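/- arXiv:1211.0168 — 4 statements merged into one kernel-verified Lean document; each statement's English description precedes it below -/
import Mathlib

section
/- Let S = K_1 ∪ K_2 be the vertex disjoint union of two cliques of weights a_1 and a_2 and orders a_1 + t_1 and a_2 + t_2 respectively, with a_1 = p_1·2^{r_1}, a_2 = p_2·2^{r_2}, t_1, t_2, r_1, r_2 ≥ 0, p_1, p_2 odd, and r_1 ≤ r_2. Then S is 2-Ramsey if and only if at least one of the following holds: (1) r_1 = r_2; (2) at least one of t_1 or t_2 equals 0, and a_1 and a_2 are both even; (3) t_1 or t_2 equals 1, and 2 ≤ r_1 < r_2. -/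
/-- An embedding of the hypercube `Q_d` into `Q_n`: an injective map on vertex sets
(identified with finite subsets of `Fin d`, resp. `Fin n`) preserving the edges,
where two vertices are adjacent iff their symmetric difference has exactly one element. -/
def IsCubeEmbedding {d n : ℕ} (ψ : Finset (Fin d) → Finset (Fin n)) : Prop :=
  Function.Injective ψ ∧
    ∀ A B : Finset (Fin d), (symmDiff A B).card = 1 → (symmDiff (ψ A) (ψ B)).card = 1

/-- `S ⊆ V_n` contains a copy of `F ⊆ V_d`. -/
def ContainsCopy {d n : ℕ} (F : Set (Finset (Fin d))) (S : Set (Finset (Fin n))) : Prop :=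
  ∃ ψ : Finset (Fin d) → Finset (Fin n), IsCubeEmbedding ψ ∧ ∀ A ∈ F, ψ A ∈ S

/-- `F ⊆ V_d` is `t`-Ramsey: for all sufficiently large `n`, every `t`-coloring of `Q_n`
contains a monochromatic copy of `F`. -/
def IsRamsey (t d : ℕ) (F : Set (Finset (Fin d))) : Prop :=
  ∃ n₀ : ℕ, ∀ n, n₀ ≤ n → ∀ c : Finset (Fin n) → Fin t,
    ∃ i : Fin t, ContainsCopy F {A | c A = i}


/-! ### Classification of cube embeddings -/

theorem tc_card_symmDiff {α : Type*} [DecidableEq α] (A B : Finset α) :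
    (symmDiff A B).card + 2 * (A ∩ B).card = A.card + B.card := by
  have h1 : (symmDiff A B).card = (A \ B).card + (B \ A).card := by
    rw [symmDiff_def]
    exact Finset.card_union_of_disjoint disjoint_sdiff_sdiff
  have h2 := Finset.card_sdiff_add_card_inter A B
  have h3 := Finset.card_sdiff_add_card_inter B A
  rw [Finset.inter_comm] at h3
  omega

theorem tc_common_nbr {α : Type*} [DecidableEq α] (B X : Finset α) (x y : α) (hxy : x ≠ y)
    (hx : x ∉ B) (hy : y ∉ B)
    (h1 : (symmDiff X (insert x B)).card = 1) (h2 : (symmDiff X (insert y B)).card = 1) :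
    X = B ∨ X = insert x (insert y B) := by
  obtain ⟨p, hp⟩ := Finset.card_eq_one.mp h1
  obtain ⟨q, hq⟩ := Finset.card_eq_one.mp h2
  have hp' : ∀ z, (z ∈ X ∧ z ∉ insert x B ∨ z ∈ insert x B ∧ z ∉ X) ↔ z = p := by
    intro z
    rw [← Finset.mem_symmDiff, hp, Finset.mem_singleton]
  have hq' : ∀ z, (z ∈ X ∧ z ∉ insert y B ∨ z ∈ insert y B ∧ z ∉ X) ↔ z = q := by
    intro z
    rw [← Finset.mem_symmDiff, hq, Finset.mem_singleton]
  simp only [Finset.mem_insert] at hp' hq'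
  by_cases hpx : p = x
  · left
    subst hpx
    ext z
    have := hp' z
    have := hq' z
    have := hq' p
    have := hp' p
    by_cases z = p <;> simp_all
    all_goals tauto
  · right
    have hpy : p = y := by
      have a1 := hp' x
      have a2 := hp' y
      have a3 := hq' x
      have a4 := hq' y
      by_contra hne
      have : x ∈ X := by
        by_contra hh
        exact hpx (a1.mp (Or.inr ⟨Or.inl rfl, hh⟩)).symm
      have hyX : y ∉ X := by
        intro hh
        apply hne
        exact (a2.mp (Or.inl ⟨hh, by simp [hy, hxy.symm]⟩)).symm
      have e1 := a3.mp (Or.inl ⟨this, by simp [hx, hxy]⟩)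
      have e2 := a4.mp (Or.inr ⟨Or.inl rfl, hyX⟩)
      exact hxy (e1.trans e2.symm)
    subst hpy
    ext z
    have hz := hp' z
    simp only [Finset.mem_insert]
    by_cases hzp : z = p
    · have hz' := hz.mpr hzp
      subst hzp
      have : z ≠ x := hpx
      tauto
    · tauto

theorem tc_embedding {d n : ℕ} (ψ : Finset (Fin d) → Finset (Fin n)) (h : IsCubeEmbedding ψ) :
    ∃ (T : Finset (Fin n)) (σ : Fin d ↪ Fin n), ∀ A, ψ A = symmDiff T (A.map σ) := by
  obtain ⟨hinj, hadj⟩ := h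
  have hs : ∀ i : Fin d, ∃ x, symmDiff (ψ ∅) (ψ {i}) = {x} := by
    intro i
    exact Finset.card_eq_one.mp (hadj _ _ (by simp [symmDiff_def]))
  choose σ hσ using hs
  have hσinj : Function.Injective σ := by
    intro i j hij
    have : symmDiff (ψ ∅) (ψ {i}) = symmDiff (ψ ∅) (ψ {j}) := by rw [hσ, hσ, hij]
    have := hinj (symmDiff_right_injective _ this)
    simpa using this
  refine ⟨ψ ∅, ⟨σ, hσinj⟩, ?_⟩
  have key : ∀ k, ∀ A : Finset (Fin d), A.card ≤ k →
      symmDiff (ψ ∅) (ψ A) = A.map ⟨σ, hσinj⟩ := by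
    intro k
    induction k with
    | zero =>
      intro A hA
      have : A = ∅ := by simpa using hA
      subst this
      simp
    | succ k ih =>
      intro A hA
      by_cases hc : A.card ≤ 1
      · rcases Nat.lt_or_ge A.card 1 with h0 | h1
        · have : A = ∅ := by simpa using h0
          subst this
          simp
        · obtain ⟨i, rfl⟩ := Finset.card_eq_one.mp (le_antisymm hc h1)
          rw [hσ]
          simp
      · push Not at hc
        obtain ⟨i, hi, j, hj, hij⟩ := Finset.one_lt_card.mp hc
        obtain ⟨C, hC, hiC, hjC⟩ : ∃ C, A = insert i (insert j C) ∧ i ∉ C ∧ j ∉ C := by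
          refine ⟨(A.erase i).erase j, ?_, by simp, by simp⟩
          rw [Finset.insert_erase (by simp [hj, hij.symm]), Finset.insert_erase hi]
        have hcard : A.card = C.card + 2 := by
          rw [hC, Finset.card_insert_of_notMem (by simp [hij, hiC]),
            Finset.card_insert_of_notMem hjC]
        have e0 := ih C (by omega)
        have e1 := ih (insert i C) (by rw [Finset.card_insert_of_notMem hiC]; omega)
        have e2 := ih (insert j C) (by rw [Finset.card_insert_of_notMem hjC]; omega)
        have adj : ∀ B, (symmDiff A B).card = 1 →
            (symmDiff (symmDiff (ψ ∅) (ψ A)) (symmDiff (ψ ∅) (ψ B))).card = 1 := by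
          intro B hB
          rw [symmDiff_symmDiff_symmDiff_comm, symmDiff_self, bot_symmDiff]
          exact hadj _ _ hB
        have f1 := adj (insert i C) (by
          rw [Finset.card_eq_one]
          refine ⟨j, ?_⟩
          ext z
          simp only [hC, Finset.mem_symmDiff, Finset.mem_insert, Finset.mem_singleton]
          by_cases z = j <;> by_cases z = i <;> simp_all <;> tauto)
        have f2 := adj (insert j C) (by
          rw [Finset.card_eq_one]
          refine ⟨i, ?_⟩
          ext z
          simp only [hC, Finset.mem_symmDiff, Finset.mem_insert, Finset.mem_singleton]
          by_cases z = j <;> by_cases z = i <;> simp_all <;> tauto)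
        rw [e1, Finset.map_insert] at f1
        rw [e2, Finset.map_insert] at f2
        rcases tc_common_nbr (C.map ⟨σ, hσinj⟩) _ (σ i) (σ j) (fun hh => hij (hσinj hh))
          (by
            rw [Finset.mem_map]
            rintro ⟨x, hx, hh⟩
            have hx' : x = i := hσinj hh
            exact hiC (hx' ▸ hx))
          (by
            rw [Finset.mem_map]
            rintro ⟨x, hx, hh⟩
            have hx' : x = j := hσinj hh
            exact hjC (hx' ▸ hx)) f1 f2 with hX | hX
        · exfalso
          rw [← e0] at hX
          have := hinj (symmDiff_right_injective _ hX)
          rw [this] at hcard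
          omega
        · rw [hX, hC]
          simp [Finset.map_insert]
  intro A
  rw [← key A.card A le_rfl, symmDiff_symmDiff_cancel_left]

/-! ### Necessity -/

theorem tc_clique_weights {d n a t : ℕ} (T : Finset (Fin n)) (σ : Fin d ↪ Fin n)
    (K : Finset (Fin d)) (hK : K.card = a + t) :
    ∃ u : ℕ, u ≤ a + t ∧ ∀ j, j ≤ a → j ≤ u → u ≤ j + t →
      ∃ X ∈ K.powersetCard a, ((symmDiff T (X.map σ)).card : ℤ) = T.card + a - 2 * j := by
  classical
  set U := K.filter (fun i => σ i ∈ T) with hU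
  set V := K.filter (fun i => σ i ∉ T) with hV
  have hUV : U.card + V.card = a + t := by
    rw [← hK, hU, hV, Finset.card_filter_add_card_filter_not]
  refine ⟨U.card, by omega, ?_⟩
  intro j hja hju hjt
  obtain ⟨X1, hX1, hc1⟩ := Finset.exists_subset_card_eq (s := U) hju
  obtain ⟨X2, hX2, hc2⟩ := Finset.exists_subset_card_eq (s := V) (n := a - j) (by omega)
  have hd : Disjoint X1 X2 := by
    rw [Finset.disjoint_left]
    intro x h1 h2
    exact (Finset.mem_filter.mp (hX2 h2)).2 (Finset.mem_filter.mp (hX1 h1)).2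
  have hXc : (X1 ∪ X2).card = a := by
    rw [Finset.card_union_of_disjoint hd]
    omega
  refine ⟨X1 ∪ X2, ?_, ?_⟩
  · rw [Finset.mem_powersetCard]
    refine ⟨Finset.union_subset (hX1.trans (Finset.filter_subset _ _))
      (hX2.trans (Finset.filter_subset _ _)), hXc⟩
  · have h := tc_card_symmDiff T ((X1 ∪ X2).map σ)
    have hi : T ∩ ((X1 ∪ X2).map σ) = X1.map σ := by
      ext z
      simp only [Finset.mem_inter, Finset.mem_map, Finset.mem_union]
      constructor
      · rintro ⟨hz, x, hx | hx, rfl⟩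
        · exact ⟨x, hx, rfl⟩
        · exact absurd hz (Finset.mem_filter.mp (hX2 hx)).2
      · rintro ⟨x, hx, rfl⟩
        exact ⟨(Finset.mem_filter.mp (hX1 hx)).2, x, Or.inl hx, rfl⟩
    rw [hi, Finset.card_map, Finset.card_map, hXc, hc1] at h
    omega

theorem tc_end_color (f : ℤ → Fin 2) (a t : ℕ) (ha : 1 ≤ a)
    (hf : (∀ x, f (x + 2) = f x) ∨ ((∀ x, f (x + 2) ≠ f x) ∧ 1 ≤ t) ∨
      ((∀ x, ¬ (f (x + 2) = f x ∧ f (x + 4) = f (x + 2))) ∧ 2 ≤ t ∧ 2 ≤ a))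
    (w : ℤ) (u : ℕ) (hu : u ≤ a + t) (i : Fin 2)
    (h : ∀ j : ℕ, j ≤ a → j ≤ u → u ≤ j + t → f (w + a - 2 * j) = i) :
    f (w + a) = i ∨ f (w - a) = i := by
  have h0 : u ≤ t → f (w + a) = i := by
    intro hh
    have := h 0 (by omega) (by omega) (by omega)
    simpa using this
  have h1 : a ≤ u → f (w - a) = i := by
    intro hh
    have := h a (by omega) (by omega) (by omega)
    have e : w + a - 2 * (a : ℤ) = w - a := by ring
    rwa [e] at this
  rcases Nat.lt_or_ge t u with htu | htu
  swap
  · exact Or.inl (h0 htu)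
  rcases Nat.lt_or_ge u a with hau | hau
  swap
  · exact Or.inr (h1 hau)
  rcases hf with hf | ⟨hf, ht⟩ | ⟨hf, ht, ha2⟩
  · left
    have hp : ∀ k : ℕ, f (w + a - 2 * k) = f (w + a) := by
      intro k
      induction k with
      | zero => simp
      | succ k ih =>
        rw [← ih, ← hf (w + a - 2 * ((k + 1 : ℕ) : ℤ))]
        congr 1
        push_cast
        ring
    rw [← hp u]
    exact h u (by omega) le_rfl (by omega)
  · exfalso
    have e1 := h u (by omega) (by omega) (by omega)
    have e2 := h (u - 1) (by omega) (by omega) (by omega)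
    apply hf (w + a - 2 * u)
    rw [e1, ← e2]
    congr 1
    omega
  · exfalso
    have e1 := h u (by omega) (by omega) (by omega)
    have e2 := h (u - 1) (by omega) (by omega) (by omega)
    have e3 := h (u - 2) (by omega) (by omega) (by omega)
    have g2 : w + a - 2 * ((u - 1 : ℕ) : ℤ) = w + a - 2 * u + 2 := by omega
    have g3 : w + a - 2 * ((u - 2 : ℕ) : ℤ) = w + a - 2 * u + 4 := by omega
    rw [g2] at e2
    rw [g3] at e3
    exact hf (w + a - 2 * u) ⟨by rw [e2, e1], by rw [e3, e2]⟩

theorem tc_not_ramsey (d a1 a2 t1 t2 p1 p2 r1 r2 : ℕ)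
    (ha1 : a1 = p1 * 2 ^ r1) (ha2 : a2 = p2 * 2 ^ r2)
    (hp1 : Odd p1) (hp2 : Odd p2) (hr : r1 < r2)
    (K1 K2 : Finset (Fin d)) (hK1 : K1.card = a1 + t1) (hK2 : K2.card = a2 + t2)
    (f : ℤ → Fin 2) (hflip : ∀ x, f (x + 2 ^ r1) ≠ f x)
    (hf : (∀ x, f (x + 2) = f x) ∨ ((∀ x, f (x + 2) ≠ f x) ∧ 1 ≤ t1 ∧ 1 ≤ t2) ∨
      ((∀ x, ¬ (f (x + 2) = f x ∧ f (x + 4) = f (x + 2))) ∧ 2 ≤ t1 ∧ 2 ≤ t2 ∧ 1 ≤ r1)) :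
    ¬ IsRamsey 2 d (↑(K1.powersetCard a1) ∪ ↑(K2.powersetCard a2)) := by
  rintro ⟨n0, hn0⟩
  obtain ⟨i, ψ, hψ, hc⟩ := hn0 n0 le_rfl (fun A => f A.card)
  obtain ⟨T, σ, hT⟩ := tc_embedding ψ hψ
  have hq1 : 1 ≤ p1 := hp1.pos
  have hq2 : 1 ≤ p2 := hp2.pos
  have h2a : 1 ≤ a1 := by rw [ha1]; exact Nat.mul_pos hq1 (by positivity)
  have h2b : 1 ≤ a2 := by rw [ha2]; exact Nat.mul_pos hq2 (by positivity)
  have h2 : 1 ≤ r1 → 2 ≤ a1 := by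
    intro h
    rw [ha1]
    calc 2 = 1 * 2 ^ 1 := rfl
      _ ≤ p1 * 2 ^ r1 := Nat.mul_le_mul hq1 (Nat.pow_le_pow_right (by norm_num) h)
  have h2' : 1 ≤ r1 → 2 ≤ a2 := by
    intro h
    rw [ha2]
    calc 2 = 1 * 2 ^ 1 := rfl
      _ ≤ p2 * 2 ^ r2 := Nat.mul_le_mul hq2 (Nat.pow_le_pow_right (by norm_num) (by omega))
  obtain ⟨u1, hu1, hw1⟩ := tc_clique_weights T σ K1 hK1
  obtain ⟨u2, hu2, hw2⟩ := tc_clique_weights T σ K2 hK2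
  have c1 : f ((T.card : ℤ) + a1) = i ∨ f ((T.card : ℤ) - a1) = i := by
    refine tc_end_color f a1 t1 h2a ?_ T.card u1 hu1 i ?_
    · rcases hf with h | h | h
      · exact Or.inl h
      · exact Or.inr (Or.inl ⟨h.1, h.2.1⟩)
      · exact Or.inr (Or.inr ⟨h.1, h.2.1, h2 h.2.2.2⟩)
    · intro j j1 j2 j3
      obtain ⟨X, hX, hX'⟩ := hw1 j j1 j2 j3
      have := hc X (Or.inl hX)
      simp only [Set.mem_ofPred_eq, hT, hX'] at this
      exact this
  have c2 : f ((T.card : ℤ) + a2) = i ∨ f ((T.card : ℤ) - a2) = i := by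
    refine tc_end_color f a2 t2 h2b ?_ T.card u2 hu2 i ?_
    · rcases hf with h | h | h
      · exact Or.inl h
      · exact Or.inr (Or.inl ⟨h.1, h.2.2⟩)
      · exact Or.inr (Or.inr ⟨h.1, h.2.2.1, h2' h.2.2.2⟩)
    · intro j j1 j2 j3
      obtain ⟨X, hX, hX'⟩ := hw2 j j1 j2 j3
      have := hc X (Or.inr hX)
      simp only [Set.mem_ofPred_eq, hT, hX'] at this
      exact this
  have hper : ∀ x, f (x + 2 * 2 ^ r1) = f x := by
    intro x
    have e1 := hflip x
    have e2 := hflip (x + 2 ^ r1)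
    rw [show x + 2 ^ r1 + 2 ^ r1 = x + 2 * 2 ^ r1 by ring] at e2
    omega
  have hperk : ∀ (k : ℕ) x, f (x + k * (2 * 2 ^ r1)) = f x := by
    intro k
    induction k with
    | zero => simp
    | succ k ih =>
      intro x
      rw [← ih x, ← hper (x + k * (2 * 2 ^ r1))]
      congr 1
      push_cast
      ring
  obtain ⟨k, hk⟩ := hp1
  have A1 : ∀ x, f (x + a1) ≠ f x := by
    intro x
    rw [show x + (a1 : ℤ) = x + 2 ^ r1 + k * (2 * 2 ^ r1) by
      rw [ha1, hk]; push_cast; ring, hperk]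
    exact hflip x
  obtain ⟨s, rfl⟩ : ∃ s, r2 = r1 + 1 + s := ⟨r2 - r1 - 1, by omega⟩
  have A2 : ∀ x, f (x + a2) = f x := by
    intro x
    rw [show x + (a2 : ℤ) = x + ((p2 * 2 ^ s : ℕ) : ℤ) * (2 * 2 ^ r1) by
      rw [ha2]; push_cast; ring, hperk]
  have B1 := A1 T.card
  have B1' := A1 (T.card - a1)
  have B2 := A2 T.card
  have B2' := A2 (T.card - a2)
  simp only [sub_add_cancel] at B1' B2'
  rcases c1 with c1 | c1 <;> rcases c2 with c2 | c2 <;> simp_all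

def tcCol (q : ℤ → ℤ) (x : ℤ) : Fin 2 := if q x % 2 = 0 then 0 else 1

theorem tcCol_eq (q : ℤ → ℤ) (x y : ℤ) : tcCol q x = tcCol q y ↔ q x % 2 = q y % 2 := by
  unfold tcCol
  split_ifs <;> simp <;> omega

theorem tc_necessity (d a1 a2 t1 t2 p1 p2 r1 r2 : ℕ)
    (ha1 : a1 = p1 * 2 ^ r1) (ha2 : a2 = p2 * 2 ^ r2)
    (hp1 : Odd p1) (hp2 : Odd p2) (hr : r1 < r2)
    (K1 K2 : Finset (Fin d)) (hK1 : K1.card = a1 + t1) (hK2 : K2.card = a2 + t2)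
    (h : r1 = 0 ∨ (r1 = 1 ∧ 1 ≤ t1 ∧ 1 ≤ t2) ∨ (2 ≤ r1 ∧ 2 ≤ t1 ∧ 2 ≤ t2)) :
    ¬ IsRamsey 2 d (↑(K1.powersetCard a1) ∪ ↑(K2.powersetCard a2)) := by
  rcases h with h | ⟨h, ht1, ht2⟩ | ⟨h, ht1, ht2⟩
  · refine tc_not_ramsey d a1 a2 t1 t2 p1 p2 r1 r2 ha1 ha2 hp1 hp2 hr K1 K2 hK1 hK2
      (tcCol fun x => x) ?_ (Or.inl ?_)
    · intro x
      rw [Ne, tcCol_eq, h]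
      omega
    · intro x
      rw [tcCol_eq]
      omega
  · refine tc_not_ramsey d a1 a2 t1 t2 p1 p2 r1 r2 ha1 ha2 hp1 hp2 hr K1 K2 hK1 hK2
      (tcCol fun x => x / 2) ?_ (Or.inr (Or.inl ⟨?_, ht1, ht2⟩))
    · intro x
      rw [Ne, tcCol_eq, h]
      omega
    · intro x
      rw [Ne, tcCol_eq]
      omega
  · obtain ⟨s, rfl⟩ : ∃ s, r1 = s + 2 := ⟨r1 - 2, by omega⟩
    have hD : (0 : ℤ) < 2 ^ s := by positivity
    have hE : (2 : ℤ) ^ (s + 2) = 4 * 2 ^ s := by ring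
    refine tc_not_ramsey d a1 a2 t1 t2 p1 p2 _ r2 ha1 ha2 hp1 hp2 hr K1 K2 hK1 hK2
      (tcCol fun x => x / 2 + x / 2 ^ (s + 2)) ?_ (Or.inr (Or.inr ⟨?_, ht1, ht2, by omega⟩))
    · intro x
      rw [Ne, tcCol_eq]
      have h1 : (x + 2 ^ (s + 2)) / 2 ^ (s + 2) = x / 2 ^ (s + 2) + 1 := by
        rw [Int.add_ediv_of_dvd_right (dvd_refl _), Int.ediv_self (by omega)]
      rw [h1]
      omega
    · intro x
      rw [tcCol_eq, tcCol_eq]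
      have m1 : x / 2 ^ (s + 2) ≤ (x + 2) / 2 ^ (s + 2) :=
        Int.ediv_le_ediv (by omega) (by omega)
      have m2 : (x + 2) / 2 ^ (s + 2) ≤ (x + 4) / 2 ^ (s + 2) :=
        Int.ediv_le_ediv (by omega) (by omega)
      have m3 : (x + 4) / 2 ^ (s + 2) ≤ (x + 2 ^ (s + 2)) / 2 ^ (s + 2) :=
        Int.ediv_le_ediv (by omega) (by omega)
      have h1 : (x + 2 ^ (s + 2)) / 2 ^ (s + 2) = x / 2 ^ (s + 2) + 1 := by
        rw [Int.add_ediv_of_dvd_right (dvd_refl _), Int.ediv_self (by omega)]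
      rw [h1] at m3
      omega

/-! ### Reduction to layered colorings (Ramsey's theorem via ultrafilters) -/

theorem tc_ulim (U : Ultrafilter ℕ) (g : ℕ → Fin 2) : ∃ i, ∀ᶠ x in (U : Filter ℕ), g x = i := by
  have : ∀ᶠ x in (U : Filter ℕ), g x = 0 ∨ g x = 1 := by
    refine Filter.Eventually.of_forall fun x => ?_
    omega
  rcases Ultrafilter.eventually_or.mp this with h | h
  · exact ⟨0, h⟩
  · exact ⟨1, h⟩

theorem tc_ramsey (c : Finset ℕ → Fin 2) :
    ∃ f : ℕ → Fin 2, ∀ N m : ℕ, ∃ M : Finset ℕ, M.card = m ∧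
      ∀ A ⊆ M, A.card ≤ N → c A = f A.card := by
  classical
  have hlim : ∀ g : Finset ℕ → Fin 2, ∃ g' : Finset ℕ → Fin 2,
      ∀ A, ∀ᶠ x in (Filter.hyperfilter ℕ : Filter ℕ), g (insert x A) = g' A := by
    intro g
    choose g' hg' using fun A : Finset ℕ => tc_ulim (Filter.hyperfilter ℕ) (fun x => g (insert x A))
    exact ⟨g', hg'⟩
  choose L hL using hlim
  set C : ℕ → Finset ℕ → Fin 2 := fun j => L^[j] c with hC
  have hCs : ∀ j A, ∀ᶠ x in (Filter.hyperfilter ℕ : Filter ℕ),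
      C j (insert x A) = C (j + 1) A := by
    intro j A
    simp only [hC, Function.iterate_succ_apply']
    exact hL _ A
  refine ⟨fun k => C k ∅, fun N m => ?_⟩
  have key : ∃ M : Finset ℕ, M.card = m ∧
      ∀ A ⊆ M, ∀ j, A.card + j ≤ N → C j A = C (A.card + j) ∅ := by
    induction m with
    | zero =>
      refine ⟨∅, rfl, ?_⟩
      intro A hA j _
      rw [Finset.subset_empty.mp hA]
      simp
    | succ m ih =>
      obtain ⟨M, hM, hMc⟩ := ih
      have h1 : ∀ᶠ x in (Filter.hyperfilter ℕ : Filter ℕ),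
          ∀ A ∈ M.powerset, ∀ j ∈ Finset.range (N + 1), C j (insert x A) = C (j + 1) A := by
        rw [Filter.eventually_all_finset]
        intro A _
        rw [Filter.eventually_all_finset]
        intro j _
        exact hCs j A
      have h2 : ∀ᶠ x in (Filter.hyperfilter ℕ : Filter ℕ), x ∉ M := by
        have : (M : Set ℕ)ᶜ ∈ Filter.hyperfilter ℕ := M.finite_toSet.compl_mem_hyperfilter
        exact this
      obtain ⟨x, hx1, hx2⟩ := (h1.and h2).exists
      refine ⟨insert x M, by rw [Finset.card_insert_of_notMem hx2, hM], ?_⟩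
      intro A hA j hj
      by_cases hxA : x ∈ A
      · have hsub : A.erase x ⊆ M := by
          rw [← Finset.subset_insert_iff]
          exact hA
        have hcard := Finset.card_erase_add_one hxA
        have := hx1 (A.erase x) (Finset.mem_powerset.mpr hsub) j
          (Finset.mem_range.mpr (by omega))
        rw [Finset.insert_erase hxA] at this
        rw [this, hMc _ hsub (j + 1) (by omega)]
        congr 1
        omega
      · exact hMc A ((Finset.subset_insert_iff_of_notMem hxA).mp hA) j hj
  obtain ⟨M, hM, hMc⟩ := key
  refine ⟨M, hM, fun A hA hAN => ?_⟩
  exact hMc A hA 0 (by simpa using hAN)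

theorem tc_map_embedding {m n : ℕ} (e : Fin m ↪ Fin n) :
    IsCubeEmbedding (fun A : Finset (Fin m) => A.map e) := by
  refine ⟨Finset.map_injective e, fun A B h => ?_⟩
  have h1 := tc_card_symmDiff A B
  have h2 := tc_card_symmDiff (A.map e) (B.map e)
  rw [← Finset.map_inter, Finset.card_map, Finset.card_map, Finset.card_map] at h2
  show (symmDiff (A.map e) (B.map e)).card = 1
  omega

theorem tc_layered {d : ℕ} (F : Set (Finset (Fin d)))
    (h : ∀ f : ℕ → Fin 2, ∃ (m : ℕ) (i : Fin 2),
      ContainsCopy F {A : Finset (Fin m) | f A.card = i}) : IsRamsey 2 d F := by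
  classical
  by_contra hR
  unfold IsRamsey at hR
  push Not at hR
  choose n hn c hc using hR
  have hlim := fun A : Finset ℕ => tc_ulim (Filter.hyperfilter ℕ)
    (fun N => c N (Finset.univ.filter fun x : Fin (n N) => (x : ℕ) ∈ A))
  choose g hg using hlim
  obtain ⟨f, hf⟩ := tc_ramsey g
  obtain ⟨m, i, ψ, hψ, hψF⟩ := h f
  obtain ⟨M, hM, hMc⟩ := hf m m
  have h1 : ∀ᶠ N in (Filter.hyperfilter ℕ : Filter ℕ), ∀ A ∈ M.powerset,
      c N (Finset.univ.filter fun x : Fin (n N) => (x : ℕ) ∈ A) = g A := by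
    rw [Filter.eventually_all_finset]
    intro A _
    exact hg A
  have h2 : ∀ᶠ N in (Filter.hyperfilter ℕ : Filter ℕ), M.sup id + 1 ≤ N := by
    apply Filter.Eventually.filter_mono Nat.hyperfilter_le_atTop
    exact Filter.eventually_ge_atTop _
  obtain ⟨N, hN1, hN2⟩ := (h1.and h2).exists
  have hlt : ∀ x ∈ M, x < n N := by
    intro x hx
    have : x ≤ M.sup id := Finset.le_sup (f := id) hx
    have := hn N
    omega
  let e : Fin m ↪ Fin (n N) :=
    ⟨fun k => ⟨M.orderEmbOfFin hM k, hlt _ (Finset.orderEmbOfFin_mem M hM k)⟩, by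
      intro k l hkl
      simpa using hkl⟩
  have he : ∀ k, ((e k : Fin (n N)) : ℕ) ∈ M := fun k => Finset.orderEmbOfFin_mem M hM k
  refine hc N i ⟨fun A => (ψ A).map e, ⟨?_, ?_⟩, ?_⟩
  · exact (Finset.map_injective e).comp hψ.1
  · intro A B hAB
    exact (tc_map_embedding e).2 _ _ (hψ.2 A B hAB)
  · intro A hA
    have hmem : f (ψ A).card = i := hψF A hA
    set B : Finset ℕ := ((ψ A).map e).map Fin.valEmbedding with hB
    have hBM : B ⊆ M := by
      intro x hx
      simp only [hB, Finset.mem_map] at hx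
      obtain ⟨y, ⟨k, _, rfl⟩, rfl⟩ := hx
      exact he k
    have hBc : B.card = (ψ A).card := by simp [hB]
    have hle : B.card ≤ m := by
      rw [← hM]
      exact Finset.card_le_card hBM
    have e1 := hN1 B (Finset.mem_powerset.mpr hBM)
    have e2 := hMc B hBM hle
    have e3 : (Finset.univ.filter fun x : Fin (n N) => (x : ℕ) ∈ B) = (ψ A).map e := by
      ext x
      simp only [hB, Finset.mem_filter, Finset.mem_univ, true_and, Finset.mem_map,
        Fin.valEmbedding_apply]
      constructor
      · rintro ⟨y, hy, hyx⟩
        rwa [← Fin.ext hyx]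
      · intro hx
        exact ⟨x, hx, rfl⟩
    show c N ((ψ A).map e) = i
    rw [← e3, e1, e2, hBc, hmem]

/-! ### Sufficiency -/

theorem tc_copy {d a1 a2 t1 t2 : ℕ} (K1 K2 : Finset (Fin d)) (hK1 : K1.card = a1 + t1)
    (hK2 : K2.card = a2 + t2) (hdisj : Disjoint K1 K2) (f : ℕ → Fin 2) (w u1 u2 : ℕ) (i : Fin 2)
    (hu1 : u1 ≤ a1 + t1) (hu2 : u2 ≤ a2 + t2) (hw : u1 + u2 ≤ w)
    (h1 : ∀ j, j ≤ a1 → j ≤ u1 → u1 ≤ j + t1 → f (w + a1 - 2 * j) = i)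
    (h2 : ∀ j, j ≤ a2 → j ≤ u2 → u2 ≤ j + t2 → f (w + a2 - 2 * j) = i) :
    ∃ (m : ℕ) (i : Fin 2),
      ContainsCopy (↑(K1.powersetCard a1) ∪ ↑(K2.powersetCard a2) : Set (Finset (Fin d)))
        {A : Finset (Fin m) | f A.card = i} := by
  classical
  obtain ⟨U1, hU1, hc1⟩ := Finset.exists_subset_card_eq (s := K1) (n := u1) (by omega)
  obtain ⟨U2, hU2, hc2⟩ := Finset.exists_subset_card_eq (s := K2) (n := u2) (by omega)
  have hUd : Disjoint U1 U2 := Finset.disjoint_of_subset_left hU1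
    (Finset.disjoint_of_subset_right hU2 hdisj)
  obtain ⟨e, rfl⟩ : ∃ e, w = u1 + u2 + e := ⟨w - (u1 + u2), by omega⟩
  set U := U1 ∪ U2 with hU
  have hUc : U.card = u1 + u2 := by rw [hU, Finset.card_union_of_disjoint hUd, hc1, hc2]
  let E : Finset (Fin (d + e)) := Finset.univ.map (Fin.natAddEmb d)
  have hEc : E.card = e := by simp [E]
  let σ : Fin d ↪ Fin (d + e) := Fin.castAddEmb e
  have hσE : ∀ A : Finset (Fin d), Disjoint (A.map σ) E := by
    intro A
    rw [Finset.disjoint_left]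
    intro x hx hxE
    simp only [Finset.mem_map, E, σ, Finset.mem_univ, true_and] at hx hxE
    obtain ⟨y, _, rfl⟩ := hx
    obtain ⟨z, hz⟩ := hxE
    have := congrArg Fin.val hz
    simp at this
    omega
  have hcard : ∀ A : Finset (Fin d), (symmDiff (U.map σ ∪ E) (A.map σ)).card + 2 * (U ∩ A).card
      = u1 + u2 + e + A.card := by
    intro A
    have h := tc_card_symmDiff (U.map σ ∪ E) (A.map σ)
    rw [Finset.union_inter_distrib_right, Finset.disjoint_iff_inter_eq_empty.mp (hσE A).symm,
      Finset.union_empty, ← Finset.map_inter, Finset.card_map, Finset.card_map,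
      Finset.card_union_of_disjoint (hσE U), Finset.card_map, hUc, hEc] at h
    exact h
  refine ⟨d + e, i, fun A => symmDiff (U.map σ ∪ E) (A.map σ), ⟨?_, ?_⟩, ?_⟩
  · intro A B hAB
    exact Finset.map_injective σ (symmDiff_right_injective _ hAB)
  · intro A B hAB
    show (symmDiff (symmDiff (U.map σ ∪ E) (A.map σ))
      (symmDiff (U.map σ ∪ E) (B.map σ))).card = 1
    rw [symmDiff_symmDiff_symmDiff_comm, symmDiff_self, bot_symmDiff]
    exact (tc_map_embedding σ).2 A B hAB
  · rintro A (hA | hA)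
    · rw [Finset.mem_coe, Finset.mem_powersetCard] at hA
      obtain ⟨hAK, hAc⟩ := hA
      have hi : U ∩ A = U1 ∩ A := by
        rw [hU, Finset.union_inter_distrib_right, Finset.disjoint_iff_inter_eq_empty.mp
          (Finset.disjoint_of_subset_left hU2 (Finset.disjoint_of_subset_right hAK hdisj.symm)),
          Finset.union_empty]
      have hA' := hcard A
      rw [hi, hAc] at hA'
      have l1 : (U1 ∩ A).card ≤ a1 := by
        rw [← hAc]; exact Finset.card_le_card Finset.inter_subset_right
      have l2 : (U1 ∩ A).card ≤ u1 := by
        rw [← hc1]; exact Finset.card_le_card Finset.inter_subset_left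
      have l3 : u1 ≤ (U1 ∩ A).card + t1 := by
        have q1 := Finset.card_union_add_card_inter U1 A
        have q2 := Finset.card_le_card (Finset.union_subset hU1 hAK)
        omega
      have := h1 _ l1 l2 l3
      show f (symmDiff (U.map σ ∪ E) (A.map σ)).card = i
      rw [← this]
      congr 1
      omega
    · rw [Finset.mem_coe, Finset.mem_powersetCard] at hA
      obtain ⟨hAK, hAc⟩ := hA
      have hi : U ∩ A = U2 ∩ A := by
        rw [hU, Finset.union_inter_distrib_right, Finset.disjoint_iff_inter_eq_empty.mp
          (Finset.disjoint_of_subset_left hU1 (Finset.disjoint_of_subset_right hAK hdisj)),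
          Finset.empty_union]
      have hA' := hcard A
      rw [hi, hAc] at hA'
      have l1 : (U2 ∩ A).card ≤ a2 := by
        rw [← hAc]; exact Finset.card_le_card Finset.inter_subset_right
      have l2 : (U2 ∩ A).card ≤ u2 := by
        rw [← hc2]; exact Finset.card_le_card Finset.inter_subset_left
      have l3 : u2 ≤ (U2 ∩ A).card + t2 := by
        have q1 := Finset.card_union_add_card_inter U2 A
        have q2 := Finset.card_le_card (Finset.union_subset hU2 hAK)
        omega
      have := h2 _ l1 l2 l3
      show f (symmDiff (U.map σ ∪ E) (A.map σ)).card = i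
      rw [← this]
      congr 1
      omega

/-- No monochromatic configuration for the layered coloring `f`. -/
def TcBad (f : ℕ → Fin 2) (a1 t1 a2 t2 : ℕ) : Prop :=
  ∀ (w u1 u2 : ℕ) (i : Fin 2), u1 ≤ a1 + t1 → u2 ≤ a2 + t2 → a1 + t1 + (a2 + t2) ≤ w →
    (∀ j, j ≤ a1 → j ≤ u1 → u1 ≤ j + t1 → f (w + a1 - 2 * j) = i) →
    (∀ j, j ≤ a2 → j ≤ u2 → u2 ≤ j + t2 → f (w + a2 - 2 * j) = i) → False

theorem TcBad.swap {f : ℕ → Fin 2} {a1 t1 a2 t2 : ℕ} (h : TcBad f a1 t1 a2 t2) :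
    TcBad f a2 t2 a1 t1 :=
  fun w u1 u2 i h1 h2 h3 h4 h5 => h w u2 u1 i h2 h1 (by omega) h5 h4

theorem TcBad.pp {f : ℕ → Fin 2} {a1 t1 a2 t2 : ℕ} (h : TcBad f a1 t1 a2 t2) (w : ℕ)
    (hw : a1 + t1 + (a2 + t2) ≤ w) : f (w + a1) ≠ f (w + a2) := by
  intro he
  refine h w 0 0 (f (w + a1)) (by omega) (by omega) hw ?_ ?_
  · intro j _ hj _
    congr 1
    omega
  · intro j _ hj _
    rw [he]
    congr 1
    omega

theorem TcBad.pm {f : ℕ → Fin 2} {a1 t1 a2 t2 : ℕ} (h : TcBad f a1 t1 a2 t2) (w : ℕ)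
    (hw : a1 + t1 + (a2 + t2) ≤ w) : f (w + a1) ≠ f (w - a2) := by
  intro he
  refine h w 0 (a2 + t2) (f (w + a1)) (by omega) (by omega) hw ?_ ?_
  · intro j _ hj _
    congr 1
    omega
  · intro j _ hj _
    rw [he]
    congr 1
    omega

theorem TcBad.per {f : ℕ → Fin 2} {a1 t1 a2 t2 : ℕ} (h : TcBad f a1 t1 a2 t2) (k x : ℕ)
    (hx : a1 + t1 + (a2 + t2) ≤ x) : f (x + k * (2 * a1)) = f x := by
  have h1 : ∀ x, a1 + t1 + (a2 + t2) ≤ x → f (x + 2 * a1) = f x := by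
    intro x hx
    have e1 := h.pp (x + a1) (by omega)
    have e2 := h.swap.pm (x + a1) (by omega)
    rw [show x + a1 - a1 = x by omega] at e2
    rw [show x + a1 + a1 = x + 2 * a1 by ring] at e1
    omega
  induction k with
  | zero => simp
  | succ k ih =>
    rw [← ih, ← h1 (x + k * (2 * a1)) (by omega)]
    congr 1
    ring

theorem tc_case_one {f : ℕ → Fin 2} {a1 t1 a2 t2 p1 p2 r : ℕ} (ha1 : a1 = p1 * 2 ^ r)
    (ha2 : a2 = p2 * 2 ^ r) (hp1 : Odd p1) (hp2 : Odd p2) (h : TcBad f a1 t1 a2 t2) : False := by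
  obtain ⟨l, hl⟩ := hp1
  obtain ⟨k, hk⟩ := hp2
  set w := a1 + t1 + (a2 + t2) with hw
  apply h.pp w le_rfl
  rw [← h.per k (w + a1) (by omega), ← h.swap.per l (w + a2) (by omega)]
  congr 1
  rw [ha1, ha2, hl, hk]
  ring

theorem tc_case_two {f : ℕ → Fin 2} {a1 a2 t2 : ℕ} (h1 : 1 ≤ a1) (he1 : Even a1)
    (he2 : Even a2) (h : TcBad f a1 0 a2 t2) : False := by
  obtain ⟨b, hb⟩ := he1
  obtain ⟨k, hk⟩ := he2
  have key : ∀ w u, u ≤ a1 → a1 + (a2 + t2) ≤ w → f (w + a1 - 2 * u) ≠ f (w + a2) := by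
    intro w u hu hw he
    refine h w u 0 (f (w + a2)) (by omega) (by omega) (by omega) ?_ ?_
    · intro j _ hj1 hj2
      rw [← he]
      congr 1
      omega
    · intro j _ hj _
      congr 1
      omega
  have step : ∀ w, a1 + (a2 + t2) ≤ w → f (w + 2) = f w := by
    intro w hw
    have e1 := key w b (by omega) hw
    have e2 := key w (b - 1) (by omega) hw
    rw [show w + a1 - 2 * b = w by omega] at e1
    rw [show w + a1 - 2 * (b - 1) = w + 2 by omega] at e2
    omega
  have hper : ∀ j w, a1 + (a2 + t2) ≤ w → f (w + 2 * j) = f w := by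
    intro j
    induction j with
    | zero => simp
    | succ j ih =>
      intro w hw
      rw [← ih w hw, ← step (w + 2 * j) (by omega)]
      congr 1
  have e1 := key (a1 + (a2 + t2)) b (by omega) le_rfl
  apply e1
  rw [show a1 + (a2 + t2) + a1 - 2 * b = a1 + (a2 + t2) by omega, hk,
    ← two_mul, hper]
  omega

theorem tc_case_three {f : ℕ → Fin 2} {a1 a2 t2 : ℕ} (h1 : 1 ≤ a1) (he1 : 4 ∣ a1)
    (he2 : 4 ∣ a2) (h : TcBad f a1 1 a2 t2) : False := by
  have key : ∀ w u, 1 ≤ u → u ≤ a1 → a1 + 1 + (a2 + t2) ≤ w → f (w + a1 - 2 * u) = f (w + a2) →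
      f (w + a1 - 2 * u + 2) ≠ f (w + a1 - 2 * u) := by
    intro w u hu1 hu hw he he'
    refine h w u 0 (f (w + a2)) (by omega) (by omega) (by omega) ?_ ?_
    · intro j _ hj1 hj2
      rcases Nat.lt_or_ge j u with hj | hj
      · rw [← he, ← he']
        congr 1
        omega
      · rw [← he]
        congr 1
        omega
    · intro j _ hj _
      congr 1
      omega
  have hdm := Nat.div_add_mod a2 (2 * a1)
  have hml := Nat.mod_lt a2 (show 0 < 2 * a1 by omega)
  have hm2 : 2 ∣ a2 % (2 * a1) := (Nat.dvd_mod_iff (Dvd.intro _ rfl)).mpr (by omega)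
  set r := a2 % (2 * a1) with hr
  set q := a2 / (2 * a1) with hq
  set B := a1 + 1 + (a2 + t2) with hB
  have hne : ∃ B', ∀ x, B' ≤ x → f (x + 2) ≠ f x := by
    refine ⟨B + 2 * a1, fun x hx => ?_⟩
    rcases Nat.lt_or_ge r a1 with hlt | hge
    · have := key (x - r) ((a1 - r) / 2) (by omega) (by omega) (by omega)
      rw [show x - r + a1 - 2 * ((a1 - r) / 2) = x by omega] at this
      apply this
      rw [← h.per q x (by omega)]
      congr 1
      rw [mul_comm q]
      omega
    · have := key (x + (2 * a1 - r)) ((3 * a1 - r) / 2) (by omega) (by omega) (by omega)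
      rw [show x + (2 * a1 - r) + a1 - 2 * ((3 * a1 - r) / 2) = x by omega] at this
      apply this
      rw [← h.per (q + 1) x (by omega)]
      congr 1
      rw [mul_comm (q + 1), mul_add]
      omega
  obtain ⟨B', hB'⟩ := hne
  have hper : ∀ j w, B' ≤ w → f (w + 4 * j) = f w := by
    intro j
    induction j with
    | zero => simp
    | succ j ih =>
      intro w hw
      rw [← ih w hw]
      have e1 := hB' (w + 4 * j) (by omega)
      have e2 := hB' (w + 4 * j + 2) (by omega)
      rw [show w + 4 * (j + 1) = w + 4 * j + 2 + 2 by ring]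
      omega
  obtain ⟨x, hx⟩ := he1
  obtain ⟨y, hy⟩ := he2
  apply h.pp (B + B') (by omega)
  have g1 := hper x (B + B') (by omega)
  have g2 := hper y (B + B') (by omega)
  rw [← hx] at g1
  rw [← hy] at g2
  rw [g1, g2]

/-- Theorem 11 (2cliques:thm): let `S = K_1 ∪ K_2` be the vertex disjoint union of two
cliques of weights `a1, a2` and orders `a1 + t1, a2 + t2`, with `a1 = p1·2^r1`,
`a2 = p2·2^r2`, `p1, p2` odd and `r1 ≤ r2`. Then `S` is `2`-Ramsey iff at least one of
the following holds: (1) `r1 = r2`; (2) at least one of `t1, t2` is `0` and `a1, a2`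
are both even; (3) `t1` or `t2` equals `1` and `2 ≤ r1 < r2`. -/
theorem two_cliques_ramsey_iff (d a1 a2 t1 t2 p1 p2 r1 r2 : ℕ)
    (ha1 : a1 = p1 * 2 ^ r1) (ha2 : a2 = p2 * 2 ^ r2)
    (hp1 : Odd p1) (hp2 : Odd p2) (hr : r1 ≤ r2)
    (K1 K2 : Finset (Fin d)) (hK1 : K1.card = a1 + t1) (hK2 : K2.card = a2 + t2)
    (hdisj : Disjoint K1 K2) :
    IsRamsey 2 d (↑(K1.powersetCard a1) ∪ ↑(K2.powersetCard a2)) ↔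
      (r1 = r2 ∨
        ((t1 = 0 ∨ t2 = 0) ∧ Even a1 ∧ Even a2) ∨
        ((t1 = 1 ∨ t2 = 1) ∧ 2 ≤ r1 ∧ r1 < r2)) := by
  have hq1 : 1 ≤ p1 := hp1.pos
  have hq2 : 1 ≤ p2 := hp2.pos
  have hb1 : 1 ≤ a1 := by rw [ha1]; exact Nat.mul_pos hq1 (by positivity)
  have hb2 : 1 ≤ a2 := by rw [ha2]; exact Nat.mul_pos hq2 (by positivity)
  have hev1 : Even a1 → 1 ≤ r1 := by
    intro h
    by_contra hc
    have : r1 = 0 := by omega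
    subst this
    rw [ha1, pow_zero, mul_one] at h
    exact (Nat.not_even_iff_odd.mpr hp1) h
  have hev : 1 ≤ r1 → Even a1 ∧ Even a2 := by
    intro h
    constructor
    · rw [ha1]
      exact (even_two.pow_of_ne_zero (by omega)).mul_left _
    · rw [ha2]
      exact (even_two.pow_of_ne_zero (by omega)).mul_left _
  constructor
  · intro h
    by_contra hcon
    rw [not_or, not_or] at hcon
    obtain ⟨n1, n2, n3⟩ := hcon
    refine tc_necessity d a1 a2 t1 t2 p1 p2 r1 r2 ha1 ha2 hp1 hp2 (by omega) K1 K2 hK1 hK2 ?_ h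
    rcases Nat.eq_zero_or_pos r1 with h0 | h0
    · exact Or.inl h0
    · have hz : ¬ (t1 = 0 ∨ t2 = 0) := fun hz => n2 ⟨hz, hev h0⟩
      right
      omega
  · intro h
    apply tc_layered
    intro f
    by_contra hno
    have hbad : TcBad f a1 t1 a2 t2 := by
      intro w u1 u2 i hu1 hu2 hw h1 h2
      exact hno (tc_copy K1 K2 hK1 hK2 hdisj f w u1 u2 i hu1 hu2 (by omega) h1 h2)
    rcases h with h | ⟨h, he1, he2⟩ | ⟨h, hr1, hr2⟩
    · subst h
      exact tc_case_one ha1 ha2 hp1 hp2 hbad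
    · rcases h with h | h
      · subst h
        exact tc_case_two hb1 he1 he2 hbad
      · subst h
        exact tc_case_two hb2 he2 he1 hbad.swap
    · have d1 : 4 ∣ a1 := by
        rw [ha1]
        exact Dvd.dvd.mul_left (pow_dvd_pow 2 hr1) _
      have d2 : 4 ∣ a2 := by
        rw [ha2]
        exact Dvd.dvd.mul_left (pow_dvd_pow 2 (hr1.trans hr)) _
      rcases h with h | h
      · subst h
        exact tc_case_three hb1 d1 d2 hbad
      · subst h
        exact tc_case_three hb2 d2 d1 hbad.swap
end

section
/- A vertex disjoint union of three cliques of pairwise distinct weights is 2-Ramsey if and only if the union of each pair of the three cliques is 2-Ramsey. -/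
namespace Cliq
open Polynomial

/-- the shift operator -/
noncomputable def T : Module.End ℝ (ℤ → ℝ) where
  toFun f := fun x => f (x + 1)
  map_add' _ _ := rfl
  map_smul' _ _ := rfl

lemma T_pow (n : ℕ) (f : ℤ → ℝ) (x : ℤ) : (T ^ n) f x = f (x + n) := by
  induction n generalizing x with
  | zero => simp
  | succ n ih =>
    rw [pow_succ', Module.End.mul_apply]
    show (T ^ n) f (x + 1) = _
    rw [ih]; push_cast; congr 1; ring

lemma act_plus (n : ℕ) (f : ℤ → ℝ) : aeval T (1 + X ^ n : ℝ[X]) f = fun x => f x + f (x + n) := by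
  funext x
  simp [T_pow]

lemma act_minus (n : ℕ) (f : ℤ → ℝ) : aeval T (1 - X ^ n : ℝ[X]) f = fun x => f x - f (x + n) := by
  funext x
  simp [T_pow]

lemma act_coprime {p q : ℝ[X]} (h : IsCoprime p q) {f : ℤ → ℝ} (hp : aeval T p f = 0)
    (hq : aeval T q f = 0) : f = 0 := by
  obtain ⟨u, v, huv⟩ := h
  have : aeval T (u * p + v * q) f = f := by rw [huv]; simp
  rw [← this]
  simp [hp, hq]

lemma coprime_pm {a b : ℕ} (h : emultiplicity 2 b ≤ emultiplicity 2 a) :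
    IsCoprime (1 + X ^ a : ℝ[X]) (1 - X ^ b) := by
  obtain ⟨o, n, ho, e⟩ : ∃ o n : ℕ, Odd o ∧ a * o = b * n := by
    rcases Nat.eq_zero_or_pos b with rfl | hb
    · rcases Nat.eq_zero_or_pos a with rfl | ha
      · exact ⟨1, 0, odd_one, by simp⟩
      · exfalso
        have : FiniteMultiplicity 2 a := Nat.finiteMultiplicity_iff.2 ⟨by norm_num, ha⟩
        simp at h
        obtain ⟨n, hn⟩ := this
        exact hn (h n)
    · obtain ⟨k, o, ho, rfl⟩ := Nat.exists_eq_two_pow_mul_odd hb.ne'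
      have h1 : 2 ^ k ∣ a := by
        apply pow_dvd_of_le_emultiplicity
        refine le_trans ?_ h
        apply le_emultiplicity_of_pow_dvd (Dvd.intro _ rfl)
      obtain ⟨n, rfl⟩ := h1
      exact ⟨o, n, ho, by ring⟩
  -- 1 + X^a ∣ 1 + X^(a o), 1 - X^b ∣ 1 - X^(b n)
  have d1 : (1 + X ^ a : ℝ[X]) ∣ 1 + X ^ (a * o) := by
    have := ho.add_dvd_pow_add_pow (1 : ℝ[X]) (X ^ a)
    simpa [pow_mul] using this
  have d2 : (1 - X ^ b : ℝ[X]) ∣ 1 - X ^ (b * n) := by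
    have := sub_dvd_pow_sub_pow (1 : ℝ[X]) (X ^ b) n
    simpa [pow_mul] using this
  rw [e] at d1
  obtain ⟨u, hu⟩ := d1
  obtain ⟨v, hv⟩ := d2
  refine ⟨C (1/2) * u, C (1/2) * v, ?_⟩
  have : C (1/2) * u * (1 + X ^ a) + C (1/2) * v * (1 - X ^ b : ℝ[X])
     = C (1/2) * ((1 + X ^ a) * u + (1 - X ^ b) * v) := by ring
  rw [this, ← hu, ← hv]
  have : (1 + X ^ (b * n) + (1 - X ^ (b * n)) : ℝ[X]) = C 2 := by
    rw [show (C 2 : ℝ[X]) = 2 from rfl]; ring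
  rw [this, ← C_mul]; norm_num

/-- sum over a period -/
def S (L : ℕ) (f : ℤ → ℝ) : ℝ := ∑ b ∈ Finset.range L, f b

lemma S_add (L : ℕ) (f g : ℤ → ℝ) : S L (fun x => f x + g x) = S L f + S L g := by
  simp [S, Finset.sum_add_distrib]

lemma S_smul (L : ℕ) (r : ℝ) (f : ℤ → ℝ) : S L (fun x => r * f x) = r * S L f := by
  simp [S, Finset.mul_sum]

lemma S_shift1 (L : ℕ) (f : ℤ → ℝ) (h : ∀ x, f (x + L) = f x) :
    S L (fun x => f (x + 1)) = S L f := by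
  unfold S
  have h1 := Finset.sum_range_succ' (fun b : ℕ => f b) L
  have h2 := Finset.sum_range_succ (fun b : ℕ => f b) L
  have h3 := h 0
  simp at h1 h2 h3
  linarith

lemma S_shift (L : ℕ) (f : ℤ → ℝ) (h : ∀ x, f (x + L) = f x) (k : ℤ) :
    S L (fun x => f (x + k)) = S L f := by
  induction k using Int.induction_on with
  | zero => simp
  | succ n ih =>
    rw [← ih, ← S_shift1 L (fun x => f (x + n))]
    · congr 1; funext x; congr 1; ring
    · intro x; rw [← h (x + n)]; congr 1; ring
  | pred n ih =>
    rw [← ih, ← S_shift1 L (fun x => f (x + (-n - 1)))]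
    · congr 1; funext x; congr 1; ring
    · intro x; rw [← h (x + (-n - 1))]; congr 1; ring

lemma S_step (L : ℕ) (s : ℝ) (hs : s * s = 1) (k : ℤ) (f g : ℤ → ℝ) (hf : ∀ x, f (x + L) = f x)
    (hg : ∀ x, g (x + L) = g x) :
    S L (fun x => (f x + s * f (x + k)) * (g x + s * g (x + k))) =
      S L (fun x => f x * (2 * g x + s * (g (x + k) + g (x - k)))) := by
  have e1 : (fun x => (f x + s * f (x + k)) * (g x + s * g (x + k))) =
    fun x => (f x * (g x + s * g (x + k)) + (f (x + k) * g (x + k) + s * (f (x+k) * g (x + k - k)))) := by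
    funext x
    rw [show x + k - k = x by ring]
    linear_combination (f (x + k) * g (x+k)) * hs
  rw [e1, S_add]
  have e2 := S_shift L (fun x => (f x * g x + s * (f x * g (x - k)))) (by
    intro x; simp only [hf, hg]
    rw [show x + L - k = x - k + L by ring, hg]) k
  rw [e2, ← S_add]
  congr 1; funext x; ring

lemma S_adj (L : ℕ) (k : ℤ) (f g : ℤ → ℝ) (hf : ∀ x, f (x + L) = f x)
    (hg : ∀ x, g (x + L) = g x) :
    S L (fun x => f x * (g (x + k) + g (x - k))) = S L (fun x => (f (x + k) + f (x - k)) * g x) := by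
  have e1 := S_shift L (fun x => f x * g (x + k)) (by
    intro x; simp only [hf]
    rw [show x + L + k = x + k + L by ring, hg]) (-k)
  have e2 := S_shift L (fun x => f x * g (x - k)) (by
    intro x; simp only [hf]
    rw [show x + L - k = x - k + L by ring, hg]) (k)
  have : (fun x => f x * (g (x + k) + g (x - k))) = fun x => f x * g (x + k) + f x * g (x-k) := by
    funext x; ring
  rw [this, S_add, ← e1, ← e2, ← S_add]
  congr 1; funext x
  rw [show x + -k + k = x by ring, show x + k - k = x by ring, show x + -k = x - k by ring]
  ring

/-- shift combination -/
def D (s : ℝ) (k : ℤ) (f : ℤ → ℝ) : ℤ → ℝ := fun x => f x + s * f (x + k)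
def M (s : ℝ) (k : ℤ) (f : ℤ → ℝ) : ℤ → ℝ := fun x => 2 * f x + s * (f (x + k) + f (x - k))

lemma D_per {L : ℕ} {s : ℝ} {k : ℤ} {f : ℤ → ℝ} (hf : ∀ x, f (x + L) = f x) :
    ∀ x, D s k f (x + L) = D s k f x := by
  intro x; simp only [D, hf]; rw [show x + L + k = x + k + L by ring, hf]

lemma M_per {L : ℕ} {s : ℝ} {k : ℤ} {f : ℤ → ℝ} (hf : ∀ x, f (x + L) = f x) :
    ∀ x, M s k f (x + L) = M s k f x := by
  intro x; simp only [M, hf]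
  rw [show x + L + k = x + k + L by ring, hf, show x + L - k = x - k + L by ring, hf]

lemma MD (s s' : ℝ) (k l : ℤ) (f : ℤ → ℝ) : M s k (D s' l f) = D s' l (M s k f) := by
  funext x; simp only [M, D]
  rw [show x + l + k = x + k + l by ring, show x + l - k = x - k + l by ring]; ring

lemma S_cube (L : ℕ) (s : ℝ) (hs : s * s = 1) (k1 k2 k3 : ℤ) (f : ℤ → ℝ)
    (hf : ∀ x, f (x + L) = f x) :
    S L (fun x => D s k1 (D s k2 (D s k3 f)) x * D s k1 (D s k2 (D s k3 f)) x) =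
      S L (fun x => f x * M s k3 (M s k2 (M s k1 f)) x) := by
  have h1 := S_step L s hs k1 _ _ (D_per (s := s) (k := k2) (D_per (s := s) (k := k3) hf)) (D_per (s := s) (k := k2) (D_per (s := s) (k := k3) hf))
  have h2 := S_step L s hs k2 _ _ (D_per (s := s) (k := k3) hf) (D_per (s := s) (k := k3) (M_per (s := s) (k := k1) hf))
  have h3 := S_step L s hs k3 _ _ hf (M_per (s := s) (k := k2) (M_per (s := s) (k := k1) hf))
  change S L (fun x => D s k1 (D s k2 (D s k3 f)) x * D s k1 (D s k2 (D s k3 f)) x) =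
    S L (fun x => (D s k2 (D s k3 f)) x * M s k1 (D s k2 (D s k3 f)) x) at h1
  change S L (fun x => D s k2 (D s k3 f) x * D s k2 (D s k3 (M s k1 f)) x) =
    S L (fun x => (D s k3 f) x * M s k2 (D s k3 (M s k1 f)) x) at h2
  change S L (fun x => D s k3 f x * D s k3 (M s k2 (M s k1 f)) x) =
    S L (fun x => f x * M s k3 (M s k2 (M s k1 f)) x) at h3
  rw [h1, MD, MD, h2, MD, h3]

lemma S_zero (L : ℕ) (hL : 0 < L) (g : ℤ → ℝ) (hg : ∀ x, g (x + L) = g x) (h0 : ∀ x, 0 ≤ g x)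
    (hS : S L g = 0) : g = 0 := by
  unfold S at hS
  rw [Finset.sum_eq_zero_iff_of_nonneg (f := fun b : ℕ => g b) (fun i _ => h0 i)] at hS
  funext x
  have hper : Function.Periodic g (L : ℤ) := hg
  have hx : g (x % L) = g x := by
    rw [Int.emod_def, mul_comm]
    exact hper.sub_int_mul_eq (x / L)
  have hp : (0:ℤ) < L := by exact_mod_cast hL
  have h1 := Int.emod_nonneg x hp.ne'
  have h2 := Int.emod_lt_of_pos x hp
  have := hS (x % L).toNat (by simp; omega)
  rw [Int.toNat_of_nonneg h1, hx] at this
  simpa using this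

/-- The spectral lemma. -/
lemma spectral (L : ℕ) (hL : 0 < L) (k1 k2 k3 : ℤ) (f : ℤ → ℝ) (hf : ∀ x, f (x + L) = f x)
    (h1 : ∀ x, f x * f x = 1)
    (h : ∀ b, 4 + (f (b + k1) + f (b - k1)) * (f (b + k2) + f (b - k2))
      + (f (b + k1) + f (b - k1)) * (f (b + k3) + f (b - k3))
      + (f (b + k2) + f (b - k2)) * (f (b + k3) + f (b - k3)) = 0) :
    D 1 k1 (D 1 k2 (D 1 k3 f)) = 0 ∧ D (-1) k1 (D (-1) k2 (D (-1) k3 f)) = 0 := by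
  have hU : ∀ k : ℤ, ∀ g : ℤ → ℝ, (∀ x, g (x + L) = g x) →
      ∀ x, (fun x => g (x + k) + g (x - k)) (x + L) = (fun x => g (x + k) + g (x - k)) x := by
    intro k g hg x
    show g (x + L + k) + g (x + L - k) = g (x + k) + g (x - k)
    rw [show x + L + k = x + k + L by ring, hg, show x + L - k = x - k + L by ring, hg]
  have key : S L (fun x => f x * M 1 k3 (M 1 k2 (M 1 k1 f)) x) +
      S L (fun x => f x * M (-1) k3 (M (-1) k2 (M (-1) k1 f)) x) = 0 := by
    have a12 := S_adj L k2 f (fun x => f (x + k1) + f (x - k1)) hf (hU k1 f hf)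
    have a13 := S_adj L k3 f (fun x => f (x + k1) + f (x - k1)) hf (hU k1 f hf)
    have a23 := S_adj L k3 f (fun x => f (x + k2) + f (x - k2)) hf (hU k2 f hf)
    have z : S L (fun b => 4 + (f (b + k1) + f (b - k1)) * (f (b + k2) + f (b - k2))
      + (f (b + k1) + f (b - k1)) * (f (b + k3) + f (b - k3))
      + (f (b + k2) + f (b - k2)) * (f (b + k3) + f (b - k3))) = 0 := by
      simp only [h]; simp [S]
    have z' : S L (fun b => 4 + (f (b + k1) + f (b - k1)) * (f (b + k2) + f (b - k2))
      + (f (b + k1) + f (b - k1)) * (f (b + k3) + f (b - k3))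
      + (f (b + k2) + f (b - k2)) * (f (b + k3) + f (b - k3))) = 
      S L (fun x => 4 * (f x * f x)) + S L (fun x => (f (x + k2) + f (x - k2)) * (f (x + k1) + f (x - k1)))
      + S L (fun x => (f (x + k3) + f (x - k3)) * (f (x + k1) + f (x - k1)))
      + S L (fun x => (f (x + k3) + f (x - k3)) * (f (x + k2) + f (x - k2))) := by
      simp only [← S_add, h1]; congr 1; funext x; ring
    rw [z', ← a12, ← a13, ← a23, ← S_add, ← S_add, ← S_add] at z
    rw [← S_add, ← mul_zero (4:ℝ), ← z, ← S_smul]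
    congr 1; funext x
    simp only [M]
    ring
  rw [← S_cube L 1 (by norm_num) k1 k2 k3 f hf, ← S_cube L (-1) (by norm_num) k1 k2 k3 f hf] at key
  have pos : ∀ g : ℤ → ℝ, 0 ≤ S L (fun x => g x * g x) := fun g =>
    Finset.sum_nonneg fun i _ => mul_self_nonneg _
  have p1 := pos (D 1 k1 (D 1 k2 (D 1 k3 f)))
  have p2 := pos (D (-1) k1 (D (-1) k2 (D (-1) k3 f)))
  have fin : ∀ s, S L (fun x => D s k1 (D s k2 (D s k3 f)) x * D s k1 (D s k2 (D s k3 f)) x) = 0 →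
      D s k1 (D s k2 (D s k3 f)) = 0 := by
    intro s hs
    have := S_zero L hL _ (by
      intro x
      rw [D_per (D_per (D_per hf))]) (fun x => mul_self_nonneg _) hs
    funext x
    have h := congrFun this x
    simpa using h
  exact ⟨fin _ (by linarith), fin _ (by linarith)⟩

end Cliq
namespace Cliq
open Polynomial

/-- sign of a colour -/
def sg (c : ℤ → Bool) : ℤ → ℝ := fun x => if c x then 1 else -1

lemma sg_sq (c : ℤ → Bool) (x : ℤ) : sg c x * sg c x = 1 := by
  unfold sg; split_ifs <;> norm_num

lemma sg_ne (c : ℤ → Bool) : sg c ≠ 0 := by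
  intro h
  have := sg_sq c 0
  rw [h] at this
  simp at this

lemma D_one (n : ℕ) (f : ℤ → ℝ) : D 1 n f = aeval T (1 + X ^ n : ℝ[X]) f := by
  rw [act_plus]; funext x; simp [D]

lemma D_neg (n : ℕ) (f : ℤ → ℝ) : D (-1) n f = aeval T (1 - X ^ n : ℝ[X]) f := by
  rw [act_minus]; funext x; simp [D]; ring

def Sep (c : ℤ → Bool) (b : ℤ) (u v : ℕ) : Prop :=
  ∃ e, c (b + u) = e ∧ c (b - u) = e ∧ c (b + v) = !e ∧ c (b - v) = !e

lemma specC {L : ℕ} (hL : 0 < L) {c : ℤ → Bool} (hc : ∀ x, c (x + L) = c x) (x y z : ℕ)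
    (h : ∀ b, ∃ u v, (u = x ∨ u = y ∨ u = z) ∧ (v = x ∨ v = y ∨ v = z) ∧ Sep c b u v) :
    aeval T ((1 + X ^ x) * ((1 + X ^ y) * (1 + X ^ z)) : ℝ[X]) (sg c) = 0 ∧
    aeval T ((1 - X ^ x) * ((1 - X ^ y) * (1 - X ^ z)) : ℝ[X]) (sg c) = 0 := by
  have := spectral L hL x y z (sg c) (fun x => by simp [sg, hc]) (sg_sq c) (by
    intro b
    obtain ⟨u, v, hu, hv, e, h1, h2, h3, h4⟩ := h b
    have vals : ∀ w, sg c w = 1 ∨ sg c w = -1 := by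
      intro w; unfold sg; split_ifs <;> simp
    have tt : ∀ w, c w = true → sg c w = 1 := by intro w hw; simp [sg, hw]
    have ff : ∀ w, c w = false → sg c w = -1 := by intro w hw; simp [sg, hw]
    rcases hu with rfl | rfl | rfl <;> rcases hv with rfl | rfl | rfl <;>
    first
    | (exfalso; rw [h1] at h3; cases e <;> simp at h3)
    | (cases e
       · rw [ff _ h1, ff _ h2, tt _ h3, tt _ h4]; ring
       · rw [tt _ h1, tt _ h2, ff _ h3, ff _ h4]; ring))
  rw [D_one, D_one, D_one, D_neg, D_neg, D_neg] at this
  simpa only [map_mul, Module.End.mul_apply] using this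

/-- all valuations equal -/
lemma lemH {L : ℕ} (hL : 0 < L) {c : ℤ → Bool} (hc : ∀ x, c (x + L) = c x) (x y z : ℕ)
    (hxy : emultiplicity 2 x = emultiplicity 2 y) (hxz : emultiplicity 2 x = emultiplicity 2 z)
    (h : ∀ b, ∃ u v, (u = x ∨ u = y ∨ u = z) ∧ (v = x ∨ v = y ∨ v = z) ∧ Sep c b u v) :
    False := by
  obtain ⟨hP, hQ⟩ := specC hL hc x y z h
  apply sg_ne c
  refine act_coprime ?_ hP hQ
  have a : ∀ u v : ℕ, (u = x ∨ u = y ∨ u = z) → (v = x ∨ v = y ∨ v = z) →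
      IsCoprime (1 + X ^ u : ℝ[X]) (1 - X ^ v) := by
    intro u v hu hv
    apply coprime_pm
    apply le_of_eq
    rcases hu with rfl | rfl | rfl <;> rcases hv with rfl | rfl | rfl <;> simp_all
  refine IsCoprime.mul_left ?_ (IsCoprime.mul_left ?_ ?_) <;>
  refine IsCoprime.mul_right ?_ (IsCoprime.mul_right ?_ ?_) <;> apply a <;> simp

lemma act_cancel {p q r : ℝ[X]} (h : IsCoprime p q) {f : ℤ → ℝ} (hp : aeval T (p * r) f = 0)
    (hq : aeval T q f = 0) : aeval T r f = 0 := by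
  refine act_coprime h (f := aeval T r f) ?_ ?_
  · simpa only [map_mul, Module.End.mul_apply] using hp
  · rw [← Module.End.mul_apply, ← map_mul, mul_comm, map_mul, Module.End.mul_apply, hq]; simp

/-- x has a different valuation from y, z which agree -/
lemma lemGper {L : ℕ} (hL : 0 < L) {c : ℤ → Bool} (hc : ∀ x, c (x + L) = c x) (x y z : ℕ)
    (hxy : emultiplicity 2 x ≠ emultiplicity 2 y) (hyz : emultiplicity 2 y = emultiplicity 2 z)
    (h : ∀ b, ∃ u v, (u = x ∨ u = y ∨ u = z) ∧ (v = x ∨ v = y ∨ v = z) ∧ Sep c b u v) :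
    ∀ w, c (w + 2 * x) = c w := by
  obtain ⟨hP, hQ⟩ := specC hL hc x y z h
  have fin : ∀ s : ℝ, (∀ w, sg c (w + x) = s * sg c w) → s * s = 1 → ∀ w, c (w + 2 * x) = c w := by
    intro s hs hss w
    have h1 := hs (w + x)
    rw [hs w, ← mul_assoc, hss, add_assoc, ← two_mul, one_mul] at h1
    unfold sg at h1
    by_contra hne
    cases h2 : c w <;> cases h3 : c (w + 2 * x) <;> simp [h2, h3] at h1 hne <;> norm_num at h1
  rcases lt_or_gt_of_ne hxy with hlt | hlt
  · -- antiperiodic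
    have q1 : aeval T ((1 - X ^ y) * (1 - X ^ z) : ℝ[X]) (sg c) = 0 := by
      refine act_cancel (p := 1 - X ^ x) (q := (1 + X ^ x) * ((1 + X ^ y) * (1 + X ^ z))) ?_ hQ hP
      refine IsCoprime.mul_right ?_ (IsCoprime.mul_right ?_ ?_) <;>
        refine (coprime_pm ?_).symm
      · exact le_rfl
      · exact hlt.le
      · exact hyz ▸ hlt.le
    have q2 : aeval T ((1 + X ^ x) : ℝ[X]) (sg c) = 0 := by
      refine act_cancel (p := (1 + X ^ y) * (1 + X ^ z)) (q := (1 - X ^ y) * (1 - X ^ z)) ?_ ?_ q1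
      · refine IsCoprime.mul_left ?_ ?_ <;>
        refine IsCoprime.mul_right ?_ ?_ <;> refine coprime_pm ?_ <;> simp [hyz]
      · rw [mul_comm]; exact hP
    rw [act_plus] at q2
    refine fin (-1) (fun w => ?_) (by norm_num)
    have := congrFun q2 w
    simp at this
    linarith
  · have q1 : aeval T ((1 + X ^ y) * (1 + X ^ z) : ℝ[X]) (sg c) = 0 := by
      refine act_cancel (p := 1 + X ^ x) (q := (1 - X ^ x) * ((1 - X ^ y) * (1 - X ^ z))) ?_ hP hQ
      refine IsCoprime.mul_right ?_ (IsCoprime.mul_right ?_ ?_) <;>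
        refine (coprime_pm ?_)
      · exact le_rfl
      · exact hlt.le
      · exact hyz ▸ hlt.le
    have q2 : aeval T ((1 - X ^ x) : ℝ[X]) (sg c) = 0 := by
      refine act_cancel (p := (1 - X ^ y) * (1 - X ^ z)) (q := (1 + X ^ y) * (1 + X ^ z)) ?_ ?_ q1
      · refine IsCoprime.mul_left ?_ ?_ <;>
        refine IsCoprime.mul_right ?_ ?_ <;> refine (coprime_pm ?_).symm <;> simp [hyz]
      · rw [mul_comm]; exact hQ
    rw [act_minus] at q2
    refine fin 1 (fun w => ?_) (by norm_num)
    have := congrFun q2 w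
    simp at this
    linarith

lemma mean_zero {L : ℕ} (hL : 0 < L) {c : ℤ → Bool} (hc : ∀ x, c (x + L) = c x) (x y z : ℕ)
    (h : ∀ b, ∃ u v, (u = x ∨ u = y ∨ u = z) ∧ (v = x ∨ v = y ∨ v = z) ∧ Sep c b u v) :
    S L (sg c) = 0 := by
  obtain ⟨hP, -⟩ := specC hL hc x y z h
  have hs : ∀ x, sg c (x + L) = sg c x := fun x => by simp [sg, hc]
  have aux : ∀ (k : ℕ) (f : ℤ → ℝ), (∀ x, f (x + L) = f x) → S L (D 1 k f) = 2 * S L f := by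
    intro k f hf
    have := S_shift L f hf k
    unfold D
    simp only [one_mul]
    rw [S_add, this]; ring
  simp only [map_mul, Module.End.mul_apply, ← D_one] at hP
  have h1 := aux x _ (D_per (s := 1) (k := y) (D_per (s := 1) (k := z) hs))
  rw [aux y _ (D_per (s := 1) (k := z) hs), aux z _ hs, hP] at h1
  have : S L 0 = 0 := by simp [S]
  rw [this] at h1
  linarith

lemma alternating {L : ℕ} (hL : 0 < L) {c : ℤ → Bool} (hc : ∀ x, c (x + L) = c x)
    (hm : S L (sg c) = 0) (e : Bool) (hr : ∀ x, c x = e ∨ c (x + 1) = e) :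
    ∀ x, c (x + 1) = !c x := by
  have hs : ∀ x, sg c (x + L) = sg c x := fun x => by simp [sg, hc]
  set r : ℝ := if e then 1 else -1
  have := S_zero L hL (fun x => r * (sg c x + sg c (x + 1))) (by
    intro x
    show r * (sg c (x + L) + sg c (x + L + 1)) = r * (sg c x + sg c (x + 1))
    rw [show x + L + 1 = x + 1 + L by ring, hs, hs])
    (by
      intro x
      have := hr x
      simp only [sg, r]
      cases e <;> cases h1 : c x <;> cases h2 : c (x + 1) <;> simp_all)
    (by rw [S_smul, S_add, S_shift1 L _ hs, hm]; simp)
  intro x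
  have h := congrFun this x
  have hr0 : r ≠ 0 := by simp only [r]; split_ifs <;> norm_num
  simp [hr0] at h
  unfold sg at h
  cases h1 : c x <;> cases h2 : c (x + 1) <;> simp [h1, h2] at h ⊢

lemma alt_even {c : ℤ → Bool} (h : ∀ x, c (x + 1) = !c x) (n : ℕ) (hn : 2 ∣ n) (b : ℤ) :
    c (b + n) = c b := by
  obtain ⟨m, rfl⟩ := hn
  induction m with
  | zero => simp
  | succ m ih =>
    rw [← ih, show b + ((2 * (m + 1) : ℕ) : ℤ) = (b + (2 * m : ℕ)) + 1 + 1 by push_cast; ring, h, h]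
    simp

/-- between a run of one colour and a run of the other: alternating stretch -/
lemma stretch {c : ℤ → Bool} (n : ℕ) : ∀ (p : ℤ) (e : Bool), c p = e → c (p + 1) = e →
    c (p + n) = (!e) → c (p + n + 1) = (!e) →
    ∃ (p : ℤ) (n : ℕ) (e : Bool), c p = e ∧ c (p + 1) = e ∧ c (p + n) = (!e) ∧
      c (p + n + 1) = (!e) ∧ ∀ k : ℕ, 0 < k → k < n → c (p + k + 1) = !c (p + k) := by
  induction n using Nat.strong_induction_on with
  | _ n ih =>
    intro p e h1 h2 h3 h4
    by_cases hk : ∀ k : ℕ, 0 < k → k < n → c (p + k + 1) = !c (p + k)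
    · exact ⟨p, n, e, h1, h2, h3, h4, hk⟩
    · push Not at hk
      obtain ⟨k, k0, kn, hk⟩ := hk
      have hk : c (p + k + 1) = c (p + k) := by
        cases h5 : c (p + k) <;> cases h6 : c (p + k + 1) <;> simp_all
      by_cases hke : c (p + k) = e
      · refine ih (n - k) (by omega) (p + k) e hke (hk.trans hke) ?_ ?_
        · rw [← h3]; congr 1; omega
        · rw [← h4]; congr 1; omega
      · have : c (p + k) = !e := by
          cases h5 : c (p + k) <;> cases e <;> simp_all
        exact ih k kn p e h1 h2 this (hk.trans this)

lemma per_mul {L : ℕ} {c : ℤ → Bool} (hc : ∀ x, c (x + L) = c x) (x : ℤ) (k : ℤ) :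
    c (x + k * L) = c x := by
  have : Function.Periodic c (L : ℤ) := hc
  exact (this.int_mul k) x

/-- useful form of the stretch -/
lemma stretch' {L : ℕ} (hL : 0 < L) {c : ℤ → Bool} (hc : ∀ x, c (x + L) = c x)
    (h1 : ∃ x, c x = true ∧ c (x + 1) = true) (h2 : ∃ x, c x = false ∧ c (x + 1) = false) :
    ∃ (p : ℤ) (n : ℕ) (e : Bool), c p = e ∧ c (p + 1) = e ∧ c (p + n) = (!e) ∧
      c (p + n + 1) = (!e) ∧ 2 ≤ n ∧ ∀ k : ℕ, k < n → c (p + 1 + k) = if 2 ∣ k then e else !e := by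
  obtain ⟨x, hx, hx'⟩ := h1
  obtain ⟨y, hy, hy'⟩ := h2
  have hp : (0:ℤ) < L := by exact_mod_cast hL
  obtain ⟨p, n, e, a1, a2, a3, a4, a5⟩ := stretch (c := c) (y + (|x - y|) * L - x).toNat x true hx hx'
    (by
      have : x ≤ y + |x - y| * L := by
        have := le_abs_self (x - y)
        nlinarith [abs_nonneg (x - y)]
      rw [Int.toNat_of_nonneg (by omega), show x + (y + |x - y| * L - x) = y + |x - y| * L by ring, per_mul hc, hy]; rfl)
    (by
      have : x ≤ y + |x - y| * L := by
        have := le_abs_self (x - y)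
        nlinarith [abs_nonneg (x - y)]
      rw [Int.toNat_of_nonneg (by omega), show x + (y + |x - y| * L - x) + 1 = (y + 1) + |x - y| * L by ring, per_mul hc, hy']; rfl)
  have hn : 2 ≤ n := by
    by_contra hlt
    have : n = 0 ∨ n = 1 := by omega
    rcases this with rfl | rfl
    · simp [a1] at a3
    · simp [a2] at a3
  refine ⟨p, n, e, a1, a2, a3, a4, hn, ?_⟩
  intro k hk
  induction k with
  | zero => simp [a2]
  | succ k ih =>
    have := a5 (k + 1) (by omega) hk
    rw [show p + 1 + ((k + 1 : ℕ) : ℤ) = p + (k + 1 : ℕ) + 1 by ring, this,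
      show p + ((k + 1 : ℕ):ℤ) = p + 1 + k by push_cast; ring, ih (by omega)]
    by_cases h : 2 ∣ k
    · have : ¬ 2 ∣ k + 1 := by omega
      simp [h, this]
    · have : 2 ∣ k + 1 := by omega
      simp [h, this]

end Cliq
namespace Cliq

/-- a periodic colouring avoiding three cliques of weights `2 α i` -/
structure Sys (L : ℕ) (c : ℤ → Bool) (α t : Fin 3 → ℕ) (O : Fin 3 → Bool → ℤ → Prop) : Prop where
  pos : 0 < L
  per : ∀ x, c (x + L) = c x
  used : ∀ b, ∃ i j e, O i e b ∧ O j (!e) b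
  ends : ∀ i e b, O i e b → c (b + α i) = e ∧ c (b - α i) = e
  w0 : ∀ i e b, O i e b → t i = 0 → ∀ y, b - α i ≤ y → y ≤ b + α i → c y = e
  w1 : ∀ i e b, O i e b → t i ≤ 1 → ∀ y, b - α i ≤ y → y + 1 ≤ b + α i → c y = e ∨ c (y + 1) = e

variable {L : ℕ} {c : ℤ → Bool} {α t : Fin 3 → ℕ} {O : Fin 3 → Bool → ℤ → Prop}

lemma fin3 {i j k : Fin 3} (hij : i ≠ j) (hik : i ≠ k) (hjk : j ≠ k) (l : Fin 3) :
    l = i ∨ l = j ∨ l = k := by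
  revert i j k l; decide

lemma Sys.ne (h : Sys L c α t O) {i j e b} (h1 : O i e b) (h2 : O j (!e) b) : i ≠ j := by
  rintro rfl
  have a := (h.ends _ _ _ h1).1
  have b := (h.ends _ _ _ h2).1
  rw [a] at b
  cases e <;> simp at b

lemma Sys.sep (h : Sys L c α t O) {i j k : Fin 3} (hij : i ≠ j) (hik : i ≠ k) (hjk : j ≠ k) :
    ∀ b, ∃ u v, (u = α i ∨ u = α j ∨ u = α k) ∧ (v = α i ∨ v = α j ∨ v = α k) ∧ Sep c b u v := by
  intro b
  obtain ⟨p, q, e, hp, hq⟩ := h.used b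
  refine ⟨α p, α q, ?_, ?_, e, (h.ends _ _ _ hp).1, (h.ends _ _ _ hp).2, (h.ends _ _ _ hq).1,
    (h.ends _ _ _ hq).2⟩
  · rcases fin3 hij hik hjk p with rfl | rfl | rfl <;> simp
  · rcases fin3 hij hik hjk q with rfl | rfl | rfl <;> simp

lemma Sys.mean (h : Sys L c α t O) : S L (sg c) = 0 :=
  mean_zero h.pos h.per _ _ _ (h.sep (i := 0) (j := 1) (k := 2) (by decide) (by decide) (by decide))

/-- one of two given indices is used -/
lemma Sys.two (h : Sys L c α t O) {i j : Fin 3} (hij : i ≠ j) (b : ℤ) :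
    ∃ e, O i e b ∨ O j e b := by
  obtain ⟨p, q, e, hp, hq⟩ := h.used b
  have hne := h.ne hp hq
  have : p = i ∨ p = j ∨ q = i ∨ q = j := by clear hp hq; revert i j p q; decide
  rcases this with rfl | rfl | rfl | rfl
  · exact ⟨_, Or.inl hp⟩
  · exact ⟨_, Or.inr hp⟩
  · exact ⟨_, Or.inl hq⟩
  · exact ⟨_, Or.inr hq⟩

lemma alt_sub {c : ℤ → Bool} (h : ∀ x, c (x + 1) = !c x) (n : ℕ) (hn : 2 ∣ n) (b : ℤ) :
    c (b - n) = c b := by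
  rw [← alt_even h n hn (b - n)]; simp

lemma Sys.no_alt (h : Sys L c α t O) (hev : ∀ i, 2 ∣ α i) : ¬ ∀ x, c (x + 1) = !c x := by
  intro ha
  obtain ⟨p, q, e, hp, hq⟩ := h.used 0
  have h1 := (h.ends _ _ _ hp).1
  have h2 := (h.ends _ _ _ hq).1
  rw [alt_even ha _ (hev _)] at h1 h2
  rw [h1] at h2
  cases e <;> simp at h2

lemma Sys.runs (h : Sys L c α t O) (hna : ¬ ∀ x, c (x + 1) = !c x) :
    (∃ x, c x = true ∧ c (x + 1) = true) ∧ (∃ x, c x = false ∧ c (x + 1) = false) := by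
  constructor
  · by_contra hn
    push Not at hn
    refine hna (alternating h.pos h.per h.mean false fun x => ?_)
    have := hn x
    cases h1 : c x <;> cases h2 : c (x + 1) <;> simp_all
  · by_contra hn
    push Not at hn
    refine hna (alternating h.pos h.per h.mean true fun x => ?_)
    have := hn x
    cases h1 : c x <;> cases h2 : c (x + 1) <;> simp_all

lemma bne {e : Bool} (h : e = !e) : False := by cases e <;> simp at h

lemma Sys.lemE0 (h : Sys L c α t O) {i j : Fin 3} (hij : i ≠ j) (hi : t i = 0) (hj : t j = 0)
    (ai : 0 < α i) (aj : 0 < α j) : False := by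
  have hc : ∀ b, c (b + 1) = c b := by
    intro b
    obtain ⟨e, h1 | h1⟩ := h.two hij b
    · rw [h.w0 _ _ _ h1 hi b (by omega) (by omega), h.w0 _ _ _ h1 hi (b+1) (by omega) (by omega)]
    · rw [h.w0 _ _ _ h1 hj b (by omega) (by omega), h.w0 _ _ _ h1 hj (b+1) (by omega) (by omega)]
  have : ¬ ∀ x, c (x + 1) = !c x := by
    intro h'
    have := h' 0
    rw [hc] at this
    exact bne this
  obtain ⟨p, n, e, a1, a2, a3, a4, hn, hk⟩ := stretch' h.pos h.per (h.runs this).1 (h.runs this).2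
  have := hk 1 (by omega)
  rw [show p + 1 + ((1 : ℕ) : ℤ) = p + 1 + 1 by simp, hc, a2] at this
  simp at this

lemma Sys.lemE (h : Sys L c α t O) {i j : Fin 3} (hij : i ≠ j) (hi : t i ≤ 1) (hj : t j ≤ 1)
    (ai : 0 < α i) (aj : 0 < α j) (hev : ∀ i, 2 ∣ α i) : False := by
  wlog hle : α i ≤ α j generalizing i j
  · exact this hij.symm hj hi aj ai (by omega)
  have hna := h.no_alt hev
  obtain ⟨p, n, e, a1, a2, a3, a4, hn, hk⟩ := stretch' h.pos h.per (h.runs hna).1 (h.runs hna).2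
  have key : ∀ r : Fin 3, t r ≤ 1 → α i ≤ α r → ∀ e', ¬ O r e' (p + α i) := by
    intro r hr har e' ho
    have ee : e' = e := by
      rcases h.w1 _ _ _ ho hr p (by omega) (by omega) with h1 | h1
      · rw [← h1, a1]
      · rw [← h1, a2]
    subst ee
    by_cases hlt : α i + α r ≤ n
    · have h1 := (h.ends _ _ _ ho).1
      have h2 := hk (α i + α r - 1) (by omega)
      have e1 := hev i
      have e2 := hev r
      rw [if_neg (by omega), show p + 1 + ((α i + α r - 1 : ℕ) : ℤ) = p + α i + α r by omega, h1] at h2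
      exact bne h2
    · rcases h.w1 _ _ _ ho hr (p + n) (by omega) (by omega) with h1 | h1
      · rw [a3] at h1; exact bne h1.symm
      · rw [a4] at h1; exact bne h1.symm
  obtain ⟨e', h1 | h1⟩ := h.two hij (p + α i)
  · exact key i hi le_rfl e' h1
  · exact key j hj hle e' h1

lemma Sys.lemF (h : Sys L c α t O) {i j k : Fin 3} (hij : i ≠ j) (hik : i ≠ k) (hjk : j ≠ k)
    (hi : t i = 0) (hj : t j ≤ 1) (ai : 0 < α i) (aj : 0 < α j) (ej : 2 ∣ α j) (ek : 2 ∣ α k) :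
    False := by
  have hna : ¬ ∀ x, c (x + 1) = !c x := by
    intro ha
    obtain ⟨p, q, e, hp, hq⟩ := h.used 0
    have key : ∀ e, ¬ O i e 0 := by
      intro e ho
      have h1 := h.w0 _ _ _ ho hi 0 (by omega) (by omega)
      have h2 := h.w0 _ _ _ ho hi (0 + 1) (by omega) (by omega)
      rw [ha, h1] at h2
      exact bne h2.symm
    have h1 := (h.ends _ _ _ hp).1
    have h2 := (h.ends _ _ _ hq).1
    have ev : ∀ r e, O r e 0 → 2 ∣ α r := by
      intro r e hr
      rcases fin3 hij hik hjk r with rfl | rfl | rfl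
      · exact absurd hr (key _)
      · exact ej
      · exact ek
    rw [alt_even ha _ (ev _ _ hp)] at h1
    rw [alt_even ha _ (ev _ _ hq), h1] at h2
    exact bne h2
  obtain ⟨p, n, e, a1, a2, a3, a4, hn, hk⟩ := stretch' h.pos h.per (h.runs hna).1 (h.runs hna).2
  obtain ⟨e', h1 | ho⟩ := h.two hij (p + 2)
  · have h2 := h.w0 _ _ _ h1 hi (p + 1) (by omega) (by omega)
    have h3 := h.w0 _ _ _ h1 hi (p + 2) (by omega) (by omega)
    have h4 := hk 1 (by omega)
    rw [show p + 1 + ((1 : ℕ) : ℤ) = p + 2 by push_cast; ring, h3] at h4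
    rw [a2] at h2
    subst h2
    simp at h4
  · have ee : e' = e := by
      rcases h.w1 _ _ _ ho hj p (by omega) (by omega) with h1 | h1
      · rw [← h1, a1]
      · rw [← h1, a2]
    subst ee
    by_cases hlt : α j + 2 ≤ n
    · have h1 := (h.ends _ _ _ ho).1
      have h2 := hk (α j + 1) (by omega)
      rw [if_neg (by omega), show p + 1 + ((α j + 1 : ℕ) : ℤ) = p + 2 + α j by push_cast; ring, h1] at h2
      exact bne h2
    · rcases h.w1 _ _ _ ho hj (p + n) (by omega) (by omega) with h1 | h1
      · rw [a3] at h1; exact bne h1.symm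
      · rw [a4] at h1; exact bne h1.symm

lemma Sys.lemG (h : Sys L c α t O) {i j k : Fin 3} (hij : i ≠ j) (hik : i ≠ k) (hjk : j ≠ k)
    (ai : 0 < α i) (hi : t i = 0 ∨ (t i ≤ 1 ∧ ∀ l, 2 ∣ α l))
    (v1 : emultiplicity 2 (α i) ≠ emultiplicity 2 (α j))
    (v2 : emultiplicity 2 (α j) = emultiplicity 2 (α k)) : False := by
  have hper := lemGper h.pos h.per _ _ _ v1 v2 (h.sep hij hik hjk)
  have hti : t i ≤ 1 := by rcases hi with hi | hi <;> omega
  have never : ∀ e b, ¬ O i e b := by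
    intro e b ho
    have ha : ∀ x, c (x + 1) = !c x := by
      refine alternating h.pos h.per h.mean e fun x => ?_
      have hp' : ∀ x, c (x + ((2 * α i : ℕ) : ℤ)) = c x := by
        intro x; push_cast; exact hper x
      have hpos : (0:ℤ) < ((2 * α i : ℕ) : ℤ) := by omega
      have m1 := Int.emod_nonneg (x - (b - α i)) hpos.ne'
      have m2 := Int.emod_lt_of_pos (x - (b - α i)) hpos
      set m := (x - (b - α i)) % ((2 * α i : ℕ) : ℤ) with hm
      have hx : x = (b - α i + m) + (x - (b - α i)) / ((2 * α i : ℕ) : ℤ) * ((2 * α i : ℕ) : ℤ) := by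
        have := Int.emod_add_mul_ediv (x - (b - α i)) ((2 * α i : ℕ) : ℤ)
        rw [← hm] at this
        linarith
      rw [hx, per_mul hp', show ∀ u v w : ℤ, u + v + w + 1 = (u + v + 1) + w by intros; ring, per_mul hp']
      exact h.w1 _ _ _ ho hti _ (by omega) (by push_cast at m2; omega)
    rcases hi with hi | ⟨-, hev⟩
    · have h1 := h.w0 _ _ _ ho hi b (by omega) (by omega)
      have h2 := h.w0 _ _ _ ho hi (b + 1) (by omega) (by omega)
      rw [ha, h1] at h2
      exact bne h2.symm
    · exact h.no_alt hev ha
  refine lemH h.pos h.per (α j) (α k) (α k) v2 v2 ?_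
  intro b
  obtain ⟨p, q, e, hp, hq⟩ := h.used b
  refine ⟨α p, α q, ?_, ?_, e, (h.ends _ _ _ hp).1, (h.ends _ _ _ hp).2, (h.ends _ _ _ hq).1,
    (h.ends _ _ _ hq).2⟩
  · rcases fin3 hij hik hjk p with rfl | rfl | rfl
    · exact absurd hp (never _ _)
    · simp
    · simp
  · rcases fin3 hij hik hjk q with rfl | rfl | rfl
    · exact absurd hq (never _ _)
    · simp
    · simp

/-- pair condition (halved weights) -/
def PC (α t : Fin 3 → ℕ) (i j : Fin 3) : Prop :=
  emultiplicity 2 (α i) = emultiplicity 2 (α j) ∨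
    (0 < α i ∧ (t i = 0 ∨ (t i ≤ 1 ∧ 2 ∣ α i ∧ 2 ∣ α j))) ∨
    (0 < α j ∧ (t j = 0 ∨ (t j ≤ 1 ∧ 2 ∣ α i ∧ 2 ∣ α j)))

lemma even_of_em {a b : ℕ} (h : emultiplicity 2 a = emultiplicity 2 b) : 2 ∣ a ↔ 2 ∣ b := by
  have := emultiplicity_eq_emultiplicity_iff.1 h 1
  simpa using this

lemma odd_em {a b : ℕ} (ha : ¬ 2 ∣ a) (hb : ¬ 2 ∣ b) : emultiplicity 2 a = emultiplicity 2 b := by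
  rw [emultiplicity_eq_zero.2 ha, emultiplicity_eq_zero.2 hb]

lemma Sys.two_eq (h : Sys L c α t O) {i j k : Fin 3} (hij : i ≠ j) (hik : i ≠ k) (hjk : j ≠ k)
    (v1 : emultiplicity 2 (α i) ≠ emultiplicity 2 (α j))
    (v2 : emultiplicity 2 (α j) = emultiplicity 2 (α k)) (h1 : PC α t i j) (h2 : PC α t i k) :
    False := by
  have hev := even_of_em v2
  have all : 2 ∣ α i → 2 ∣ α j → ∀ l, 2 ∣ α l := by
    intro e1 e2 l
    rcases fin3 hij hik hjk l with rfl | rfl | rfl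
    · exact e1
    · exact e2
    · exact hev.1 e2
  rcases h1 with h1 | ⟨ai, h1⟩ | ⟨aj, h1⟩
  · exact v1 h1
  · refine h.lemG hij hik hjk ai ?_ v1 v2
    rcases h1 with h1 | ⟨h1, e1, e2⟩
    · exact Or.inl h1
    · exact Or.inr ⟨h1, all e1 e2⟩
  · rcases h2 with h2 | ⟨ai, h2⟩ | ⟨ak, h2⟩
    · exact v1 (h2.trans v2.symm)
    · refine h.lemG hij hik hjk ai ?_ v1 v2
      rcases h2 with h1 | ⟨h1, e1, e2⟩
      · exact Or.inl h1
      · exact Or.inr ⟨h1, all e1 (hev.2 e2)⟩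
    · by_cases he : 2 ∣ α i ∧ 2 ∣ α j
      · exact h.lemE hjk (by omega) (by omega) aj ak (all he.1 he.2)
      · exact h.lemE0 hjk (by tauto) (by tauto) aj ak

lemma Sys.one_odd (h : Sys L c α t O) {i j k : Fin 3} (hij : i ≠ j) (hik : i ≠ k) (hjk : j ≠ k)
    (oi : ¬ 2 ∣ α i) (ej : 2 ∣ α j) (ek : 2 ∣ α k)
    (v2 : emultiplicity 2 (α j) ≠ emultiplicity 2 (α k)) (h1 : PC α t i j) (h2 : PC α t i k)
    (h3 : PC α t j k) : False := by
  have v1 : emultiplicity 2 (α i) ≠ emultiplicity 2 (α j) := fun hh => oi ((even_of_em hh).2 ej)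
  have v3 : emultiplicity 2 (α i) ≠ emultiplicity 2 (α k) := fun hh => oi ((even_of_em hh).2 ek)
  have ai : 0 < α i := by
    rcases Nat.eq_zero_or_pos (α i) with h0 | h0
    · rw [h0] at oi; simp at oi
    · exact h0
  unfold PC at h1 h2 h3
  by_cases hi : t i = 0
  · rcases h3 with h3 | ⟨aj, h3⟩ | ⟨ak, h3⟩
    · exact v2 h3
    · exact h.lemF hij hik hjk hi (by omega) ai aj ej ek
    · exact h.lemF hik hij hjk.symm hi (by omega) ai ak ek ej
  · exact h.lemE0 hjk (by tauto) (by tauto) (by tauto) (by tauto)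

lemma PC.symm {i j : Fin 3} (h : PC α t i j) : PC α t j i := by
  unfold PC at *
  rcases h with h | h | h
  · exact Or.inl h.symm
  · right; right; tauto
  · right; left; tauto

lemma Sys.final (h : Sys L c α t O) (hp : ∀ i j, i ≠ j → PC α t i j) : False := by
  by_cases v01 : emultiplicity 2 (α 0) = emultiplicity 2 (α 1)
  · by_cases v02 : emultiplicity 2 (α 0) = emultiplicity 2 (α 2)
    · exact lemH h.pos h.per _ _ _ v01 v02 (h.sep (by decide) (by decide) (by decide))
    · exact h.two_eq (i := 2) (j := 0) (k := 1) (by decide) (by decide) (by decide) (Ne.symm v02) v01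
        (hp _ _ (by decide)) (hp _ _ (by decide))
  by_cases v02 : emultiplicity 2 (α 0) = emultiplicity 2 (α 2)
  · exact h.two_eq (i := 1) (j := 0) (k := 2) (by decide) (by decide) (by decide) (Ne.symm v01) v02
        (hp _ _ (by decide)) (hp _ _ (by decide))
  by_cases v12 : emultiplicity 2 (α 1) = emultiplicity 2 (α 2)
  · exact h.two_eq (i := 0) (j := 1) (k := 2) (by decide) (by decide) (by decide) v01 v12
        (hp _ _ (by decide)) (hp _ _ (by decide))
  have o01 := mt (fun h : _ ∧ _ => odd_em h.1 h.2) v01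
  have o02 := mt (fun h : _ ∧ _ => odd_em h.1 h.2) v02
  have o12 := mt (fun h : _ ∧ _ => odd_em h.1 h.2) v12
  by_cases e0 : 2 ∣ α 0
  · by_cases e1 : 2 ∣ α 1
    · by_cases e2 : 2 ∣ α 2
      · have all : ∀ l, 2 ∣ α l := by
          intro l; fin_cases l <;> assumption
        have good : ∀ i j, emultiplicity 2 (α i) ≠ emultiplicity 2 (α j) → i ≠ j →
            (0 < α i ∧ t i ≤ 1) ∨ (0 < α j ∧ t j ≤ 1) := by
          intro i j hv hij
          rcases hp i j hij with h1 | ⟨h1, h2⟩ | ⟨h1, h2⟩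
          · exact absurd h1 hv
          · left; exact ⟨h1, by omega⟩
          · right; exact ⟨h1, by omega⟩
        have g01 := good 0 1 v01 (by decide)
        have g02 := good 0 2 v02 (by decide)
        have g12 := good 1 2 v12 (by decide)
        rcases g01 with g | g
        · rcases g12 with g' | g'
          · exact h.lemE (i := 0) (j := 1) (by decide) g.2 g'.2 g.1 g'.1 all
          · exact h.lemE (i := 0) (j := 2) (by decide) g.2 g'.2 g.1 g'.1 all
        · rcases g02 with g' | g'
          · exact h.lemE (i := 1) (j := 0) (by decide) g.2 g'.2 g.1 g'.1 all
          · exact h.lemE (i := 1) (j := 2) (by decide) g.2 g'.2 g.1 g'.1 all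
      · exact h.one_odd (i := 2) (j := 0) (k := 1) (by decide) (by decide) (by decide) e2 (by tauto) (by tauto)
          v01 (hp _ _ (by decide)) (hp _ _ (by decide)) (hp _ _ (by decide))
    · exact h.one_odd (i := 1) (j := 0) (k := 2) (by decide) (by decide) (by decide) e1 (by tauto) (by tauto)
          v02 (hp _ _ (by decide)) (hp _ _ (by decide)) (hp _ _ (by decide))
  · exact h.one_odd (i := 0) (j := 1) (k := 2) (by decide) (by decide) (by decide) e0 (by tauto) (by tauto)
          v12 (hp _ _ (by decide)) (hp _ _ (by decide)) (hp _ _ (by decide))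

end Cliq
namespace Cliq

/-- the clique of weight `a` and order `a+t` can be put monochromatically with base level `b` -/
def Can (c : ℤ → Bool) (a t : ℕ) (e : Bool) (b : ℤ) : Prop :=
  c (b + a) = e ∨ c (b - a) = e ∨
    ∃ s : ℕ, s + t ≤ a ∧ ∀ k : ℕ, k ≤ t → c (b + a - 2 * (s + k : ℕ)) = e

lemma Can.transfer {c c' : ℤ → Bool} {a t : ℕ} {e : Bool} {b b' : ℤ}
    (h : ∀ y : ℤ, -a ≤ y → y ≤ a → c (b + y) = c' (b' + y)) (hc : Can c a t e b) :
    Can c' a t e b' := by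
  rcases hc with h1 | h1 | ⟨s, hs, h1⟩
  · left; rw [← h1, h _ (by omega) le_rfl]
  · right; left; rw [← h1]; have := h (-a) le_rfl (by omega)
    rw [sub_eq_add_neg, sub_eq_add_neg, this]
  · right; right
    refine ⟨s, hs, fun k hk => ?_⟩
    have := h (a - 2 * (s + k : ℕ)) (by push_cast; omega) (by push_cast; omega)
    rw [← h1 k hk, ← add_sub_assoc, ← add_sub_assoc] at *
    exact this.symm

/-- the pair condition for original weights -/
def PCo (a1 t1 a2 t2 : ℕ) : Prop :=
  emultiplicity 2 a1 = emultiplicity 2 a2 ∨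
    (2 ∣ a1 ∧ 2 ∣ a2 ∧ 
      ((0 < a1 ∧ (t1 = 0 ∨ (t1 ≤ 1 ∧ 4 ∣ a1 ∧ 4 ∣ a2))) ∨
        (0 < a2 ∧ (t2 = 0 ∨ (t2 ≤ 1 ∧ 4 ∣ a1 ∧ 4 ∣ a2)))))

lemma em_half {a b : ℕ} (h : emultiplicity 2 (2 * a) = emultiplicity 2 (2 * b)) :
    emultiplicity 2 a = emultiplicity 2 b := by
  rw [emultiplicity_eq_emultiplicity_iff] at *
  intro n
  have := h (n + 1)
  rw [pow_succ', Nat.mul_dvd_mul_iff_left (by norm_num), Nat.mul_dvd_mul_iff_left (by norm_num)] at this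
  exact this

lemma core {L : ℕ} (hL : 0 < L) {c : ℤ → Bool} (hc : ∀ x, c (x + L) = c x) (a t : Fin 3 → ℕ)
    (hp : ∀ i j, i ≠ j → PCo (a i) (t i) (a j) (t j)) :
    ∃ b e, ∀ i, Can c (a i) (t i) e b := by
  by_contra hcon
  push Not at hcon
  have ends : ∀ i e b, ¬ Can c (a i) (t i) (!e) b → c (b + a i) = e ∧ c (b - a i) = e := by
    intro i e b h
    unfold Can at h
    push Not at h
    obtain ⟨h1, h2, -⟩ := h
    constructor
    · cases e <;> simp_all
    · cases e <;> simp_all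
  have used : ∀ b, ∃ i j, ¬ Can c (a i) (t i) true b ∧ ¬ Can c (a j) (t j) false b := by
    intro b
    obtain ⟨i, hi⟩ := hcon b true
    obtain ⟨j, hj⟩ := hcon b false
    exact ⟨i, j, hi, hj⟩
  by_cases hall : ∀ i j, emultiplicity 2 (a i) = emultiplicity 2 (a j)
  · refine lemH hL hc (a 0) (a 1) (a 2) (hall _ _) (hall _ _) fun b => ?_
    obtain ⟨i, j, hi, hj⟩ := used b
    have m : ∀ i, a i = a 0 ∨ a i = a 1 ∨ a i = a 2 := by
      intro i; fin_cases i <;> simp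
    have e1 := ends i false b hi
    have e2 := ends j true b hj
    exact ⟨a i, a j, m i, m j, false, e1.1, e1.2, e2.1, e2.2⟩
  · push Not at hall
    obtain ⟨i, j, hij⟩ := hall
    have hne : i ≠ j := by rintro rfl; exact hij rfl
    have hev : ∀ l, 2 ∣ a l := by
      intro l
      by_cases hl : emultiplicity 2 (a l) = emultiplicity 2 (a i)
      · have hlj : emultiplicity 2 (a l) ≠ emultiplicity 2 (a j) := hl ▸ hij
        rcases hp l j (by rintro rfl; exact hlj rfl) with h | h
        · exact absurd h hlj
        · exact h.1
      · rcases hp l i (by rintro rfl; exact hl rfl) with h | h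
        · exact absurd h hl
        · exact h.1
    choose α hα using hev
    have sys : Sys L (fun x => c (2 * x)) α t (fun i e x => ¬ Can c (a i) (t i) (!e) (2 * x)) := by
      have nrun : ∀ i e x, ¬ Can c (a i) (t i) (!e) (2 * x) → ∀ s : ℕ, s + t i ≤ a i →
          ∃ k : ℕ, k ≤ t i ∧ c (2 * x + a i - 2 * (s + k : ℕ)) = e := by
        intro i e x h s hs
        unfold Can at h
        push Not at h
        obtain ⟨k, hk, h1⟩ := h.2.2 s hs
        refine ⟨k, hk, ?_⟩
        cases e <;> simp_all
      refine ⟨hL, ?_, ?_, ?_, ?_, ?_⟩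
      · intro x
        have := per_mul hc (2 * x) 2
        rw [← this]; congr 1; ring
      · intro b
        obtain ⟨i, j, hi, hj⟩ := used (2 * b)
        exact ⟨i, j, false, hi, hj⟩
      · intro i e b h
        have := ends i e _ h
        rw [hα i] at this
        push_cast at this
        rw [← mul_add, ← mul_sub] at this
        exact this
      · intro i e b h ht y h1 h2
        obtain ⟨k, hk, h3⟩ := nrun i e b h (b + α i - y).toNat (by have := hα i; omega)
        have : k = 0 := by omega
        subst this
        rw [← h3]
        show c (2 * y) = _
        congr 1
        have := hα i
        omega
      · intro i e b h ht y h1 h2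
        obtain ⟨k, hk, h3⟩ := nrun i e b h (b + α i - y - 1).toNat (by have := hα i; omega)
        have hh := hα i
        have : k = 0 ∨ k = 1 := by omega
        show c (2 * y) = e ∨ c (2 * (y + 1)) = e
        rcases this with rfl | rfl
        · right; rw [← h3]; congr 1; omega
        · left; rw [← h3]; congr 1; omega
    refine sys.final fun i j hij => ?_
    have h1 := hα i
    have h2 := hα j
    rcases hp i j hij with h | ⟨-, -, h⟩
    · left; rw [h1, h2] at h; exact em_half h
    · right
      rcases h with ⟨h3, h4⟩ | ⟨h3, h4⟩
      · left; exact ⟨by omega, by omega⟩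
      · right; exact ⟨by omega, by omega⟩

lemma core2 (a t : Fin 3 → ℕ) (hp : ∀ i j, i ≠ j → PCo (a i) (t i) (a j) (t j)) (R : ℕ)
    (hR : ∀ i, a i ≤ R) :
    ∃ N : ℕ, ∀ χ : ℕ → Bool, ∃ b : ℕ, R ≤ b ∧ b + R ≤ N ∧ ∃ e, ∀ i,
      Can (fun x => χ x.toNat) (a i) (t i) e b := by
  set W := Fintype.card (Fin (2 * R + 1) → Bool) with hW
  refine ⟨W + 3 * R + 1, fun χ => ?_⟩
  obtain ⟨p', q', hne, hpq⟩ := Fintype.exists_ne_map_eq_of_card_lt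
    (fun (x : Fin (W + 1)) (i : Fin (2 * R + 1)) => χ (x + i)) (by simp [hW])
  obtain ⟨p, q, hlt, hq, hw⟩ : ∃ p q : ℕ, p < q ∧ q ≤ W ∧ ∀ i, i ≤ 2 * R → χ (p + i) = χ (q + i) := by
    have hh : ∀ i, i ≤ 2 * R → χ (p' + i) = χ (q' + i) := fun i hi =>
      congrFun hpq (⟨i, by omega⟩ : Fin (2 * R + 1))
    rcases lt_or_gt_of_ne (fun h => hne (Fin.ext h) : (p' : ℕ) ≠ q') with h | h
    · exact ⟨p', q', h, by omega, hh⟩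
    · exact ⟨q', p', h, by omega, fun i hi => (hh i hi).symm⟩
  set L := q - p with hLd
  have hL : 0 < L := by omega
  have hLz : (0 : ℤ) < L := by omega
  let c : ℤ → Bool := fun x => χ (p + ((x - p) % L).toNat)
  have hc : ∀ x, c (x + L) = c x := by
    intro x
    show χ (p + ((x + L - p) % L).toNat) = χ (p + ((x - p) % L).toNat)
    rw [show x + L - p = x - p + L by ring, Int.add_emod_right]
  have hag : ∀ n : ℕ, n ≤ L + 2 * R → c ((p + n : ℕ) : ℤ) = χ (p + n) := by
    intro n
    induction n using Nat.strong_induction_on with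
    | _ n ih =>
      intro hn
      by_cases hnL : n < L
      · show χ (p + ((((p + n : ℕ) : ℤ) - p) % L).toNat) = _
        rw [show ((p + n : ℕ) : ℤ) - p = n by push_cast; ring,
          Int.emod_eq_of_lt (by omega) (by omega)]
        simp
      · have h1 := ih (n - L) (by omega) (by omega)
        have h2 := hw (n - L) (by omega)
        rw [h2] at h1
        rw [show p + n = q + (n - L) by omega, ← h1, ← hc ((p + (n - L) : ℕ) : ℤ)]
        congr 1; omega
  obtain ⟨b, e, hb⟩ := core hL hc a t hp
  have m1 := Int.emod_nonneg (b - R - p) hLz.ne'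
  have m2 := Int.emod_lt_of_pos (b - R - p) hLz
  set m := (b - R - p) % (L : ℤ) with hm
  have hbm : b = (p + m + R) + (b - R - p) / (L : ℤ) * L := by
    have := Int.emod_add_mul_ediv (b - R - p) (L : ℤ)
    rw [← hm] at this
    linarith
  refine ⟨(p + m + R).toNat, by omega, by omega, e, fun i => ?_⟩
  refine (hb i).transfer fun y y1 y2 => ?_
  have hRi := hR i
  have : b + y = (p + m + R + y) + (b - R - p) / (L : ℤ) * L := by linarith
  rw [this, per_mul hc, Int.toNat_of_nonneg (by omega)]
  have h3 := hag (m + R + y).toNat (by omega)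
  rw [show ((p + (m + R + y).toNat : ℕ) : ℤ) = p + m + R + y by omega] at h3
  rw [h3]
  congr 1
  omega

end Cliq
namespace Cliq

lemma ramsey (k : ℕ) : ∀ p q : ℕ, ∃ n : ℕ, ∀ (β : Type) [DecidableEq β] (S : Finset β)
    (c : Finset β → Bool), n ≤ S.card →
      (∃ U ⊆ S, U.card = p ∧ ∀ A ⊆ U, A.card = k → c A = true) ∨
      (∃ U ⊆ S, U.card = q ∧ ∀ A ⊆ U, A.card = k → c A = false) := by
  induction k with
  | zero =>
    intro p q
    refine ⟨p + q, fun β _ S c hS => ?_⟩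
    cases hc : c ∅
    · right
      obtain ⟨U, hU, hUc⟩ := Finset.exists_subset_card_eq (show q ≤ S.card by omega)
      refine ⟨U, hU, hUc, fun A _ hA => ?_⟩
      rw [Finset.card_eq_zero.1 hA, hc]
    · left
      obtain ⟨U, hU, hUc⟩ := Finset.exists_subset_card_eq (show p ≤ S.card by omega)
      refine ⟨U, hU, hUc, fun A _ hA => ?_⟩
      rw [Finset.card_eq_zero.1 hA, hc]
  | succ k ihk =>
    have main : ∀ m p q : ℕ, p + q = m → ∃ n : ℕ, ∀ (β : Type) [DecidableEq β] (S : Finset β)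
      (c : Finset β → Bool), n ≤ S.card →
      (∃ U ⊆ S, U.card = p ∧ ∀ A ⊆ U, A.card = k + 1 → c A = true) ∨
      (∃ U ⊆ S, U.card = q ∧ ∀ A ⊆ U, A.card = k + 1 → c A = false) := by
      intro m
      induction m with
      | zero =>
        intro p q hpq
        refine ⟨0, fun β _ S c hS => Or.inl ⟨∅, by simp, by simp; omega, ?_⟩⟩
        intro A hA hc
        rw [Finset.subset_empty.1 hA] at hc; simp at hc
      | succ m ihm =>
        intro p q hpq
        rcases p with _ | p
        · refine ⟨0, fun β _ S c hS => Or.inl ⟨∅, by simp, by simp, ?_⟩⟩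
          intro A hA hc
          rw [Finset.subset_empty.1 hA] at hc; simp at hc
        rcases q with _ | q
        · refine ⟨0, fun β _ S c hS => Or.inr ⟨∅, by simp, by simp, ?_⟩⟩
          intro A hA hc
          rw [Finset.subset_empty.1 hA] at hc; simp at hc
        obtain ⟨n1, h1⟩ := ihm p (q + 1) (by omega)
        obtain ⟨n2, h2⟩ := ihm (p + 1) q (by omega)
        obtain ⟨n, h⟩ := ihk n1 n2
        refine ⟨n + 1, fun β _ S c hS => ?_⟩
        obtain ⟨x, hx⟩ := Finset.card_pos.1 (show 0 < S.card by omega)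
        have ext : ∀ (e : Bool) (U V : Finset β), U ⊆ S.erase x →
            (∀ A ⊆ U, A.card = k → c (insert x A) = e) → V ⊆ U →
            (∀ A ⊆ V, A.card = k + 1 → c A = e) →
            ∀ A ⊆ insert x V, A.card = k + 1 → c A = e := by
          intro e U V hU hUe hVU hV A hA hAc
          by_cases hxA : x ∈ A
          · rw [← Finset.insert_erase hxA]
            apply hUe
            · intro y hy
              rw [Finset.mem_erase] at hy
              rcases Finset.mem_insert.1 (hA hy.2) with rfl | h
              · exact absurd rfl hy.1
              · exact hVU h
            · rw [Finset.card_erase_of_mem hxA]; omega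
          · apply hV _ _ hAc
            intro y hy
            rcases Finset.mem_insert.1 (hA hy) with rfl | h
            · exact absurd hy hxA
            · exact h
        have hins : ∀ (V : Finset β), V ⊆ S.erase x → insert x V ⊆ S ∧ (insert x V).card = V.card + 1 := by
          intro V hV
          constructor
          · exact Finset.insert_subset hx (hV.trans (Finset.erase_subset _ _))
          · rw [Finset.card_insert_of_notMem]
            intro h; exact Finset.notMem_erase x S (hV h)
        rcases h β (S.erase x) (fun A => c (insert x A)) (by rw [Finset.card_erase_of_mem hx]; omega)
          with ⟨U, hU, hUc, hUe⟩ | ⟨U, hU, hUc, hUe⟩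
        · rcases h1 β U c hUc.ge with ⟨V, hV, hVc, hVe⟩ | ⟨V, hV, hVc, hVe⟩
          · left
            refine ⟨insert x V, (hins V (hV.trans hU)).1, by rw [(hins V (hV.trans hU)).2, hVc], ?_⟩
            exact ext true U V hU hUe hV hVe
          · right
            exact ⟨V, hV.trans (hU.trans (Finset.erase_subset _ _)), hVc, hVe⟩
        · rcases h2 β U c hUc.ge with ⟨V, hV, hVc, hVe⟩ | ⟨V, hV, hVc, hVe⟩
          · left
            exact ⟨V, hV.trans (hU.trans (Finset.erase_subset _ _)), hVc, hVe⟩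
          · right
            refine ⟨insert x V, (hins V (hV.trans hU)).1, by rw [(hins V (hV.trans hU)).2, hVc], ?_⟩
            exact ext false U V hU hUe hV hVe
    intro p q
    exact main (p + q) p q rfl

lemma layers (N : ℕ) : ∀ M : ℕ, ∃ n : ℕ, ∀ (β : Type) [DecidableEq β] (S : Finset β)
    (c : Finset β → Bool), n ≤ S.card →
      ∃ U ⊆ S, U.card = M ∧ ∃ χ : ℕ → Bool, ∀ A ⊆ U, A.card < N → c A = χ A.card := by
  induction N with
  | zero =>
    intro M
    refine ⟨M, fun β _ S c hS => ?_⟩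
    obtain ⟨U, hU, hUc⟩ := Finset.exists_subset_card_eq hS
    exact ⟨U, hU, hUc, fun _ => true, fun A _ hA => by omega⟩
  | succ N ih =>
    intro M
    obtain ⟨n1, h1⟩ := ih M
    obtain ⟨n, h⟩ := ramsey N n1 n1
    refine ⟨n, fun β _ S c hS => ?_⟩
    obtain ⟨e, U, hU, hUc, hUe⟩ : ∃ e, ∃ U ⊆ S, U.card = n1 ∧ ∀ A ⊆ U, A.card = N → c A = e := by
      rcases h β S c hS with h | h
      · exact ⟨_, h⟩
      · exact ⟨_, h⟩
    obtain ⟨V, hV, hVc, χ, hχ⟩ := h1 β U c hUc.ge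
    refine ⟨V, hV.trans hU, hVc, fun k => if k = N then e else χ k, fun A hA hAN => ?_⟩
    by_cases hk : A.card = N
    · simp only [hk, if_true]; exact hUe A (hA.trans hV) hk
    · simp only [hk, if_false]; exact hχ A hA (by omega)

lemma card_sd {β : Type} [DecidableEq β] (A B : Finset β) :
    ((symmDiff A B).card : ℤ) = A.card + B.card - 2 * (A ∩ B).card := by
  have h1 := Finset.card_sdiff_add_card_inter A B
  have h2 := Finset.card_sdiff_add_card_inter B A
  have h3 : (symmDiff A B).card = (A \ B).card + (B \ A).card := by
    rw [symmDiff_def]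
    exact Finset.card_union_of_disjoint disjoint_sdiff_sdiff
  rw [Finset.inter_comm B A] at h2
  omega

lemma map_sd {β γ : Type} [DecidableEq β] [DecidableEq γ] (σ : β ↪ γ) (A B : Finset β) :
    (symmDiff A B).map σ = symmDiff (A.map σ) (B.map σ) := by
  ext x
  simp only [Finset.mem_map, Finset.mem_symmDiff]
  constructor
  · rintro ⟨y, hy | hy, rfl⟩
    · left; exact ⟨⟨y, hy.1, rfl⟩, by rintro ⟨z, hz, hzy⟩; rw [σ.injective hzy] at hz; exact hy.2 hz⟩
    · right; exact ⟨⟨y, hy.1, rfl⟩, by rintro ⟨z, hz, hzy⟩; rw [σ.injective hzy] at hz; exact hy.2 hz⟩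
  · rintro (⟨⟨y, hy, rfl⟩, h⟩ | ⟨⟨y, hy, rfl⟩, h⟩)
    · exact ⟨y, Or.inl ⟨hy, fun h' => h ⟨y, h', rfl⟩⟩, rfl⟩
    · exact ⟨y, Or.inr ⟨hy, fun h' => h ⟨y, h', rfl⟩⟩, rfl⟩

lemma std_emb {d n : ℕ} (B : Finset (Fin n)) (σ : Fin d ↪ Fin n) :
    IsCubeEmbedding (fun A : Finset (Fin d) => symmDiff B (A.map σ)) := by
  constructor
  · intro A C h
    exact Finset.map_injective σ (symmDiff_right_injective B h)
  · intro A C h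
    have : symmDiff (symmDiff B (A.map σ)) (symmDiff B (C.map σ)) = (symmDiff A C).map σ := by
      rw [map_sd, symmDiff_symmDiff_symmDiff_comm, symmDiff_self, bot_symmDiff]
    show (symmDiff (symmDiff B (A.map σ)) (symmDiff B (C.map σ))).card = 1
    rw [this, Finset.card_map, h]

/-- realizing `Can` by a flip set -/
lemma Can.flip {β : Type} [DecidableEq β] {χ : ℤ → Bool} {a t : ℕ} {e : Bool} {b : ℤ}
    (h : Can χ a t e b) (K : Finset β) (hK : K.card = a + t) :
    ∃ J ⊆ K, ∀ A ⊆ K, A.card = a → χ (b + a - 2 * (J ∩ A).card) = e := by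
  rcases h with h | h | ⟨s, hs, h⟩
  · exact ⟨∅, by simp, fun A _ _ => by simpa using h⟩
  · refine ⟨K, subset_rfl, fun A hA hc => ?_⟩
    rw [Finset.inter_eq_right.2 hA, hc, ← h]; congr 1; ring
  · obtain ⟨J, hJ, hJc⟩ := Finset.exists_subset_card_eq (show s + t ≤ K.card by omega)
    refine ⟨J, hJ, fun A hA hc => ?_⟩
    have h1 : (J ∩ A).card ≤ s + t := hJc ▸ Finset.card_le_card Finset.inter_subset_left
    have h2 : s ≤ (J ∩ A).card := by
      have u := Finset.card_union_add_card_inter J A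
      have v := Finset.card_le_card (Finset.union_subset hJ hA)
      omega
    have := h ((J ∩ A).card - s) (by omega)
    rw [show s + ((J ∩ A).card - s) = (J ∩ A).card by omega] at this
    exact this

lemma realize {d n N : ℕ} (c : Finset (Fin n) → Bool) (U : Finset (Fin n)) (hU : U.card = d + N)
    (χ : ℕ → Bool) (hχ : ∀ A ⊆ U, A.card < N + 1 → c A = χ A.card)
    (a t : Fin 3 → ℕ) (K : Fin 3 → Finset (Fin d)) (hK : ∀ i, (K i).card = a i + t i)
    (hdis : ∀ i j, i ≠ j → Disjoint (K i) (K j)) (b : ℕ) (hb1 : d ≤ b) (hb2 : b + d ≤ N) (e : Bool)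
    (hcan : ∀ i, Can (fun x => χ x.toNat) (a i) (t i) e b) :
    ∃ ψ : Finset (Fin d) → Finset (Fin n), IsCubeEmbedding ψ ∧
      ∀ i, ∀ A ⊆ K i, A.card = a i → c (ψ A) = e := by
  choose J hJ hJc using fun i => (hcan i).flip (K i) (hK i)
  obtain ⟨U0, hU0, hU0c⟩ := Finset.exists_subset_card_eq (show d ≤ U.card by omega)
  let σ : Fin d ↪ Fin n := (U0.orderEmbOfFin hU0c).toEmbedding
  have hσ : ∀ x, σ x ∈ U0 := fun x => Finset.orderEmbOfFin_mem U0 hU0c x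
  set Jall : Finset (Fin d) := Finset.univ.biUnion J with hJall
  have hJle : Jall.card ≤ d := by simpa using Finset.card_le_univ Jall
  obtain ⟨X, hX, hXc⟩ := Finset.exists_subset_card_eq
    (show b - Jall.card ≤ (U \ U0).card by
      rw [Finset.card_sdiff_of_subset hU0]; omega)
  have hXd : ∀ x, σ x ∉ X := fun x hx => (Finset.mem_sdiff.1 (hX hx)).2 (hσ x)
  set B := Jall.map σ ∪ X with hB
  have hBc : B.card = b := by
    rw [hB, Finset.card_union_of_disjoint, Finset.card_map, hXc]
    · omega
    · rw [Finset.disjoint_left]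
      intro y hy
      obtain ⟨x, -, rfl⟩ := Finset.mem_map.1 hy
      exact hXd x
  refine ⟨_, std_emb B σ, fun i A hA hAc => ?_⟩
  have hmapU : ∀ C : Finset (Fin d), C.map σ ⊆ U := by
    intro C y hy
    obtain ⟨x, -, rfl⟩ := Finset.mem_map.1 hy
    exact hU0 (hσ x)
  have hBU : B ⊆ U := Finset.union_subset (hmapU _) (hX.trans Finset.sdiff_subset)
  have hsub : symmDiff B (A.map σ) ⊆ U := by
    rw [symmDiff_def]
    exact Finset.union_subset (Finset.sdiff_subset.trans hBU) (Finset.sdiff_subset.trans (hmapU _))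
  have hBA : B ∩ A.map σ = (J i ∩ A).map σ := by
    ext y
    simp only [hB, Finset.mem_inter, Finset.mem_union, Finset.mem_map]
    constructor
    · rintro ⟨h1, x, hx, rfl⟩
      refine ⟨x, ⟨?_, hx⟩, rfl⟩
      rcases h1 with ⟨z, hz, hzx⟩ | h1
      · have := σ.injective hzx
        subst this
        obtain ⟨j, -, hj⟩ := Finset.mem_biUnion.1 hz
        by_cases hij : i = j
        · rw [hij]; exact hj
        · exact absurd (hJ j hj) (Finset.disjoint_left.1 (hdis i j hij) (hA hx))
      · exact absurd h1 (hXd x)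
    · rintro ⟨x, ⟨h1, h2⟩, rfl⟩
      exact ⟨Or.inl ⟨x, Finset.mem_biUnion.2 ⟨i, Finset.mem_univ _, h1⟩, rfl⟩, x, h2, rfl⟩
  have hcard := card_sd B (A.map σ)
  rw [hBA, Finset.card_map, Finset.card_map, hBc, hAc] at hcard
  have hAd : A.card ≤ d := by simpa using Finset.card_le_univ A
  have := hJc i A hA hAc
  rw [← hcard] at this
  simp only [Int.toNat_natCast] at this
  rw [← this]
  apply hχ _ hsub
  omega

/-- sufficiency -/
lemma suff {d : ℕ} (a t : Fin 3 → ℕ) (K : Fin 3 → Finset (Fin d)) (hK : ∀ i, (K i).card = a i + t i)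
    (hdis : ∀ i j, i ≠ j → Disjoint (K i) (K j))
    (hp : ∀ i j, i ≠ j → PCo (a i) (t i) (a j) (t j)) :
    IsRamsey 2 d {A | ∃ i, A ∈ (K i).powersetCard (a i)} := by
  have hR : ∀ i, a i ≤ d := by
    intro i
    have : (K i).card ≤ d := by simpa using Finset.card_le_univ (K i)
    have := hK i
    omega
  obtain ⟨N, hN⟩ := core2 a t hp d hR
  obtain ⟨n0, hn0⟩ := layers (N + 1) (d + N)
  refine ⟨n0, fun n hn c => ?_⟩
  obtain ⟨U, -, hUc, χ, hχ⟩ := hn0 (Fin n) Finset.univ (fun A => decide (c A = 1)) (by simpa using hn)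
  obtain ⟨b, hb1, hb2, e, hcan⟩ := hN χ
  obtain ⟨ψ, hψ, hm⟩ := realize _ U hUc χ hχ a t K hK hdis b hb1 hb2 e hcan
  refine ⟨if e then 1 else 0, ψ, hψ, ?_⟩
  rintro A ⟨i, hi⟩
  rw [Finset.mem_powersetCard] at hi
  have := hm i A hi.1 hi.2
  show c (ψ A) = _
  cases e
  · simp at this ⊢; omega
  · simpa using this

end Cliq
namespace Cliq

lemma emb_struct {d n : ℕ} (ψ : Finset (Fin d) → Finset (Fin n)) (h : IsCubeEmbedding ψ) :
    ∃ σ : Fin d ↪ Fin n, ∀ A, ψ A = symmDiff (ψ ∅) (A.map σ) := by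
  obtain ⟨hinj, hadj⟩ := h
  have h1 : ∀ i : Fin d, ∃ x, symmDiff (ψ ∅) (ψ {i}) = {x} := by
    intro i
    apply Finset.card_eq_one.1
    apply hadj
    rw [← Finset.bot_eq_empty, bot_symmDiff]; simp
  choose s hs using h1
  have hs' : ∀ i, ψ {i} = symmDiff (ψ ∅) {s i} := by
    intro i; rw [← hs i, symmDiff_symmDiff_cancel_left]
  have sinj : Function.Injective s := by
    intro i j hij
    have : ψ {i} = ψ {j} := by rw [hs', hs', hij]
    simpa using hinj this
  refine ⟨⟨s, sinj⟩, ?_⟩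
  intro A
  induction hm : A.card using Nat.strong_induction_on generalizing A with
  | _ m ih =>
    rcases Nat.lt_or_ge m 2 with hm2 | hm2
    · have : m = 0 ∨ m = 1 := by omega
      rcases this with rfl | rfl
      · rw [Finset.card_eq_zero.1 hm, Finset.map_empty]; exact (symmDiff_bot _).symm
      · obtain ⟨i, rfl⟩ := Finset.card_eq_one.1 hm
        rw [hs']; simp
    · obtain ⟨i, hi, j, hj, hij⟩ := Finset.one_lt_card.1 (show 1 < A.card by omega)
      have sij : s i ≠ s j := fun h => hij (sinj h)
      have hji : j ∈ A.erase i := Finset.mem_erase.2 ⟨hij.symm, hj⟩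
      have hijm : i ∈ A.erase j := Finset.mem_erase.2 ⟨hij, hi⟩
      set C := (A.erase i).erase j with hC
      have ci : (A.erase i).card = m - 1 := by rw [Finset.card_erase_of_mem hi, hm]
      have cj : (A.erase j).card = m - 1 := by rw [Finset.card_erase_of_mem hj, hm]
      have cC : C.card = m - 2 := by rw [hC, Finset.card_erase_of_mem hji, ci]; omega
      have IC := ih _ (by omega) C cC
      have Ii := ih _ (by omega) (A.erase i) ci
      have Ij := ih _ (by omega) (A.erase j) cj
      set τ : Fin d ↪ Fin n := ⟨s, sinj⟩ with hτ
      have sdA : ∀ x ∈ A, symmDiff (A.erase x) A = {x} := by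
        intro x hx; ext y
        simp only [Finset.mem_symmDiff, Finset.mem_erase, Finset.mem_singleton]
        constructor
        · tauto
        · rintro rfl; tauto
      obtain ⟨p, hp⟩ := Finset.card_eq_one.1 (hadj (A.erase i) A (by rw [sdA i hi]; simp))
      obtain ⟨q, hq⟩ := Finset.card_eq_one.1 (hadj (A.erase j) A (by rw [sdA j hj]; simp))
      have hp' : ψ A = symmDiff (ψ (A.erase i)) {p} := by rw [← hp, symmDiff_symmDiff_cancel_left]
      have hq' : ψ A = symmDiff (ψ (A.erase j)) {q} := by rw [← hq, symmDiff_symmDiff_cancel_left]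
      have mA : ∀ x ∈ A, (A.erase x).map τ = symmDiff (A.map τ) {s x} := by
        intro x hx
        have h2 := congrArg (Finset.map τ) (sdA x hx)
        rw [map_sd] at h2
        have h3 : Finset.map τ {x} = {s x} := by simp [hτ]
        rw [h3] at h2
        rw [← h2, symmDiff_comm ((A.erase x).map τ), symmDiff_symmDiff_cancel_left]
      have mC : C.map τ = symmDiff (symmDiff (A.map τ) {s i}) {s j} := by
        rw [← mA i hi]
        ext y
        simp only [hC, Finset.mem_symmDiff, Finset.mem_map, Finset.mem_singleton, Finset.mem_erase, hτ,
          Function.Embedding.coeFn_mk]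
        constructor
        · rintro ⟨x, ⟨h1, h2⟩, rfl⟩
          left; exact ⟨⟨x, h2, rfl⟩, fun h => h1 (sinj h)⟩
        · rintro (⟨⟨x, h2, rfl⟩, h3⟩ | ⟨rfl, h3⟩)
          · exact ⟨x, ⟨fun h => h3 (by rw [h]), h2⟩, rfl⟩
          · exact absurd ⟨j, ⟨hij.symm, hj⟩, rfl⟩ h3
      rw [mA i hi, ← symmDiff_assoc] at Ii
      rw [mA j hj, ← symmDiff_assoc] at Ij
      rw [mC, ← symmDiff_assoc, ← symmDiff_assoc] at IC
      set Y := symmDiff (ψ ∅) (A.map τ) with hY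
      rw [Ii, symmDiff_assoc] at hp'
      rw [Ij, symmDiff_assoc] at hq'
      have e1 : symmDiff ({s i} : Finset (Fin n)) {p} = symmDiff {s j} {q} :=
        symmDiff_right_injective Y (hp'.symm.trans hq')
      have hCA : ψ A ≠ ψ C := by
        intro h
        have := hinj h
        have := congrArg Finset.card this
        omega
      by_cases hpi : p = s i
      · rw [hp', hpi, symmDiff_self, symmDiff_bot]
      · exfalso
        -- then p = s j
        have : p ∈ symmDiff ({s i} : Finset (Fin n)) {p} := by
          simp [Finset.mem_symmDiff, hpi]
        rw [e1] at this
        have hsi : s i ∈ symmDiff ({s i} : Finset (Fin n)) {p} := by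
          simp [Finset.mem_symmDiff, Ne.symm hpi]
        rw [e1] at hsi
        simp only [Finset.mem_symmDiff, Finset.mem_singleton] at this hsi
        have hpj : p = s j := by
          rcases hsi with h | h
          · exact absurd h.1 sij
          · rcases this with h' | h'
            · exact h'.1
            · exact absurd (h'.1.trans h.1.symm) hpi
        apply hCA
        rw [hp', IC, hpj]
        exact (symmDiff_assoc _ _ _).symm

lemma exists_inter {β : Type} [DecidableEq β] (K J : Finset β) (hJ : J ⊆ K) (u v : ℕ) (hu : u ≤ J.card)
    (hv : v ≤ K.card - J.card) : ∃ A ⊆ K, A.card = u + v ∧ (J ∩ A).card = u := by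
  obtain ⟨P, hP, hPc⟩ := Finset.exists_subset_card_eq hu
  obtain ⟨Q, hQ, hQc⟩ := Finset.exists_subset_card_eq
    (show v ≤ (K \ J).card by rw [Finset.card_sdiff_of_subset hJ]; exact hv)
  have hd : Disjoint P Q := Finset.disjoint_of_subset_left hP
    (Finset.disjoint_of_subset_right hQ Finset.disjoint_sdiff)
  refine ⟨P ∪ Q, Finset.union_subset (hP.trans hJ) (hQ.trans Finset.sdiff_subset), ?_, ?_⟩
  · rw [Finset.card_union_of_disjoint hd, hPc, hQc]
  · rw [← hPc]; congr 1
    ext x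
    simp only [Finset.mem_inter, Finset.mem_union]
    constructor
    · rintro ⟨h1, h2 | h2⟩
      · exact h2
      · exact absurd h1 (Finset.mem_sdiff.1 (hQ h2)).2
    · exact fun h => ⟨hP h, Or.inl h⟩

lemma mono_can {d n : ℕ} (χ : ℤ → Bool) (a t : ℕ) (K : Finset (Fin d)) (hK : K.card = a + t)
    (B : Finset (Fin n)) (σ : Fin d ↪ Fin n) (e : Bool)
    (h : ∀ A ∈ K.powersetCard a, χ (symmDiff B (A.map σ)).card = e) : Can χ a t e B.card := by
  set J := K.filter (fun x => σ x ∈ B) with hJ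
  have hJK : J ⊆ K := Finset.filter_subset _ _
  have key : ∀ u, u ≤ J.card → u ≤ a → a - u ≤ K.card - J.card → χ (B.card + a - 2 * (u : ℕ)) = e := by
    intro u h1 h2 h3
    obtain ⟨A, hA, hAc, hAJ⟩ := exists_inter K J hJK u (a - u) h1 h3
    have hAc : A.card = a := by omega
    rw [← h A (Finset.mem_powersetCard.2 ⟨hA, hAc⟩), card_sd, Finset.card_map, hAc]
    have : B ∩ A.map σ = (J ∩ A).map σ := by
      ext y
      simp only [Finset.mem_inter, Finset.mem_map, hJ, Finset.mem_filter]
      constructor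
      · rintro ⟨h1, x, hx, rfl⟩
        exact ⟨x, ⟨⟨hA hx, h1⟩, hx⟩, rfl⟩
      · rintro ⟨x, ⟨⟨h1, h2⟩, h3⟩, rfl⟩
        exact ⟨h2, x, h3, rfl⟩
    rw [this, Finset.card_map, hAJ]
  by_cases h1 : J.card ≤ t
  · left
    have := key 0 (by omega) (by omega) (by omega)
    simpa using this
  by_cases h2 : a ≤ J.card
  · right; left
    have := key a h2 le_rfl (by omega)
    rw [← this]; congr 1; ring
  right; right
  refine ⟨J.card - t, by omega, fun k hk => ?_⟩
  exact key _ (by omega) (by omega) (by omega)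

lemma ramsey_can {d : ℕ} (a1 t1 a2 t2 : ℕ) (K1 K2 : Finset (Fin d)) (h1 : K1.card = a1 + t1)
    (h2 : K2.card = a2 + t2)
    (h : IsRamsey 2 d (↑(K1.powersetCard a1) ∪ ↑(K2.powersetCard a2))) (χ : ℤ → Bool) :
    ∃ b e, Can χ a1 t1 e b ∧ Can χ a2 t2 e b := by
  obtain ⟨n, hn⟩ := h
  obtain ⟨i, ψ, hψ, hm⟩ := hn n le_rfl (fun A => if χ A.card then 1 else 0)
  obtain ⟨σ, hσ⟩ := emb_struct ψ hψ
  have hcol : ∀ A, ψ A ∈ {A : Finset (Fin n) | (if χ A.card then (1 : Fin 2) else 0) = i} →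
      χ (symmDiff (ψ ∅) (A.map σ)).card = decide (i = 1) := by
    intro A hA
    simp only [Set.mem_setOf_eq] at hA
    rw [← hσ, ← hA]
    cases hχ : χ (ψ A).card <;> simp
  refine ⟨(ψ ∅).card, decide (i = 1), ?_, ?_⟩
  · exact mono_can χ a1 t1 K1 h1 _ σ _ fun A hA => hcol A (hm A (Or.inl hA))
  · exact mono_can χ a2 t2 K2 h2 _ σ _ fun A hA => hcol A (hm A (Or.inr hA))

lemma avoid_aux (η : ℤ → Bool) (P : ℤ) (hodd : ∀ y k : ℤ, ¬ 2 ∣ k → η (y + P * k) = !η y)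
    (heven : ∀ y k : ℤ, 2 ∣ k → η (y + P * k) = η y)
    (a1 t1 a2 t2 : ℕ) (k1 k2 : ℤ) (ha1 : (a1 : ℤ) = 2 * (P * k1)) (ha2 : (a2 : ℤ) = 2 * (P * k2))
    (hk1 : ¬ 2 ∣ k1) (hk2 : 2 ∣ k2)
    (r1 : a1 = 0 ∨ ∀ y, ∃ k : ℕ, k ≤ t1 ∧ η (y - k) ≠ η y)
    (r2 : a2 = 0 ∨ ∀ y, ∃ k : ℕ, k ≤ t2 ∧ η (y - k) ≠ η y)
    (h : ∃ b e, Can (fun x => η (x / 2)) a1 t1 e b ∧ Can (fun x => η (x / 2)) a2 t2 e b) : False := by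
  obtain ⟨b, e, h1, h2⟩ := h
  have red : ∀ a t : ℕ, Can (fun x => η (x / 2)) a t e b → (a = 0 ∨ ∀ y, ∃ k : ℕ, k ≤ t ∧ η (y - k) ≠ η y) →
      η ((b + a) / 2) = e ∨ η ((b - a) / 2) = e := by
    rintro a t (h | h | ⟨s, hs, h⟩) hr
    · exact Or.inl h
    · exact Or.inr h
    · rcases hr with rfl | hr
      · have : s = 0 := by omega
        subst this
        have := h 0 (by omega)
        left
        simpa using this
      · exfalso
        obtain ⟨k, hk, hne⟩ := hr ((b + a - 2 * (s + 0 : ℕ)) / 2)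
        apply hne
        have e0 := h 0 (by omega)
        have e1 := h k hk
        simp only [] at e0 e1
        rw [e0, ← e1]
        congr 1
        push_cast
        omega
  have m1 : ∀ k : ℤ, (b + 2 * (P * k)) / 2 = b / 2 + P * k := by intro k; omega
  have m2 : ∀ k : ℤ, (b - 2 * (P * k)) / 2 = b / 2 + P * (-k) := by
    intro k; rw [mul_neg]; omega
  have q1 := red a1 t1 h1 r1
  have q2 := red a2 t2 h2 r2
  rw [ha1, m1, m2, hodd _ _ hk1, hodd _ _ (by omega)] at q1
  rw [ha2, m1, m2, heven _ _ hk2, heven _ _ (by omega)] at q2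
  simp only [or_self] at q1 q2
  rw [q2] at q1
  exact bne q1.symm

lemma nec_lt (a1 t1 a2 t2 : ℕ) (hlt : emultiplicity 2 a1 < emultiplicity 2 a2)
    (h : ∀ χ : ℤ → Bool, ∃ b e, Can χ a1 t1 e b ∧ Can χ a2 t2 e b) :
    (2 ∣ a1 ∧ 2 ∣ a2 ∧ 
      ((0 < a1 ∧ (t1 = 0 ∨ (t1 ≤ 1 ∧ 4 ∣ a1 ∧ 4 ∣ a2))) ∨
        (0 < a2 ∧ (t2 = 0 ∨ (t2 ≤ 1 ∧ 4 ∣ a1 ∧ 4 ∣ a2))))) := by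
  have ha1 : a1 ≠ 0 := by rintro rfl; simp at hlt
  obtain ⟨m, o, ho, rfl⟩ := Nat.exists_eq_two_pow_mul_odd ha1
  have hm : emultiplicity 2 (2 ^ m * o) = m := by
    rw [emultiplicity_eq_coe]
    refine ⟨Dvd.intro _ rfl, ?_⟩
    rw [pow_succ, Nat.mul_dvd_mul_iff_left (by positivity)]
    exact ho.not_two_dvd_nat
  rw [hm] at hlt
  have hd : 2 ^ (m + 1) ∣ a2 := by
    apply pow_dvd_of_le_emultiplicity
    have := Order.add_one_le_of_lt hlt
    exact_mod_cast this
  obtain ⟨n, rfl⟩ := hd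
  have ho2 : ¬ 2 ∣ o := ho.not_two_dvd_nat
  rcases m with _ | m
  · exfalso
    obtain ⟨b, e, h1, h2⟩ := h (fun x => decide (2 ∣ x))
    have red : ∀ a t : ℕ, Can (fun x => decide (2 ∣ x)) a t e b → decide (2 ∣ b + a) = e := by
      rintro a t (h | h | ⟨s, hs, h⟩)
      · exact h
      · rw [← h]; simp only [decide_eq_decide]; omega
      · rw [← h 0 (by omega)]; simp only [decide_eq_decide]; omega
    have q1 := red _ _ h1
    have q2 := red _ _ h2
    rw [← q2] at q1
    simp only [decide_eq_decide] at q1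
    push_cast at q1
    omega
  have even1 : 2 ∣ 2 ^ (m + 1) * o := Dvd.dvd.mul_right (dvd_pow_self 2 (by omega)) _
  have even2 : 2 ∣ 2 ^ (m + 1 + 1) * n := Dvd.dvd.mul_right (dvd_pow_self 2 (by omega)) _
  refine ⟨even1, even2, ?_⟩
  by_contra hbad
  have hpos1 : 0 < 2 ^ (m + 1) * o := Nat.pos_of_ne_zero ha1
  rcases m with _ | m
  · -- alternating
    have n4 : ¬ 4 ∣ 2 ^ (0 + 1) * o := by omega
    refine avoid_aux (fun y => decide (2 ∣ y)) 1 ?_ ?_ (2 ^ (0 + 1) * o) t1 (2 ^ (0 + 1 + 1) * n) t2 o (2 * n)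
      (by push_cast; ring) (by push_cast; ring) (by omega) (by omega) ?_ ?_ (h _)
    · intro y k hk
      by_cases hy : 2 ∣ y
      · have : ¬ 2 ∣ y + 1 * k := by omega
        simp [hy] at this ⊢; exact this
      · have : 2 ∣ y + 1 * k := by omega
        simp [hy] at this ⊢; exact this
    · intro y k hk
      simp only [decide_eq_decide]; omega
    · right
      intro y
      refine ⟨1, by omega, ?_⟩
      simp only [ne_eq, decide_eq_decide]; push_cast; omega
    · by_cases h0 : 2 ^ (0 + 1 + 1) * n = 0
      · exact Or.inl h0
      right
      intro y
      refine ⟨1, by omega, ?_⟩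
      simp only [ne_eq, decide_eq_decide]; push_cast; omega
  · have f1 : 4 ∣ 2 ^ (m + 1 + 1) * o := by
      refine Dvd.dvd.mul_right ?_ _
      exact ⟨2 ^ m, by ring⟩
    have f2 : 4 ∣ 2 ^ (m + 1 + 1 + 1) * n := by
      refine Dvd.dvd.mul_right ?_ _
      exact ⟨2 ^ (m + 1), by ring⟩
    set Q : ℤ := 2 ^ m with hQ
    have hQ0 : 0 < Q := by positivity
    set P : ℤ := 2 * Q with hP
    have hP0 : P ≠ 0 := by omega
    have shift : ∀ y k : ℤ, (y + P * k) / P = y / P + k := fun y k => Int.add_mul_ediv_left y k hP0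
    have e2 : ∀ k, 2 ∣ P * k := fun k => ⟨Q * k, by rw [hP]; ring⟩
    have run : ∀ y : ℤ, ∃ k : ℕ, k ≤ 2 ∧ decide (2 ∣ (y - k) + (y - k) / P) ≠ decide (2 ∣ y + y / P) := by
      intro y
      have s1 := shift (y - 2) 1
      have m1 : y / P ≤ (y - 2 + P * 1) / P := Int.ediv_le_ediv (by omega) (by omega)
      have m2 : (y - 1) / P ≤ y / P := Int.ediv_le_ediv (by omega) (by omega)
      have m3 : (y - 2) / P ≤ (y - 1) / P := Int.ediv_le_ediv (by omega) (by omega)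
      by_contra hc
      push Not at hc
      have c1 := hc 1 (by omega)
      have c2 := hc 2 (by omega)
      simp only [decide_eq_decide] at c1 c2
      push_cast at c1 c2
      omega
    refine avoid_aux (fun y => decide (2 ∣ y + y / P)) P ?_ ?_ (2 ^ (m + 1 + 1) * o) t1 (2 ^ (m + 1 + 1 + 1) * n) t2 o (2 * n)
      (by push_cast; rw [hP, hQ]; ring) (by push_cast; rw [hP, hQ]; ring) (by omega) (by omega) ?_ ?_ (h _)
    · intro y k hk
      simp only [shift]
      have := e2 k
      generalize P * k = z at *
      by_cases hy : 2 ∣ y + y / P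
      · have : ¬ 2 ∣ y + z + (y / P + k) := by omega
        simp [hy, this]
      · have : 2 ∣ y + z + (y / P + k) := by omega
        simp [hy, this]
    · intro y k hk
      simp only [shift, decide_eq_decide]
      have := e2 k
      generalize P * k = z at *
      omega
    · right
      intro y
      obtain ⟨k, hk, hne⟩ := run y
      exact ⟨k, by omega, hne⟩
    · by_cases h0 : 2 ^ (m + 1 + 1 + 1) * n = 0
      · exact Or.inl h0
      right
      intro y
      obtain ⟨k, hk, hne⟩ := run y
      exact ⟨k, by omega, hne⟩

lemma nec (a1 t1 a2 t2 : ℕ)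
    (h : ∀ χ : ℤ → Bool, ∃ b e, Can χ a1 t1 e b ∧ Can χ a2 t2 e b) : PCo a1 t1 a2 t2 := by
  rcases lt_trichotomy (emultiplicity 2 a1) (emultiplicity 2 a2) with hlt | heq | hlt
  · exact Or.inr (nec_lt a1 t1 a2 t2 hlt h)
  · exact Or.inl heq
  · right
    have := nec_lt a2 t2 a1 t1 hlt (fun χ => by
      obtain ⟨b, e, h1, h2⟩ := h χ
      exact ⟨b, e, h2, h1⟩)
    tauto

lemma PCo.symm {a1 t1 a2 t2 : ℕ} (h : PCo a1 t1 a2 t2) : PCo a2 t2 a1 t1 := by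
  unfold PCo at *
  rcases h with h | h
  · exact Or.inl h.symm
  · right; tauto

lemma IsRamsey.mono {t d : ℕ} {F G : Set (Finset (Fin d))} (hFG : F ⊆ G) (h : IsRamsey t d G) :
    IsRamsey t d F := by
  obtain ⟨n, hn⟩ := h
  refine ⟨n, fun m hm c => ?_⟩
  obtain ⟨i, ψ, hψ, h1⟩ := hn m hm c
  exact ⟨i, ψ, hψ, fun A hA => h1 A (hFG hA)⟩

end Cliq

/-- Theorem 13 (3cliques:thm): a vertex disjoint union of three cliques of pairwise
distinct weights is `2`-Ramsey iff the union of each pair of the cliques is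
`2`-Ramsey. -/
theorem three_cliques_ramsey_iff_pairs (d a1 a2 a3 t1 t2 t3 : ℕ)
    (h12 : a1 ≠ a2) (h13 : a1 ≠ a3) (h23 : a2 ≠ a3)
    (K1 K2 K3 : Finset (Fin d))
    (hK1 : K1.card = a1 + t1) (hK2 : K2.card = a2 + t2) (hK3 : K3.card = a3 + t3)
    (hd12 : Disjoint K1 K2) (hd13 : Disjoint K1 K3) (hd23 : Disjoint K2 K3) :
    IsRamsey 2 d
        (↑(K1.powersetCard a1) ∪ ↑(K2.powersetCard a2) ∪ ↑(K3.powersetCard a3)) ↔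
      (IsRamsey 2 d (↑(K1.powersetCard a1) ∪ ↑(K2.powersetCard a2)) ∧
        IsRamsey 2 d (↑(K1.powersetCard a1) ∪ ↑(K3.powersetCard a3)) ∧
        IsRamsey 2 d (↑(K2.powersetCard a2) ∪ ↑(K3.powersetCard a3))) := by
  constructor
  · intro h
    refine ⟨Cliq.IsRamsey.mono ?_ h, Cliq.IsRamsey.mono ?_ h, Cliq.IsRamsey.mono ?_ h⟩
    · rintro A (hA | hA)
      · exact Or.inl (Or.inl hA)
      · exact Or.inl (Or.inr hA)
    · rintro A (hA | hA)
      · exact Or.inl (Or.inl hA)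
      · exact Or.inr hA
    · rintro A (hA | hA)
      · exact Or.inl (Or.inr hA)
      · exact Or.inr hA
  · rintro ⟨r12, r13, r23⟩
    have p12 := Cliq.nec _ _ _ _ (Cliq.ramsey_can a1 t1 a2 t2 K1 K2 hK1 hK2 r12)
    have p13 := Cliq.nec _ _ _ _ (Cliq.ramsey_can a1 t1 a3 t3 K1 K3 hK1 hK3 r13)
    have p23 := Cliq.nec _ _ _ _ (Cliq.ramsey_can a2 t2 a3 t3 K2 K3 hK2 hK3 r23)
    refine Cliq.IsRamsey.mono ?_ (Cliq.suff ![a1, a2, a3] ![t1, t2, t3] ![K1, K2, K3] ?_ ?_ ?_)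
    · rintro A ((hA | hA) | hA)
      · exact ⟨0, hA⟩
      · exact ⟨1, hA⟩
      · exact ⟨2, hA⟩
    · intro i
      fin_cases i
      · exact hK1
      · exact hK2
      · exact hK3
    · intro i j hij
      fin_cases i <;> fin_cases j
      · exact absurd rfl hij
      · exact hd12
      · exact hd13
      · exact hd12.symm
      · exact absurd rfl hij
      · exact hd23
      · exact hd13.symm
      · exact hd23.symm
      · exact absurd rfl hij
    · intro i j hij
      fin_cases i <;> fin_cases j
      · exact absurd rfl hij
      · exact p12
      · exact p13
      · exact p12.symm
      · exact absurd rfl hij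
      · exact p23
      · exact p13.symm
      · exact p23.symm
      · exact absurd rfl hij
end

section
/- Let a_1 > a_2 > a_3 be integers such that a_1 and a_2 have the same number of factors of 2 in their prime factorizations, let t_1, t_2, t_3 be nonnegative integers, and let S = K^{(a_1)}_{a_1+t_1} ∪ K^{(a_2)}_{a_2+t_2} ∪ K^{(a_3)}_{a_3+t_3} be a vertex disjoint union of cliques. Then any 2-coloring of ℤ with no monochromatic translate of any set in W'(S) is periodic with period 2a_3. -/
/-- An automorphism of the hypercube `Q_d`: a bijection of the vertex set preserving
adjacency (symmetric difference of size one) in both directions. -/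
def IsCubeAutomorphism {d : ℕ} (ψ : Finset (Fin d) → Finset (Fin d)) : Prop :=
  Function.Bijective ψ ∧
    ∀ A B : Finset (Fin d), (symmDiff A B).card = 1 ↔ (symmDiff (ψ A) (ψ B)).card = 1

/-- `W_d(S) = {|A| : A ∈ S}`, the set of weights (as integers) of members of `S`. -/
def weightSet {d : ℕ} (S : Set (Finset (Fin d))) : Set ℤ :=
  {w | ∃ A ∈ S, (A.card : ℤ) = w}

/-- `W*(S) = {W_d(ψ(S)) : ψ an automorphism of Q_d}`. -/
def WStar {d : ℕ} (S : Set (Finset (Fin d))) : Set (Set ℤ) :=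
  {W | ∃ ψ, IsCubeAutomorphism ψ ∧ W = weightSet (ψ '' S)}

/-- `D` is a translate of `W`. -/
def IsTranslateOf (D W : Set ℤ) : Prop := ∃ j : ℤ, D = (fun x => x + j) '' W

/-- The translates of sets from `𝒲` whose smallest element is `0`. -/
def MinZeroTranslates (𝒲 : Set (Set ℤ)) : Set (Set ℤ) :=
  {D | (∃ W ∈ 𝒲, IsTranslateOf D W) ∧ 0 ∈ D ∧ ∀ x ∈ D, 0 ≤ x}

/-- `W'(S)`: translates of sets from `W*(S)` with smallest element `0` which are
minimal with respect to inclusion. -/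
def WPrime {d : ℕ} (S : Set (Finset (Fin d))) : Set (Set ℤ) :=
  {D | D ∈ MinZeroTranslates (WStar S) ∧
    ∀ D' ∈ MinZeroTranslates (WStar S), D' ⊆ D → D' = D}

/-- A family `𝒟` of sets of integers is `t`-translate-Ramsey: every `t`-coloring of `ℤ`
admits a monochromatic translate `D + j` of some `D ∈ 𝒟`. -/
def TranslateRamseySet (t : ℕ) (𝒟 : Set (Set ℤ)) : Prop :=
  ∀ c : ℤ → Fin t, ∃ D ∈ 𝒟, ∃ j : ℤ, ∀ x ∈ D, ∀ y ∈ D, c (x + j) = c (y + j)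

theorem tc_step (c : ℤ → Fin 2) (a1 a2 a3 : ℤ)
    (H : ∀ j s1 s2 s3 : ℤ, (s1 = 1 ∨ s1 = -1) → (s2 = 1 ∨ s2 = -1) → (s3 = 1 ∨ s3 = -1) →
      ¬ (c (j + s1 * a1) = c (j + s2 * a2) ∧ c (j + s2 * a2) = c (j + s3 * a3)))
    (s1 s2 : ℤ) (h1 : s1 = 1 ∨ s1 = -1) (h2 : s2 = 1 ∨ s2 = -1)
    (j : ℤ) (hj : c (j + a3) ≠ c (j - a3)) :
    c (j + (s1 * a1 + s2 * a2) + a3) ≠ c (j + (s1 * a1 + s2 * a2) - a3) ∧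
    c (j + (s1 * a1 + s2 * a2) + a3) ≠ c (j + a3) := by
  have n1 : -s1 = 1 ∨ -s1 = -1 := by omega
  have n2 : -s2 = 1 ∨ -s2 = -1 := by omega
  have p : (1 : ℤ) = 1 ∨ (1 : ℤ) = -1 := Or.inl rfl
  have m : (-1 : ℤ) = 1 ∨ (-1 : ℤ) = -1 := Or.inr rfl
  have e1 := H j s1 s2 1 h1 h2 p
  have e2 := H j s1 s2 (-1) h1 h2 m
  have f1 := H (j + s1 * a1 + a3) (-s1) s2 (-1) n1 h2 m
  have f2 := H (j + s1 * a1 - a3) (-s1) s2 1 n1 h2 p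
  have g1 := H (j + s2 * a2 + a3) s1 (-s2) (-1) h1 n2 m
  have g2 := H (j + s2 * a2 - a3) s1 (-s2) 1 h1 n2 p
  ring_nf at hj e1 e2 f1 f2 g1 g2 ⊢
  generalize c (j + a3) = x1 at *
  generalize c (j - a3) = x2 at *
  generalize c (j + s1 * a1) = x3 at *
  generalize c (j + s2 * a2) = x4 at *
  generalize c (j + a3 + s1 * a1 + s2 * a2) = x5 at *
  generalize c (j - a3 + s1 * a1 + s2 * a2) = x6 at *
  clear H h1 h2 n1 n2 p m
  revert x1 x2 x3 x4 x5 x6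
  decide

theorem tc_iter (c : ℤ → Fin 2) (a3 s : ℤ)
    (H : ∀ j, c (j + a3) ≠ c (j - a3) →
      c (j + s + a3) ≠ c (j + s - a3) ∧ c (j + s + a3) ≠ c (j + a3)) (n : ℕ) (j : ℤ)
    (hj : c (j + a3) ≠ c (j - a3)) :
    c (j + n * s + a3) ≠ c (j + n * s - a3) ∧ (c (j + n * s + a3) = c (j + a3) ↔ Even n) := by
  induction n with
  | zero => simpa using hj
  | succ n ih =>
    obtain ⟨h1, h2⟩ := ih
    have h3 := H _ h1
    have e : j + ((n + 1 : ℕ) : ℤ) * s = j + n * s + s := by push_cast; ring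
    rw [e]
    refine ⟨h3.1, ?_⟩
    rw [Nat.even_add_one, ← h2]
    have := h3.2
    generalize c (j + n * s + s + a3) = x at *
    generalize c (j + n * s + a3) = y at *
    generalize c (j + a3) = z at *
    clear h1 h2 h3 hj
    revert x y z
    decide

theorem tc_main (c : ℤ → Fin 2) (a1 a2 a3 : ℤ) (p q r : ℕ) (hp : Odd p) (hq : Odd q)
    (hpq : q < p) (ha1 : a1 = p * 2 ^ r) (ha2 : a2 = q * 2 ^ r)
    (H : ∀ j s1 s2 s3 : ℤ, (s1 = 1 ∨ s1 = -1) → (s2 = 1 ∨ s2 = -1) → (s3 = 1 ∨ s3 = -1) →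
      ¬ (c (j + s1 * a1) = c (j + s2 * a2) ∧ c (j + s2 * a2) = c (j + s3 * a3)))
    (j : ℤ) : c (j + a3) = c (j - a3) := by
  by_contra hj
  obtain ⟨k, rfl⟩ := hp
  obtain ⟨l, rfl⟩ := hq
  obtain ⟨m, rfl⟩ : ∃ m, k = l + m := ⟨k - l, by omega⟩
  have A := tc_iter c a3 _ (tc_step c a1 a2 a3 H 1 (-1) (Or.inl rfl) (Or.inr rfl))
    (2 * l + m + 1) j hj
  have B := tc_iter c a3 _ (tc_step c a1 a2 a3 H (-1) (-1) (Or.inr rfl) (Or.inr rfl))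
    m _ A.1
  have e : j + ((2 * l + m + 1 : ℕ) : ℤ) * (1 * a1 + -1 * a2) + m * (-1 * a1 + -1 * a2) = j := by
    rw [ha1, ha2]; push_cast; ring
  rw [e] at B
  have A2 := A.2
  have B2 := B.2
  rw [eq_comm, A2] at B2
  rw [Nat.even_iff, Nat.even_iff] at B2
  omega

theorem tc_card {d : ℕ} (F K A : Finset (Fin d)) (a : ℕ) (s : ℤ)
    (hF : (s = 1 ∧ Disjoint K F) ∨ (s = -1 ∧ K ⊆ F)) (hA : A ∈ K.powersetCard a) :
    ((symmDiff A F).card : ℤ) = F.card + s * a := by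
  rw [Finset.mem_powersetCard] at hA
  obtain ⟨hAK, rfl⟩ := hA
  rcases hF with ⟨rfl, h⟩ | ⟨rfl, h⟩
  · have h' : Disjoint A F := Finset.disjoint_of_subset_left hAK h
    rw [h'.symmDiff_eq_sup, Finset.sup_eq_union, Finset.card_union_of_disjoint h']
    push_cast; ring
  · have h' : A ⊆ F := hAK.trans h
    rw [symmDiff_of_le h', Finset.card_sdiff_of_subset h', Nat.cast_sub (Finset.card_le_card h')]
    ring

theorem tc_aut {d : ℕ} (F : Finset (Fin d)) :
    IsCubeAutomorphism (fun A : Finset (Fin d) => symmDiff A F) := by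
  refine ⟨(symmDiff_left_involutive F).bijective, fun A B => ?_⟩
  have : symmDiff (symmDiff A F) (symmDiff B F) = symmDiff A B := by
    rw [symmDiff_symmDiff_symmDiff_comm, symmDiff_self, symmDiff_bot]
  simp only [this]

theorem tc_reduce {d : ℕ} (S : Set (Finset (Fin d))) (c : ℤ → Fin 2)
    (hc : ¬ ∃ D ∈ WPrime S, ∃ j : ℤ, ∀ x ∈ D, ∀ y ∈ D, c (x + j) = c (y + j))
    (W : Set ℤ) (hW : W ∈ WStar S) (hfin : W.Finite) (hne : W.Nonempty) (i : ℤ)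
    (hmono : ∀ x ∈ W, ∀ y ∈ W, c (x + i) = c (y + i)) : False := by
  obtain ⟨m, hm, hmin⟩ := Set.exists_min_image W id hfin hne
  let D : Set ℤ := (fun x => x + (-m)) '' W
  have hD : D ∈ MinZeroTranslates (WStar S) := by
    refine ⟨⟨W, hW, -m, rfl⟩, ⟨m, hm, by simp⟩, ?_⟩
    rintro _ ⟨x, hx, rfl⟩
    have := hmin x hx
    simp only [id] at this
    simp only; omega
  have hDf : D.Finite := hfin.image _
  have hf : {D' | D' ∈ MinZeroTranslates (WStar S) ∧ D' ⊆ D}.Finite :=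
    hDf.finite_subsets.subset (fun x hx => hx.2)
  obtain ⟨D', hD'⟩ := hf.exists_minimal ⟨D, hD, subset_rfl⟩
  apply hc
  refine ⟨D', ⟨hD'.prop.1, fun E hE hED => ?_⟩, m + i, ?_⟩
  · exact subset_antisymm hED (hD'.le_of_le ⟨hE, hED.trans hD'.prop.2⟩ hED)
  · intro x hx y hy
    obtain ⟨x', hx', rfl⟩ := hD'.prop.2 hx
    obtain ⟨y', hy', rfl⟩ := hD'.prop.2 hy
    have := hmono x' hx' y' hy'
    simpa [add_assoc] using this

theorem tc_flip {d : ℕ} (K1 K2 K3 : Finset (Fin d))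
    (hd12 : Disjoint K1 K2) (hd13 : Disjoint K1 K3) (hd23 : Disjoint K2 K3)
    (s1 s2 s3 : ℤ) (h1 : s1 = 1 ∨ s1 = -1) (h2 : s2 = 1 ∨ s2 = -1) (h3 : s3 = 1 ∨ s3 = -1) :
    ∃ F : Finset (Fin d), ((s1 = 1 ∧ Disjoint K1 F) ∨ (s1 = -1 ∧ K1 ⊆ F)) ∧
      ((s2 = 1 ∧ Disjoint K2 F) ∨ (s2 = -1 ∧ K2 ⊆ F)) ∧
      ((s3 = 1 ∧ Disjoint K3 F) ∨ (s3 = -1 ∧ K3 ⊆ F)) := by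
  have hd21 := hd12.symm
  have hd31 := hd13.symm
  have hd32 := hd23.symm
  have sub1 : ∀ A B C : Finset (Fin d), A ⊆ A ∪ B ∪ C := by intro A B C x; simp; tauto
  have sub2 : ∀ A B C : Finset (Fin d), B ⊆ A ∪ B ∪ C := by intro A B C x; simp; tauto
  have sub3 : ∀ A B C : Finset (Fin d), C ⊆ A ∪ B ∪ C := by intro A B C x; simp; tauto
  refine ⟨(if s1 = -1 then K1 else ∅) ∪ (if s2 = -1 then K2 else ∅) ∪
    (if s3 = -1 then K3 else ∅), ?_, ?_, ?_⟩
  · rcases h1 with rfl | rfl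
    · left; refine ⟨rfl, ?_⟩
      rw [Finset.disjoint_union_right, Finset.disjoint_union_right]
      refine ⟨⟨?_, ?_⟩, ?_⟩ <;> first | (simp; done) | split_ifs <;>
        first | assumption | exact Finset.disjoint_empty_right _
    · right; exact ⟨rfl, by simp⟩
  · rcases h2 with rfl | rfl
    · left; refine ⟨rfl, ?_⟩
      rw [Finset.disjoint_union_right, Finset.disjoint_union_right]
      refine ⟨⟨?_, ?_⟩, ?_⟩ <;> first | (simp; done) | split_ifs <;>
        first | assumption | exact Finset.disjoint_empty_right _
    · right; exact ⟨rfl, by simpa using sub2 _ K2 _⟩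
  · rcases h3 with rfl | rfl
    · left; refine ⟨rfl, ?_⟩
      rw [Finset.disjoint_union_right, Finset.disjoint_union_right]
      refine ⟨⟨?_, ?_⟩, ?_⟩ <;> first | (simp; done) | split_ifs <;>
        first | assumption | exact Finset.disjoint_empty_right _
    · right; exact ⟨rfl, sub3 _ _ K3⟩

/-- Lemma 15 (3cliques3:lem): let `a1 > a2 > a3` be integers such that `a1` and `a2`
have the same number of factors of `2` in their prime factorizations (i.e.
`a1 = p·2^r`, `a2 = q·2^r` with `p, q` odd), let `t1, t2, t3 ≥ 0`, and let
`S = K^{(a1)} ∪ K^{(a2)} ∪ K^{(a3)}` be a vertex disjoint union of cliques. Then any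
`2`-coloring of `ℤ` with no monochromatic translate of any set in `W'(S)` is periodic
with period `2·a3`. -/
theorem three_cliques_periodic_two_a3 (d a1 a2 a3 t1 t2 t3 : ℕ)
    (hgt1 : a2 < a1) (hgt2 : a3 < a2)
    (hval : ∃ p q r : ℕ, Odd p ∧ Odd q ∧ a1 = p * 2 ^ r ∧ a2 = q * 2 ^ r)
    (K1 K2 K3 : Finset (Fin d))
    (hK1 : K1.card = a1 + t1) (hK2 : K2.card = a2 + t2) (hK3 : K3.card = a3 + t3)
    (hd12 : Disjoint K1 K2) (hd13 : Disjoint K1 K3) (hd23 : Disjoint K2 K3)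
    (S : Set (Finset (Fin d)))
    (hS : S = ↑(K1.powersetCard a1) ∪ ↑(K2.powersetCard a2) ∪ ↑(K3.powersetCard a3))
    (c : ℤ → Fin 2)
    (hc : ¬ ∃ D ∈ WPrime S, ∃ j : ℤ, ∀ x ∈ D, ∀ y ∈ D, c (x + j) = c (y + j)) :
    ∀ x : ℤ, c (x + 2 * (a3 : ℤ)) = c x := by
  obtain ⟨p, q, r, hp, hq, ha1, ha2⟩ := hval
  have hpq : q < p := by
    rw [ha1, ha2] at hgt1
    exact lt_of_mul_lt_mul_right hgt1 (Nat.zero_le _)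
  have key := tc_main c (a1 : ℤ) a2 a3 p q r hp hq hpq (by rw [ha1]; push_cast; rfl)
    (by rw [ha2]; push_cast; rfl) ?_
  · intro x
    have := key (x + a3)
    rw [add_sub_cancel_right] at this
    rw [← this]
    congr 1
    ring
  · rintro j s1 s2 s3 h1 h2 h3 ⟨m1, m2⟩
    obtain ⟨F, hF1, hF2, hF3⟩ := tc_flip K1 K2 K3 hd12 hd13 hd23 s1 s2 s3 h1 h2 h3
    let W := weightSet ((fun A : Finset (Fin d) => symmDiff A F) '' S)
    have hsub : W ⊆ {(F.card : ℤ) + s1 * a1, (F.card : ℤ) + s2 * a2, (F.card : ℤ) + s3 * a3} := by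
      rintro w ⟨_, ⟨A, hA, rfl⟩, rfl⟩
      rw [hS] at hA
      rcases hA with (hA | hA) | hA
      · left; exact tc_card F K1 A a1 s1 hF1 hA
      · right; left; exact tc_card F K2 A a2 s2 hF2 hA
      · right; right; exact tc_card F K3 A a3 s3 hF3 hA
    have hne : W.Nonempty := by
      obtain ⟨A, hA⟩ := Finset.powersetCard_nonempty.2 (show a1 ≤ K1.card by omega)
      exact ⟨_, _, ⟨A, by rw [hS]; exact Or.inl (Or.inl hA), rfl⟩, rfl⟩
    have hcol : ∀ w ∈ W, c (w + (j - F.card)) = c (j + s1 * a1) := by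
      intro w hw
      have e : ∀ z : ℤ, (F.card : ℤ) + z + (j - F.card) = j + z := fun z => by ring
      rcases hsub hw with h | h | h
      · rw [h, e]
      · rw [h, e, m1]
      · rw [h, e, m1, m2]
    exact tc_reduce S c hc W ⟨_, tc_aut F, rfl⟩ (Set.Finite.subset (by simp) hsub) hne
      (j - F.card) (fun x hx y hy => (hcol x hx).trans (hcol y hy).symm)
end

section
/- If S ⊆ V_d is the vertex disjoint union of s ≥ 39 cliques K^{(a_1)}_{a_1+t_1}, ..., K^{(a_s)}_{a_s+t_s} of pairwise distinct weights, and t_i ≥ 2 for each i, then S is not 2-Ramsey. -/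
namespace CliqueProof

/-- base point of the pair containing the position `m` -/
def vb (m : ℤ) : ℤ := if m % 4 < 2 then m else m - 2

/-- colour of the position `m` under the bits `X` -/
def chi (X : Finset ℤ) (m : ℤ) : Bool := if m % 4 < 2 then decide (m ∈ X) else decide (m - 2 ∉ X)

/-- set the colour of position `m` to `b` -/
def setc (X : Finset ℤ) (m : ℤ) (b : Bool) : Finset ℤ :=
  if (m % 4 < 2 ↔ b = true) then insert (vb m) X else X.erase (vb m)

lemma mem_setc (X : Finset ℤ) (m : ℤ) (b : Bool) (w : ℤ) :
    w ∈ setc X m b ↔ (if w = vb m then (m % 4 < 2 ↔ b = true) else w ∈ X) := by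
  unfold setc
  split_ifs <;> simp_all

lemma chi_eq (X : Finset ℤ) (m : ℤ) (b : Bool) :
    chi X m = b ↔ (vb m ∈ X ↔ (m % 4 < 2 ↔ b = true)) := by
  unfold chi vb
  split_ifs with h <;> cases b <;> simp [h]

lemma chi_congr {X Y : Finset ℤ} {m : ℤ} (h : vb m ∈ X ↔ vb m ∈ Y) : chi X m = chi Y m := by
  rw [chi_eq, h, ← chi_eq]

lemma chi_setc_self (X : Finset ℤ) (m : ℤ) (b : Bool) : chi (setc X m b) m = b := by
  rw [chi_eq, mem_setc]; simp

/-- changing another position keeps the colour of `k`, or makes it the opposite of the new one -/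
lemma chi_setc_ne (X : Finset ℤ) (m k : ℤ) (b c : Bool) (hk : k ≠ m) (hbc : c = !b)
    (h : chi X k = c) : chi (setc X m b) k = c := by
  by_cases hv : vb k = vb m
  · rw [chi_eq, mem_setc, if_pos hv]
    have : (m % 4 < 2) ↔ ¬ (k % 4 < 2) := by
      unfold vb at hv; split_ifs at hv <;> omega
    subst hbc
    cases b <;> simp [this]
  · rw [← h]
    apply chi_congr
    rw [mem_setc, if_neg hv]

lemma setc_setc_inj {X Y : Finset ℤ} {m : ℤ} {b : Bool}
    (h : setc X m b = setc Y m b) (h1 : chi X m = chi Y m) : X = Y := by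
  ext w
  by_cases hw : w = vb m
  · have := (chi_eq X m (chi Y m)).1 h1
    have h2 := (chi_eq Y m (chi Y m)).1 rfl
    rw [hw]; tauto
  · have := Finset.ext_iff.1 h w
    simpa [mem_setc, hw] using this

def vars (r : ℤ) (J : Finset ℤ) : Finset ℤ :=
  J.image (fun a => vb (r + a)) ∪ J.image (fun a => vb (r - a))

def Sat (r : ℤ) (J : Finset ℤ) (c : Bool) (X : Finset ℤ) : Prop :=
  ∀ a ∈ J, chi X (r + a) = c ∨ chi X (r - a) = c

open Classical in
lemma count_sat (r : ℤ) (c : Bool) (U : Finset ℤ) (J : Finset ℤ) :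
    (∀ a ∈ J, 0 ≤ a) → ((r % 4 = 1 ∨ r % 4 = 2) → (1:ℤ) ∉ J) → vars r J ⊆ U →
    (U.powerset.filter (Sat r J c)).card * 4 ^ J.card ≤ 3 ^ J.card * 2 ^ U.card := by
  induction J using Finset.induction_on with
  | empty =>
    intro _ _ _
    simpa using (Finset.card_filter_le U.powerset (Sat r ∅ c))
  | insert a J haJ ih =>
    intro h0 h1 hU
    have hJ := ih (fun b hb => h0 b (Finset.mem_insert_of_mem hb))
      (fun h hh => h1 h (Finset.mem_insert_of_mem hh))
      (by
        refine subset_trans ?_ hU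
        unfold vars
        apply Finset.union_subset_union <;> apply Finset.image_subset_image <;>
          exact Finset.subset_insert _ _)
    have ha0 : 0 ≤ a := h0 a (Finset.mem_insert_self _ _)
    have hm : vb (r + a) ∈ U := hU (by
      unfold vars
      exact Finset.mem_union_left _ (Finset.mem_image_of_mem (fun a => vb (r + a)) (Finset.mem_insert_self a J)))
    have hm' : vb (r - a) ∈ U := hU (by
      unfold vars
      exact Finset.mem_union_right _ (Finset.mem_image_of_mem (fun a => vb (r - a)) (Finset.mem_insert_self a J)))
    have hvne : a ≠ 0 → vb (r + a) ≠ vb (r - a) := by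
      intro hne hv
      have : a = 1 ∧ (r % 4 = 1 ∨ r % 4 = 2) := by
        unfold vb at hv; split_ifs at hv <;> omega
      exact h1 this.2 (by rw [← this.1]; exact Finset.mem_insert_self _ _)
    set S := U.powerset.filter (Sat r J c) with hS
    set S1 := U.powerset.filter (Sat r (insert a J) c) with hS1
    set S0 := S.filter (fun X => ¬ Sat r (insert a J) c X) with hS0
    have hsplit : S1.card + S0.card = S.card := by
      rw [← Finset.card_filter_add_card_filter_not (s := S) (Sat r (insert a J) c)]
      congr 2
      ext X
      simp only [hS1, hS, Finset.mem_filter, Finset.mem_powerset]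
      constructor
      · rintro ⟨h, h'⟩
        exact ⟨⟨h, fun b hb => h' b (Finset.mem_insert_of_mem hb)⟩, h'⟩
      · rintro ⟨⟨h, _⟩, h'⟩
        exact ⟨h, h'⟩
    have hmap : S1.card ≤ (S0 ×ˢ (({(c, c), (c, !c), (!c, c)} : Finset (Bool × Bool)))).card := by
      apply Finset.card_le_card_of_injOn
        (fun X => (setc (setc X (r + a) (!c)) (r - a) (!c), (chi X (r + a), chi X (r - a))))
      · intro X hX
        simp only [hS1, Finset.coe_filter, Set.mem_ofPred_eq, Finset.mem_powerset] at hX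
        obtain ⟨hXU, hXs⟩ := hX
        simp only [Finset.coe_product, Set.mem_prod, Finset.mem_coe, hS0, hS, Finset.mem_filter,
          Finset.mem_powerset]
        refine ⟨⟨⟨?_, ?_⟩, ?_⟩, ?_⟩
        · intro w hw
          rw [mem_setc, mem_setc] at hw
          split_ifs at hw with h2 h3
          · rw [h2]; exact hm'
          · rw [h3]; exact hm
          · exact hXU hw
        · intro b hb
          have hb0 : 0 ≤ b := h0 b (Finset.mem_insert_of_mem hb)
          have hba : b ≠ a := by rintro rfl; exact haJ hb
          rcases hXs b (Finset.mem_insert_of_mem hb) with h | h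
          · left
            exact chi_setc_ne _ _ _ _ _ (by omega) (by simp)
              (chi_setc_ne _ _ _ _ _ (by omega) (by simp) h)
          · right
            exact chi_setc_ne _ _ _ _ _ (by omega) (by simp)
              (chi_setc_ne _ _ _ _ _ (by omega) (by simp) h)
        · intro h
          rcases h a (Finset.mem_insert_self _ _) with h | h
          · by_cases haz : a = 0
            · subst haz
              simp only [add_zero, sub_zero] at h
              rw [chi_setc_self] at h
              cases c <;> simp at h
            · have : chi (setc (setc X (r + a) (!c)) (r - a) (!c)) (r + a)
                  = chi (setc X (r + a) (!c)) (r + a) := by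
                apply chi_congr
                rw [mem_setc, if_neg (hvne haz)]
              rw [this, chi_setc_self] at h
              cases c <;> simp at h
          · rw [chi_setc_self] at h
            cases c <;> simp at h
        · have := hXs a (Finset.mem_insert_self _ _)
          cases c <;> cases h4 : chi X (r + a) <;> cases h5 : chi X (r - a) <;> simp_all
      · intro X _ Y _ h
        simp only [Prod.mk.injEq] at h
        obtain ⟨h2, h3, h4⟩ := h
        apply setc_setc_inj (m := r + a) (b := !c) _ h3
        apply setc_setc_inj h2
        by_cases haz : a = 0
        · subst haz
          simp only [add_zero, sub_zero]
          rw [chi_setc_self, chi_setc_self]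
        · have : ∀ Z, chi (setc Z (r + a) (!c)) (r - a) = chi Z (r - a) := by
            intro Z
            apply chi_congr
            rw [mem_setc, if_neg (hvne haz).symm]
          rw [this, this, h4]
    have h3 : S1.card ≤ S0.card * 3 := by
      rw [Finset.card_product] at hmap
      refine hmap.trans (Nat.mul_le_mul_left _ Finset.card_le_three)
    rw [Finset.card_insert_of_notMem haJ, pow_succ, pow_succ]
    have h4 : S1.card * 4 ≤ S.card * 3 := by omega
    calc S1.card * (4 ^ J.card * 4) = (S1.card * 4) * 4 ^ J.card := by ring
      _ ≤ (S.card * 3) * 4 ^ J.card := Nat.mul_le_mul_right _ h4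
      _ = 3 * (S.card * 4 ^ J.card) := by ring
      _ ≤ 3 * (3 ^ J.card * 2 ^ U.card) := Nat.mul_le_mul_left _ hJ
      _ = _ := by ring

section Rosenfeld

variable (vs : ℤ → Finset ℤ) (Bad : ℤ → Finset ℤ → Prop)

open Classical in
/-- colourings of `V` avoiding the bad events inside `V` -/
noncomputable def good (V : Finset ℤ) : Finset (Finset ℤ) :=
  V.powerset.filter (fun X => ∀ e, vs e ⊆ V → ¬ Bad e X)

open Classical in
lemma rosenfeld (hloc : ∀ e X Y, X ∩ vs e = Y ∩ vs e → Bad e X → Bad e Y)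
    (β : ℝ) (hβ : 0 < β) (w : ℤ → ℝ)
    (T : ℤ → Finset ℤ) (hT : ∀ e v, v ∈ vs e → e ∈ T v)
    (hN : ∀ e, (((vs e).powerset.filter (Bad e)).card : ℝ) ≤ w e * β ^ ((vs e).card - 1))
    (hw0 : ∀ e, 0 ≤ w e)
    (hw : ∀ v, ∑ e ∈ T v, w e ≤ 2 - β) :
    ∀ (k : ℕ) (V : Finset ℤ), V.card = k → ∀ v, v ∉ V →
      β * ((good vs Bad V).card : ℝ) ≤ ((good vs Bad (insert v V)).card : ℝ) := by
  intro k
  induction k using Nat.strong_induction_on with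
  | _ k IH =>
  intro V hV v hv
  have chain : ∀ (D U : Finset ℤ), Disjoint U D → U ∪ D ⊆ V →
      β ^ D.card * ((good vs Bad U).card : ℝ) ≤ ((good vs Bad (U ∪ D)).card : ℝ) := by
    intro D
    induction D using Finset.induction_on with
    | empty => intro U _ _; simp
    | insert x D hx ihD =>
      intro U hd hs
      rw [Finset.disjoint_insert_right] at hd
      have hs' : insert x (U ∪ D) ⊆ V := by rwa [← Finset.union_insert]
      have h1 := ihD U hd.2 ((Finset.subset_insert _ _).trans hs')
      have hxU : x ∉ U ∪ D := by simp [hx, hd.1]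
      have hlt : (U ∪ D).card < k := by
        have := Finset.card_le_card hs'
        rw [Finset.card_insert_of_notMem hxU] at this
        omega
      have h2 := IH _ hlt (U ∪ D) rfl x hxU
      rw [Finset.union_insert, Finset.card_insert_of_notMem hx, pow_succ]
      calc β ^ D.card * β * ((good vs Bad U).card : ℝ)
          = β * (β ^ D.card * ((good vs Bad U).card : ℝ)) := by ring
        _ ≤ β * ((good vs Bad (U ∪ D)).card : ℝ) := by gcongr
        _ ≤ _ := h2
  -- the failing extensions for each event
  set F : ℤ → Finset (Finset ℤ) := fun e =>
    (insert v V).powerset.filter (fun X => X.erase v ∈ good vs Bad V ∧ v ∈ vs e ∧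
      vs e ⊆ insert v V ∧ Bad e X) with hF
  have hFe : ∀ e, ((F e).card : ℝ) ≤ w e * (good vs Bad V).card := by
    intro e
    by_cases hve : v ∈ vs e ∧ vs e ⊆ insert v V
    swap
    · have : F e = ∅ := by
        rw [hF]
        apply Finset.filter_eq_empty_iff.2
        intro X _ h
        exact hve ⟨h.2.1, h.2.2.1⟩
      rw [this]
      simp only [Finset.card_empty, Nat.cast_zero]
      exact mul_nonneg (hw0 e) (Nat.cast_nonneg _)
    obtain ⟨hve, hsub⟩ := hve
    have h1 : (F e).card ≤ (((vs e).powerset.filter (Bad e)) ×ˢ good vs Bad (V \ vs e)).card := by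
      apply Finset.card_le_card_of_injOn (fun X => (X ∩ vs e, X \ vs e))
      · intro X hX
        simp only [hF, Finset.coe_filter, Set.mem_ofPred_eq, Finset.mem_powerset] at hX
        obtain ⟨hXV, hXg, -, -, hbad⟩ := hX
        simp only [Finset.coe_product, Set.mem_prod, Finset.mem_coe, Finset.mem_filter,
          Finset.mem_powerset, good]
        refine ⟨⟨Finset.inter_subset_right, hloc e X _ ?_ hbad⟩, ?_, ?_⟩
        · ext z; simp
        · intro z hz
          rw [Finset.mem_sdiff] at hz ⊢
          refine ⟨?_, hz.2⟩
          rcases Finset.mem_insert.1 (hXV hz.1) with h | h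
          · rw [h] at hz; exact absurd hve hz.2
          · exact h
        · intro e' he' hb
          simp only [good, Finset.mem_filter] at hXg
          apply hXg.2 e' (he'.trans Finset.sdiff_subset)
          apply hloc e' _ _ _ hb
          ext z
          simp only [Finset.mem_inter, Finset.mem_sdiff, Finset.mem_erase]
          constructor
          · rintro ⟨⟨h1, h2⟩, h3⟩
            exact ⟨⟨by rintro rfl; exact h2 hve, h1⟩, h3⟩
          · rintro ⟨⟨h1, h2⟩, h3⟩
            exact ⟨⟨h2, (Finset.mem_sdiff.1 (he' h3)).2⟩, h3⟩
      · intro X _ Y _ h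
        simp only [Prod.mk.injEq] at h
        rw [← Finset.sdiff_union_inter X (vs e), ← Finset.sdiff_union_inter Y (vs e), h.1, h.2]
    have h2 := chain (V ∩ vs e) (V \ vs e)
      (by rw [Finset.disjoint_left]; intro z; simp; tauto)
      (by rw [Finset.sdiff_union_inter])
    rw [Finset.sdiff_union_inter] at h2
    have h3 : (V ∩ vs e).card = (vs e).card - 1 := by
      rw [← Finset.card_erase_of_mem hve]
      congr 1
      ext z
      simp only [Finset.mem_inter, Finset.mem_erase]
      constructor
      · rintro ⟨h, h'⟩; exact ⟨by rintro rfl; exact hv h, h'⟩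
      · rintro ⟨h, h'⟩
        exact ⟨(Finset.mem_insert.1 (hsub h')).resolve_left h, h'⟩
    rw [h3] at h2
    rw [Finset.card_product] at h1
    calc ((F e).card : ℝ) ≤ (((vs e).powerset.filter (Bad e)).card : ℝ) * (good vs Bad (V \ vs e)).card := by
          exact_mod_cast h1
      _ ≤ w e * β ^ ((vs e).card - 1) * (good vs Bad (V \ vs e)).card := by
          gcongr; exact hN e
      _ = w e * (β ^ ((vs e).card - 1) * (good vs Bad (V \ vs e)).card) := by ring
      _ ≤ _ := by gcongr; exact hw0 e
  have htot : (good vs Bad V).card * 2 ≤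
      (good vs Bad (insert v V) ∪ (T v).biUnion F).card := by
    rw [← Fintype.card_bool, ← Finset.card_univ, ← Finset.card_product]
    apply Finset.card_le_card_of_injOn (fun p => if p.2 then insert v p.1 else p.1)
    · rintro ⟨X, b⟩ hX
      simp only [Finset.coe_product, Set.mem_prod, Finset.mem_coe] at hX
      replace hX := hX.1
      have hXV : X ⊆ V := by
        simp only [good, Finset.mem_filter, Finset.mem_powerset] at hX; exact hX.1
      have hvX : v ∉ X := fun h => hv (hXV h)
      set Z := (if b then insert v X else X) with hZ
      have hZe : Z.erase v = X := by
        rw [hZ]; split_ifs <;> simp [hvX]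
      have hZV : Z ⊆ insert v V := by
        rw [hZ]; split_ifs
        · exact Finset.insert_subset_insert _ hXV
        · exact hXV.trans (Finset.subset_insert _ _)
      change Z ∈ _
      rw [Finset.mem_coe, Finset.mem_union]
      by_cases hg : Z ∈ good vs Bad (insert v V)
      · exact Or.inl hg
      right
      simp only [good, Finset.mem_filter, Finset.mem_powerset, hZV, true_and, not_forall,
        not_not] at hg
      obtain ⟨e, hes, hb⟩ := hg
      have hve : v ∈ vs e := by
        by_contra hcon
        have hX2 := hX
        simp only [good, Finset.mem_filter, Finset.mem_powerset] at hX2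
        apply hX2.2 e
        · intro z hz
          exact (Finset.mem_insert.1 (hes hz)).resolve_left (by rintro rfl; exact hcon hz)
        · apply hloc e Z _ _ hb
          rw [← hZe]
          ext z
          simp only [Finset.mem_inter, Finset.mem_erase]
          constructor
          · rintro ⟨h, h'⟩; exact ⟨⟨by rintro rfl; exact hcon h', h⟩, h'⟩
          · rintro ⟨h, h'⟩; exact ⟨h.2, h'⟩
      rw [Finset.mem_biUnion]
      refine ⟨e, hT e v hve, ?_⟩
      simp only [hF, Finset.mem_filter, Finset.mem_powerset]
      exact ⟨hZV, by rw [hZe]; exact hX, hve, hes, hb⟩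
    · rintro ⟨X, b⟩ hX ⟨Y, b'⟩ hY h
      simp only [Finset.coe_product, Set.mem_prod, Finset.mem_coe, good, Finset.mem_filter, Finset.mem_powerset] at hX hY
      have hvX : v ∉ X := fun h => hv (hX.1.1 h)
      have hvY : v ∉ Y := fun h => hv (hY.1.1 h)
      have h5 := Finset.ext_iff.1 h
      have hb : b = b' := by
        have h8 := h5 v
        clear h h5
        cases b <;> cases b' <;> simp [hvX, hvY] at h8 ⊢
      subst hb
      congr 1
      cases b
      · simpa using h
      · simp only [if_true] at h
        rw [← Finset.erase_insert hvX, h, Finset.erase_insert hvY]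
  have h6 : ((good vs Bad V).card : ℝ) * 2 ≤ (good vs Bad (insert v V)).card +
      ∑ e ∈ T v, ((F e).card : ℝ) := by
    have := htot.trans ((Finset.card_union_le _ _).trans (Nat.add_le_add_left Finset.card_biUnion_le _))
    exact_mod_cast this
  have h7 : ∑ e ∈ T v, ((F e).card : ℝ) ≤ (2 - β) * (good vs Bad V).card := by
    calc ∑ e ∈ T v, ((F e).card : ℝ) ≤ ∑ e ∈ T v, w e * (good vs Bad V).card :=
          Finset.sum_le_sum (fun e _ => hFe e)
      _ = (∑ e ∈ T v, w e) * (good vs Bad V).card := by rw [Finset.sum_mul]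
      _ ≤ _ := by gcongr; exact hw v
  linarith

lemma rosenfeld' (hloc : ∀ e X Y, X ∩ vs e = Y ∩ vs e → Bad e X → Bad e Y)
    (β : ℝ) (hβ : 0 < β)
    (hstep : ∀ (k : ℕ) (V : Finset ℤ), V.card = k → ∀ v, v ∉ V →
      β * ((good vs Bad V).card : ℝ) ≤ ((good vs Bad (insert v V)).card : ℝ))
    (hne : ∀ e, (vs e).Nonempty) (V : Finset ℤ) : (good vs Bad V).Nonempty := by
  have : 0 < ((good vs Bad V).card : ℝ) := by
    induction V using Finset.induction_on with
    | empty =>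
      rw [Nat.cast_pos, Finset.card_pos]
      refine ⟨∅, ?_⟩
      simp only [good, Finset.mem_filter, Finset.mem_powerset, subset_refl, true_and]
      intro e he
      exact absurd (hne e) (by rw [Finset.subset_empty.1 he]; simp)
    | insert v V hv ih =>
      exact lt_of_lt_of_le (mul_pos hβ ih) (hstep _ V rfl v hv)
  rwa [Nat.cast_pos, Finset.card_pos] at this

end Rosenfeld

/-- the clauses used at centre `r` -/
def JJ (J : Finset ℤ) (a₀ r : ℤ) : Finset ℤ :=
  if r % 4 = 1 ∨ r % 4 = 2 then J.erase a₀ else J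

open Classical in
lemma exists_bits (J : Finset ℤ) (hJ : J.card = 39) (h0 : ∀ a ∈ J, 0 ≤ a) (n : ℕ) :
    ∃ X : Finset ℤ, ∀ r : ℤ, 0 ≤ r → r ≤ n → ∀ c, ¬ Sat r J c X := by
  obtain ⟨a₀, ha₀, h1⟩ : ∃ a₀ ∈ J, (1:ℤ) ∉ J.erase a₀ := by
    by_cases h : (1:ℤ) ∈ J
    · exact ⟨1, h, by simp⟩
    · obtain ⟨a, ha⟩ : J.Nonempty := by rw [← Finset.card_pos]; omega
      exact ⟨a, ha, fun hh => h (Finset.mem_of_mem_erase hh)⟩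
  have hJe : (J.erase a₀).card = 38 := by rw [Finset.card_erase_of_mem ha₀, hJ]
  set vs : ℤ → Finset ℤ := fun r => vars r (JJ J a₀ r) with hvs
  set Bad : ℤ → Finset ℤ → Prop := fun r X => ∃ c, Sat r (JJ J a₀ r) c X with hBad
  have hloc : ∀ e X Y, X ∩ vs e = Y ∩ vs e → Bad e X → Bad e Y := by
    rintro e X Y h ⟨c, hc⟩
    refine ⟨c, fun a ha => ?_⟩
    have key : ∀ m, vb m ∈ vs e → chi X m = chi Y m := by
      intro m hm
      apply chi_congr
      have := Finset.ext_iff.1 h (vb m)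
      simpa [hm] using this
    rw [← key, ← key]
    · exact hc a ha
    · exact Finset.mem_union_right _ (Finset.mem_image_of_mem (fun a => vb (e - a)) ha)
    · exact Finset.mem_union_left _ (Finset.mem_image_of_mem (fun a => vb (e + a)) ha)
  have hne : ∀ e, (vs e).Nonempty := by
    intro e
    have : (JJ J a₀ e).Nonempty := by
      rw [← Finset.card_pos]; unfold JJ; split_ifs <;> omega
    obtain ⟨a, ha⟩ := this
    exact ⟨_, Finset.mem_union_left _ (Finset.mem_image_of_mem (fun a => vb (e + a)) ha)⟩
  set wt : ℕ → ℝ := fun s => 4 * (3/4) ^ s * (77/76) ^ (2 * s - 1) with hwt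
  set w : ℤ → ℝ := fun r => wt (JJ J a₀ r).card with hw
  set gd : ℤ → ℤ := fun y => if y % 4 = 0 ∨ y % 4 = 3 then y else y + 2 with hgd
  set bd : ℤ → ℤ := fun y => if y % 4 = 0 ∨ y % 4 = 3 then y + 2 else y with hbd
  set TG : ℤ → Finset ℤ := fun v => J.image (fun a => gd (v + a)) ∪ J.image (fun a => gd (v - a)) with hTG
  set TB : ℤ → Finset ℤ := fun v => (J.erase a₀).image (fun a => bd (v + a)) ∪
    (J.erase a₀).image (fun a => bd (v - a)) with hTB
  have hT : ∀ e v, v ∈ vs e → e ∈ TG v ∪ TB v := by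
    intro e v hv
    by_cases he : e % 4 = 1 ∨ e % 4 = 2
    · apply Finset.mem_union_right
      simp only [hvs, vars, JJ, if_pos he, Finset.mem_union, Finset.mem_image] at hv
      simp only [hTB, Finset.mem_union, Finset.mem_image, hbd]
      rcases hv with ⟨a, ha, hv⟩ | ⟨a, ha, hv⟩
      · right; refine ⟨a, ha, ?_⟩
        unfold vb at hv
        split_ifs at hv ⊢ <;> omega
      · left; refine ⟨a, ha, ?_⟩
        unfold vb at hv
        split_ifs at hv ⊢ <;> omega
    · apply Finset.mem_union_left
      simp only [hvs, vars, JJ, if_neg he, Finset.mem_union, Finset.mem_image] at hv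
      simp only [hTG, Finset.mem_union, Finset.mem_image, hgd]
      rcases hv with ⟨a, ha, hv⟩ | ⟨a, ha, hv⟩
      · right; refine ⟨a, ha, ?_⟩
        unfold vb at hv
        split_ifs at hv ⊢ <;> omega
      · left; refine ⟨a, ha, ?_⟩
        unfold vb at hv
        split_ifs at hv ⊢ <;> omega
  have hwt0 : ∀ s, 0 ≤ wt s := fun s => by rw [hwt]; positivity
  have hw0 : ∀ e, 0 ≤ w e := fun e => hwt0 _
  have hsum : ∀ v, ∑ e ∈ TG v ∪ TB v, w e ≤ 2 - (152/77 : ℝ) := by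
    intro v
    have hG : ∑ e ∈ TG v, w e ≤ 78 * wt 39 := by
      have hc : (TG v).card ≤ 78 := by
        have h1 : (J.image (fun a => gd (v + a))).card ≤ 39 := hJ ▸ Finset.card_image_le
        have h2 : (J.image (fun a => gd (v - a))).card ≤ 39 := hJ ▸ Finset.card_image_le
        exact (Finset.card_union_le _ _).trans (by omega)
      have hall : ∀ e ∈ TG v, w e ≤ wt 39 := by
        intro e he
        have : ¬ (e % 4 = 1 ∨ e % 4 = 2) := by
          simp only [hTG, Finset.mem_union, Finset.mem_image, hgd] at he
          rcases he with ⟨a, _, h⟩ | ⟨a, _, h⟩ <;> split_ifs at h <;> omega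
        simp only [hw, JJ, if_neg this, hJ, le_refl]
      have := Finset.sum_le_card_nsmul _ _ _ hall
      rw [nsmul_eq_mul] at this
      refine this.trans (mul_le_mul_of_nonneg_right (by exact_mod_cast hc) (hwt0 _))
    have hB : ∑ e ∈ TB v, w e ≤ 76 * wt 38 := by
      have hc : (TB v).card ≤ 76 := by
        have h1 : ((J.erase a₀).image (fun a => bd (v + a))).card ≤ 38 := hJe ▸ Finset.card_image_le
        have h2 : ((J.erase a₀).image (fun a => bd (v - a))).card ≤ 38 := hJe ▸ Finset.card_image_le
        exact (Finset.card_union_le _ _).trans (by omega)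
      have hall : ∀ e ∈ TB v, w e ≤ wt 38 := by
        intro e he
        have : (e % 4 = 1 ∨ e % 4 = 2) := by
          simp only [hTB, Finset.mem_union, Finset.mem_image, hbd] at he
          rcases he with ⟨a, _, h⟩ | ⟨a, _, h⟩ <;> split_ifs at h <;> omega
        simp only [hw, JJ, if_pos this, hJe, le_refl]
      have := Finset.sum_le_card_nsmul _ _ _ hall
      rw [nsmul_eq_mul] at this
      refine this.trans (mul_le_mul_of_nonneg_right (by exact_mod_cast hc) (hwt0 _))
    have hU : ∑ e ∈ TG v ∪ TB v, w e ≤ ∑ e ∈ TG v, w e + ∑ e ∈ TB v, w e := by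
      rw [← Finset.sum_union_inter]
      exact le_add_of_nonneg_right (Finset.sum_nonneg (fun e _ => hw0 e))
    have hnum : 78 * wt 39 + 76 * wt 38 ≤ 2 - (152/77 : ℝ) := by
      simp only [hwt]; norm_num
    exact hU.trans ((add_le_add hG hB).trans hnum)
  have hN : ∀ e, (((vs e).powerset.filter (Bad e)).card : ℝ) ≤ w e * (152/77 : ℝ) ^ ((vs e).card - 1) := by
    intro e
    set I := JJ J a₀ e with hI
    have hI0 : ∀ a ∈ I, 0 ≤ a := by
      intro a ha
      apply h0
      rw [hI] at ha; unfold JJ at ha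
      split_ifs at ha
      · exact Finset.mem_of_mem_erase ha
      · exact ha
    have hI1 : (e % 4 = 1 ∨ e % 4 = 2) → (1:ℤ) ∉ I := by
      intro h; rw [hI, JJ, if_pos h]; exact h1
    have hcnt := fun c => count_sat e c (vs e) I hI0 hI1 (subset_refl _)
    have hsub : (vs e).powerset.filter (Bad e) ⊆ (vs e).powerset.filter (Sat e I true) ∪
        (vs e).powerset.filter (Sat e I false) := by
      intro X hX
      rw [Finset.mem_filter] at hX
      obtain ⟨hX, c, hc⟩ := hX
      rw [Finset.mem_union, Finset.mem_filter, Finset.mem_filter]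
      cases c
      · exact Or.inr ⟨hX, hc⟩
      · exact Or.inl ⟨hX, hc⟩
    have hcard : ((vs e).powerset.filter (Bad e)).card * 4 ^ I.card ≤ 2 * (3 ^ I.card * 2 ^ (vs e).card) := by
      have := (Finset.card_le_card hsub).trans (Finset.card_union_le _ _)
      have h2 := hcnt true
      have h3 := hcnt false
      calc _ ≤ _ := Nat.mul_le_mul_right _ this
        _ ≤ _ := by rw [add_mul, two_mul]; exact Nat.add_le_add h2 h3
    have hk : (vs e).card ≤ 2 * I.card := by
      refine (Finset.card_union_le _ _).trans ?_
      rw [two_mul]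
      exact Nat.add_le_add Finset.card_image_le Finset.card_image_le
    have hk1 : 1 ≤ (vs e).card := Finset.card_pos.2 (hne e)
    obtain ⟨k, hk2⟩ : ∃ k, (vs e).card = k + 1 := ⟨_, (Nat.sub_add_cancel hk1).symm⟩
    have hcardR : (((vs e).powerset.filter (Bad e)).card : ℝ) * 4 ^ I.card ≤ 2 * (3 ^ I.card * 2 ^ (vs e).card) := by
      exact_mod_cast hcard
    have hle : (((vs e).powerset.filter (Bad e)).card : ℝ) ≤ 4 * (3/4) ^ I.card * 2 ^ k := by
      rw [div_pow]
      have h4 : (0:ℝ) < 4 ^ I.card := by positivity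
      rw [← mul_le_mul_iff_left₀ h4]
      refine hcardR.trans (le_of_eq ?_)
      rw [hk2]
      field_simp
      ring
    refine hle.trans ?_
    change _ ≤ 4 * (3/4) ^ I.card * (77/76) ^ (2 * I.card - 1) * (152/77 : ℝ) ^ ((vs e).card - 1)
    rw [mul_assoc _ ((77/76 : ℝ) ^ _)]
    apply mul_le_mul_of_nonneg_left _ (by positivity)
    rw [hk2, Nat.add_sub_cancel]
    have h22 : (2:ℝ) = 77/76 * (152/77) := by norm_num
    have : (2:ℝ) ^ k = (77/76) ^ k * (152/77) ^ k := by rw [← mul_pow, ← h22]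
    rw [this]
    apply mul_le_mul_of_nonneg_right _ (by positivity)
    exact pow_le_pow_right₀ (by norm_num) (by omega)
  have hstep := rosenfeld vs Bad hloc (152/77) (by norm_num) w (fun v => TG v ∪ TB v) hT
    (fun e => by convert hN e) hw0 hsum
  obtain ⟨X, hX⟩ := rosenfeld' vs Bad hloc (152/77) (by norm_num) hstep hne
    ((Finset.Icc (0:ℤ) n).biUnion vs)
  refine ⟨X, fun r hr0 hrn c hs => ?_⟩
  simp only [good, Finset.mem_filter] at hX
  apply hX.2 r
  · exact Finset.subset_biUnion_of_mem vs (Finset.mem_Icc.2 ⟨hr0, hrn⟩)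
  · refine ⟨c, fun a ha => hs a ?_⟩
    unfold JJ at ha
    split_ifs at ha
    · exact Finset.mem_of_mem_erase ha
    · exact ha

/-- three consecutive positions of the same parity are not monochromatic -/
lemma no_triple (X : Finset ℤ) (m : ℤ) (c : Bool) (h1 : chi X m = c) (h2 : chi X (m + 2) = c)
    (h3 : chi X (m + 4) = c) : False := by
  rw [chi_eq] at h1 h2 h3
  by_cases h : m % 4 < 2
  · have e1 : vb m = m := by unfold vb; simp [h]
    have h' : ¬ (m + 2) % 4 < 2 := by omega
    have e2 : vb (m + 2) = m := by unfold vb; simp [h']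
    rw [e1] at h1; rw [e2] at h2
    tauto
  · have h'' : (m + 2) % 4 < 2 := by omega
    have e1 : vb (m + 2) = m + 2 := by unfold vb; simp [h'']
    have h' : ¬ (m + 4) % 4 < 2 := by omega
    have e2 : vb (m + 4) = m + 2 := by unfold vb; rw [if_neg h']; ring
    rw [e1] at h2; rw [e2] at h3
    tauto

set_option maxHeartbeats 2000000 in
lemma embedding_structure {d n : ℕ} (ψ : Finset (Fin d) → Finset (Fin n)) (h : IsCubeEmbedding ψ) :
    ∃ f : Fin d → Fin n, Function.Injective f ∧
      ∀ A, ψ A = symmDiff (ψ ∅) (A.image f) := by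
  obtain ⟨hinj, hadj⟩ := h
  have h1 : ∀ j : Fin d, ∃ y, symmDiff (ψ ∅) (ψ {j}) = {y} := by
    intro j
    exact Finset.card_eq_one.1 (hadj ∅ {j} (by simp [← Finset.bot_eq_empty]))
  choose f hf using h1
  have hf' : ∀ j, ψ {j} = symmDiff (ψ ∅) {f j} := by
    intro j; rw [← hf j, symmDiff_symmDiff_cancel_left]
  have hfi : Function.Injective f := by
    intro i j hij
    have : ψ {i} = ψ {j} := by rw [hf', hf', hij]
    simpa using hinj this
  refine ⟨f, hfi, ?_⟩
  intro A
  induction hk : A.card using Nat.strong_induction_on generalizing A with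
  | _ k IH =>
  rcases Nat.lt_or_ge A.card 2 with hlt | hge
  · rcases Nat.lt_or_ge A.card 1 with h0 | h0
    · have : A = ∅ := by rw [← Finset.card_eq_zero]; omega
      subst this; rw [Finset.image_empty]; exact (symmDiff_bot _).symm
    · obtain ⟨j, rfl⟩ := Finset.card_eq_one.1 (show A.card = 1 by omega)
      rw [hf' j, Finset.image_singleton]
  · obtain ⟨x, hx, y, hy, hxy⟩ := Finset.one_lt_card.1 (show 1 < A.card by omega)
    have hAx : symmDiff A (A.erase x) = {x} := by
      ext z; simp only [Finset.mem_symmDiff, Finset.mem_erase, Finset.mem_singleton]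
      by_cases hz : z = x
      · subst hz; simp [hx]
      · simp [hz]
    have hAy : symmDiff A (A.erase y) = {y} := by
      ext z; simp only [Finset.mem_symmDiff, Finset.mem_erase, Finset.mem_singleton]
      by_cases hz : z = y
      · subst hz; simp [hy]
      · simp [hz]
    obtain ⟨u, hu⟩ := Finset.card_eq_one.1 (hadj A (A.erase x) (by rw [hAx]; simp))
    obtain ⟨w, hw⟩ := Finset.card_eq_one.1 (hadj A (A.erase y) (by rw [hAy]; simp))
    have hcx : (A.erase x).card = A.card - 1 := Finset.card_erase_of_mem hx
    have hcy : (A.erase y).card = A.card - 1 := Finset.card_erase_of_mem hy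
    have hyx : y ∈ A.erase x := Finset.mem_erase.2 ⟨hxy.symm, hy⟩
    have hcxy : ((A.erase x).erase y).card = A.card - 1 - 1 := by
      rw [Finset.card_erase_of_mem hyx, hcx]
    have ix := IH _ (by omega) (A.erase x) rfl
    have iy := IH _ (by omega) (A.erase y) rfl
    have ixy := IH _ (by omega) ((A.erase x).erase y) rfl
    have hneq : ψ A ≠ ψ ((A.erase x).erase y) := by
      intro he
      have := hinj he
      rw [← this] at hcxy; omega
    rw [ix] at hu
    rw [iy] at hw
    rw [ixy] at hneq
    have Mx : ∀ z, z ∈ (A.erase x).image f ↔ z ≠ f x ∧ z ∈ A.image f := by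
      intro z; rw [Finset.image_erase hfi, Finset.mem_erase]
    have My : ∀ z, z ∈ (A.erase y).image f ↔ z ≠ f y ∧ z ∈ A.image f := by
      intro z; rw [Finset.image_erase hfi, Finset.mem_erase]
    have Mxy : ∀ z, z ∈ ((A.erase x).erase y).image f ↔ z ≠ f y ∧ z ≠ f x ∧ z ∈ A.image f := by
      intro z; rw [Finset.image_erase hfi, Finset.mem_erase, Mx]
    have hfx : f x ∈ A.image f := Finset.mem_image_of_mem f hx
    have hfy : f y ∈ A.image f := Finset.mem_image_of_mem f hy
    have hfxy : f x ≠ f y := fun h => hxy (hfi h)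
    have hu' : ∀ z, (z ∈ ψ A ↔ (z ∈ ψ ∅ ↔ ¬ (z ≠ f x ∧ z ∈ A.image f))) ↔ z ≠ u := by
      intro z
      have := Finset.ext_iff.1 hu z
      simp only [Finset.mem_symmDiff, Mx, Finset.mem_singleton] at this
      tauto
    have hw' : ∀ z, (z ∈ ψ A ↔ (z ∈ ψ ∅ ↔ ¬ (z ≠ f y ∧ z ∈ A.image f))) ↔ z ≠ w := by
      intro z
      have := Finset.ext_iff.1 hw z
      simp only [Finset.mem_symmDiff, My, Finset.mem_singleton] at this
      tauto
    by_cases hux : u = f x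
    · -- good case
      subst hux
      ext z
      rw [Finset.mem_symmDiff]
      have := hu' z
      by_cases hz : z = f x
      · subst hz; tauto
      · tauto
    · exfalso
      have huy : u = f y := by
        have hwx : w = f x := by
          by_contra hne
          have a1 := (hu' (f x)).2 (fun h => hux h.symm)
          have a2 := (hw' (f x)).2 (fun h => hne h.symm)
          simp only [ne_eq, not_true_eq_false, false_and, not_false_eq_true, hfxy, hfx, and_self,
            iff_true, iff_false] at a1 a2
          clear hu' hw' Mx My Mxy hneq
          tauto
        by_contra hne
        have a1 := (hu' (f y)).2 (fun h => hne h.symm)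
        have a2 := (hw' (f y)).2 (fun h => hfxy (h.trans hwx).symm)
        simp only [ne_eq, not_true_eq_false, false_and, not_false_eq_true, hfxy.symm, hfy, and_self,
          iff_true, iff_false] at a1 a2
        clear hu' hw' Mx My Mxy hneq
        tauto
      apply hneq
      ext z
      rw [Finset.mem_symmDiff, Mxy]
      have := hu' z
      have hyx' := hfxy.symm
      rw [huy] at this
      clear hu' hw' Mx My Mxy hneq hu hw ix iy ixy IH hcx hcy hcxy hyx hAx hAy hadj hf hf'
      by_cases hz : z = f y
      · rw [hz] at this ⊢
        simp only [ne_eq, hyx', not_false_eq_true, hfy, and_self, not_true_eq_false, iff_false,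
          false_and, and_false, and_true, or_false] at this ⊢
        by_cases h1 : f y ∈ ψ A <;> by_cases h2 : f y ∈ ψ ∅ <;> simp [h1, h2] at this ⊢
      · simp only [ne_eq, hz, not_false_eq_true, iff_true, true_and] at this ⊢
        by_cases h1 : z ∈ ψ A <;> by_cases h2 : z ∈ ψ ∅ <;> simp only [h1, h2] at this ⊢ <;> tauto

lemma exists_sub {α : Type*} [DecidableEq α] (K P : Finset α) (hP : P ⊆ K) (a j : ℕ)
    (hj : j ≤ P.card) (hja : j ≤ a) (haj : a - j ≤ (K \ P).card) :
    ∃ A ∈ K.powersetCard a, (A ∩ P).card = j := by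
  obtain ⟨A1, h1, c1⟩ := Finset.exists_subset_card_eq hj
  obtain ⟨A2, h2, c2⟩ := Finset.exists_subset_card_eq haj
  have hdis : Disjoint A1 A2 :=
    Finset.disjoint_of_subset_left h1 (Finset.disjoint_of_subset_right h2 Finset.disjoint_sdiff)
  refine ⟨A1 ∪ A2, ?_, ?_⟩
  · rw [Finset.mem_powersetCard]
    refine ⟨Finset.union_subset (h1.trans hP) (h2.trans Finset.sdiff_subset), ?_⟩
    rw [Finset.card_union_of_disjoint hdis]; omega
  · rw [← c1]; congr 1
    ext z
    simp only [Finset.mem_inter, Finset.mem_union]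
    constructor
    · rintro ⟨h | h, h'⟩
      · exact h
      · exact absurd h' (Finset.mem_sdiff.1 (h2 h)).2
    · intro h; exact ⟨Or.inl h, h1 h⟩

lemma card_symmDiff_image {d n : ℕ} (B : Finset (Fin n)) (f : Fin d → Fin n)
    (hf : Function.Injective f) (A P : Finset (Fin d)) (hP : ∀ z ∈ A, z ∈ P ↔ f z ∈ B) :
    ((symmDiff B (A.image f)).card : ℤ) = B.card + A.card - 2 * (A ∩ P).card := by
  have h1 : (B ∩ A.image f) = (A ∩ P).image f := by
    ext z
    simp only [Finset.mem_inter, Finset.mem_image]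
    constructor
    · rintro ⟨hz, x, hx, rfl⟩
      exact ⟨x, ⟨hx, (hP x hx).2 hz⟩, rfl⟩
    · rintro ⟨x, ⟨hx, hxP⟩, rfl⟩
      exact ⟨(hP x hx).1 hxP, x, hx, rfl⟩
  have h2 : (B ∩ A.image f).card = (A ∩ P).card := by
    rw [h1, Finset.card_image_of_injective _ hf]
  have h3 : (A.image f).card = A.card := Finset.card_image_of_injective _ hf
  have h4 : (symmDiff B (A.image f)).card = (B \ A.image f).card + (A.image f \ B).card := by
    rw [symmDiff_def, Finset.sup_eq_union, Finset.card_union_of_disjoint]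
    exact disjoint_sdiff_sdiff
  have h5 := Finset.card_sdiff_add_card_inter B (A.image f)
  have h6 := Finset.card_sdiff_add_card_inter (A.image f) B
  rw [Finset.inter_comm] at h6
  omega

end CliqueProof

/-- Theorem 18 (lll:thm): if `S ⊆ V_d` is the vertex disjoint union of `s ≥ 39` cliques
`K^{(a_1)}_{a_1+t_1}, …, K^{(a_s)}_{a_s+t_s}` of pairwise distinct weights, and each
`t i ≥ 2`, then `S` is not `2`-Ramsey. -/
theorem not_ramsey_of_many_cliques (s : ℕ) (hs : 39 ≤ s) (d : ℕ)
    (a tt : Fin s → ℕ) (K : Fin s → Finset (Fin d))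
    (hK : ∀ i, (K i).card = a i + tt i)
    (hdisj : ∀ i j, i ≠ j → Disjoint (K i) (K j))
    (ha : Function.Injective a)
    (htt : ∀ i, 2 ≤ tt i) :
    ¬ IsRamsey 2 d (⋃ i, ↑((K i).powersetCard (a i))) := by
  open CliqueProof in
  rintro ⟨n, hn⟩
  have hc : 39 ≤ (Finset.univ.image (fun i => (a i : ℤ))).card := by
    rw [Finset.card_image_of_injective _ (fun i j h => ha (by exact_mod_cast h))]
    rw [Finset.card_univ, Fintype.card_fin]; exact hs
  obtain ⟨J, hJs, hJ⟩ := Finset.exists_subset_card_eq hc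
  have hJa : ∀ b ∈ J, ∃ i, (a i : ℤ) = b := by
    intro b hb
    obtain ⟨i, -, hi⟩ := Finset.mem_image.1 (hJs hb)
    exact ⟨i, hi⟩
  obtain ⟨X, hX⟩ := exists_bits J hJ (fun b hb => by obtain ⟨i, rfl⟩ := hJa b hb; positivity) n
  obtain ⟨col, ψ, hψ, hmono⟩ := hn n le_rfl (fun A => if chi X (A.card : ℤ) then 1 else 0)
  obtain ⟨f, hf, hform⟩ := embedding_structure ψ hψ
  set B := ψ ∅ with hB
  obtain ⟨c, hcol⟩ : ∃ c : Bool, ∀ m : ℤ, (if chi X m then (1 : Fin 2) else 0) = col → chi X m = c := by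
    refine ⟨decide (col = 1), fun m hm => ?_⟩
    subst hm
    cases chi X m <;> simp
  have hBn : B.card ≤ n := (Finset.card_le_univ B).trans (Fintype.card_fin n).le
  refine hX B.card (Int.natCast_nonneg _) (Int.ofNat_le.2 hBn) c ?_
  intro b hb
  obtain ⟨i, rfl⟩ := hJa b hb
  set P := (K i).filter (fun z => f z ∈ B) with hP
  have hPK : P ⊆ K i := Finset.filter_subset _ _
  have hcards := Finset.card_sdiff_add_card_eq_card hPK
  rw [hK i] at hcards
  have ht := htt i
  have main : ∀ j, j ≤ P.card → j ≤ a i → a i - j ≤ (K i \ P).card →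
      chi X ((B.card : ℤ) + a i - 2 * j) = c := by
    intro j h1 h2 h3
    obtain ⟨A, hA, hAj⟩ := exists_sub (K i) P hPK (a i) j h1 h2 h3
    have hm := hmono A (Set.mem_iUnion.2 ⟨i, hA⟩)
    have hm2 := hcol _ hm
    rw [hform A] at hm2
    rw [Finset.mem_powersetCard] at hA
    rw [card_symmDiff_image B f hf A P (fun z hz => by simp [hP, hA.1 hz]), hA.2, hAj] at hm2
    exact hm2
  by_cases hQ : a i ≤ (K i \ P).card
  · left
    have := main 0 (by omega) (by omega) (by omega)
    simpa using this
  by_cases hPP : a i ≤ P.card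
  · right
    have := main (a i) (by omega) (by omega) (by omega)
    rw [← this]; congr 1; ring
  exfalso
  have m0 := main P.card (by omega) (by omega) (by omega)
  have m1 := main (P.card - 1) (by omega) (by omega) (by omega)
  have m2 := main (P.card - 2) (by omega) (by omega) (by omega)
  refine no_triple X ((B.card : ℤ) + a i - 2 * P.card) c m0 ?_ ?_
  · rw [← m1]; congr 1; omega
  · rw [← m2]; congr 1; omega
end
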